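/- Let σ be a rational cone in V*, let {σ'} be a subdivision of σ, and let s ∈ V_ℚ. Then μ_s^*(σ) = Σ_{σ' : dim σ' = dim σ} μ_s^*(σ'), where for a cone τ ⊂ V*, μ_s^*(τ) := μ(π_{<τ>^⊥}(s + τ*)), with τ* ⊂ V the dual cone of τ, <τ>^⊥ ⊂ V the annihilator of the span of τ, and π_{<τ>^⊥} : V → V/<τ>^⊥ the projection. -/

import Mathlib

open MeasureTheory Filter Topology Set
open scoped RealInnerProductSpace Pointwise BigOperators

noncomputable section

/-- the ambient rational vector space: `ℝ^d` with the standard inner product, which is used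
to identify `V` with its dual space `V^*`. -/
abbrev Vd (d : ℕ) := EuclideanSpace ℝ (Fin d)

variable {d : ℕ}

/-- the duality pairing `⟨ξ, x⟩` between `V^*` and `V`, realized by the standard inner
product of `ℝ^d`. -/
def pairE {d : ℕ} (ξ x : Vd d) : ℝ := @inner ℝ _ _ ξ x

/-- `Λ` is a lattice of its span: it is generated by finitely many `ℝ`-independent vectors. -/
def IsLatticeSub (Λ : AddSubgroup (Vd d)) : Prop :=
  ∃ (k : ℕ) (v : Fin k → Vd d), LinearIndependent ℝ v ∧
    Λ = AddSubgroup.closure (Set.range v)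

/-- `Λ` is a full-rank lattice in `ℝ^d`. -/
def IsFullLattice (Λ : AddSubgroup (Vd d)) : Prop :=
  IsLatticeSub Λ ∧ Submodule.span ℝ (Λ : Set (Vd d)) = ⊤

/-- `x` is a rational point with respect to the lattice `Λ`. -/
def IsRatPoint (Λ : AddSubgroup (Vd d)) (x : Vd d) : Prop :=
  ∃ q : ℤ, q ≠ 0 ∧ (q : ℝ) • x ∈ Λ

/-- viewing `φ ∈ V` as a linear functional via the standard pairing, it takes integer values
on `Λ`, i.e. it belongs to the dual lattice. -/
def IsDualIntegral (Λ : AddSubgroup (Vd d)) (φ : Vd d) : Prop :=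
  ∀ x ∈ Λ, ∃ n : ℤ, (pairE (φ) (x)) = (n : ℝ)

/-- a rational polyhedron (inside the span of `Λ`): a finite intersection of half-spaces
bounded by rational affine hyperplanes. -/
def IsRatPolyhedron (Λ : AddSubgroup (Vd d)) (P : Set (Vd d)) : Prop :=
  ∃ (n : ℕ) (φ : Fin n → Vd d) (c : Fin n → ℚ),
    (∀ i, IsDualIntegral Λ (φ i)) ∧
    P = {x | x ∈ Submodule.span ℝ (Λ : Set (Vd d)) ∧ ∀ i, (pairE (φ i) x) ≤ (c i : ℝ)}

/-- the set `P` contains a straight (affine) line. -/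
def ContainsLine (P : Set (Vd d)) : Prop :=
  ∃ x u : Vd d, u ≠ 0 ∧ ∀ t : ℝ, x + t • u ∈ P

/-- equality of meromorphic-type functions near `0`: they agree near `0` outside a closed
set with empty interior (the polar set). -/
def MeroEqAt0 (f g : Vd d → ℝ) : Prop :=
  ∃ Z : Set (Vd d), IsClosed Z ∧ interior Z = ∅ ∧
    ∀ᶠ ξ in 𝓝 (0 : Vd d), ξ ∉ Z → f ξ = g ξ

/-- `g` is analytic at `0` and its Taylor coefficients are rational with respect to an
integral basis (i.e. the coefficients take rational values on dual-lattice vectors). -/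
def HasRatSeriesAt0 (Λ : AddSubgroup (Vd d)) (g : Vd d → ℝ) : Prop :=
  ∃ p : FormalMultilinearSeries ℝ (Vd d) ℝ, HasFPowerSeriesAt g p 0 ∧
    ∀ (n : ℕ) (w : Fin n → Vd d), (∀ i, IsDualIntegral Λ (w i)) →
      ∃ q : ℚ, (p n) w = (q : ℝ)

/-- `f` is meromorphic near `0` with rational Taylor coefficients: near `0` it is a quotient
of two analytic functions with rational Taylor coefficients. -/
def RatMeromorphicAt0 (Λ : AddSubgroup (Vd d)) (f : Vd d → ℝ) : Prop :=
  ∃ g h : Vd d → ℝ, HasRatSeriesAt0 Λ g ∧ HasRatSeriesAt0 Λ h ∧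
    (¬ ∀ᶠ ξ in 𝓝 (0 : Vd d), h ξ = 0) ∧
    (∀ᶠ ξ in 𝓝 (0 : Vd d), h ξ ≠ 0 → f ξ * h ξ = g ξ)

/-- `m` is the canonical Lebesgue measure carried by the rational affine subspace `A`,
normalized so that a fundamental parallelepiped of the lattice `Λ ∩ lin(A)` has volume `1`:
it is the image of the standard Lebesgue measure under a `ℤ`-basis parametrization. -/
def IsCanonicalMeasure (Λ : AddSubgroup (Vd d)) (A : Set (Vd d)) (m : Measure (Vd d)) : Prop :=
  ∃ (k : ℕ) (x₀ : Vd d) (v : Fin k → Vd d),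
    x₀ ∈ A ∧ (∀ i, v i ∈ Λ) ∧ LinearIndependent ℝ v ∧
    A = {x | ∃ t : Fin k → ℝ, x = x₀ + ∑ i, t i • v i} ∧
    (∀ y ∈ Λ, y ∈ Submodule.span ℝ (Set.range v) →
      ∃ c : Fin k → ℤ, y = ∑ i, (c i : ℝ) • v i) ∧
    m = Measure.map (fun t : Fin k → ℝ => x₀ + ∑ i, t i • v i) volume

/-- the characterizing properties of the map `I`: it sends rational polyhedra to meromorphic
functions with rational coefficients, vanishes on polyhedra containing lines, and is given by
`∫_P e^{⟨ξ,x⟩} dm_{<P>}(x)` wherever this integral converges. -/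
def IsIMap (Λ : AddSubgroup (Vd d)) (I : Set (Vd d) → Vd d → ℝ) : Prop :=
  (∀ P, IsRatPolyhedron Λ P → RatMeromorphicAt0 Λ (I P)) ∧
  (∀ P, IsRatPolyhedron Λ P → ContainsLine P → ∀ ξ, I P ξ = 0) ∧
  (∀ P, IsRatPolyhedron Λ P → ∀ m : Measure (Vd d),
    IsCanonicalMeasure Λ ((affineSpan ℝ P : AffineSubspace ℝ (Vd d)) : Set (Vd d)) m →
    ∀ ξ : Vd d, IntegrableOn (fun x => Real.exp (pairE (ξ) (x))) P m →
      I P ξ = ∫ x in P, Real.exp (pairE (ξ) (x)) ∂m)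

/-- the characterizing properties of the map `S`: it sends rational polyhedra to meromorphic
functions with rational coefficients, vanishes on polyhedra containing lines, and is given by
`∑_{x ∈ P ∩ Λ} e^{⟨ξ,x⟩}` wherever this sum converges absolutely. -/
def IsSMap (Λ : AddSubgroup (Vd d)) (S : Set (Vd d) → Vd d → ℝ) : Prop :=
  (∀ P, IsRatPolyhedron Λ P → RatMeromorphicAt0 Λ (S P)) ∧
  (∀ P, IsRatPolyhedron Λ P → ContainsLine P → ∀ ξ, S P ξ = 0) ∧
  (∀ P, IsRatPolyhedron Λ P → ∀ ξ : Vd d,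
    Summable (fun x : ↥(P ∩ (Λ : Set (Vd d))) => Real.exp (pairE ξ (x : Vd d))) →
      S P ξ = ∑' x : ↥(P ∩ (Λ : Set (Vd d))), Real.exp (pairE ξ (x : Vd d)))

/-- `F` is a (nonempty, exposed) face of the convex set `P`. -/
def IsFaceOf (P F : Set (Vd d)) : Prop :=
  F.Nonempty ∧ ∃ φ : Vd d, F = {x ∈ P | ∀ y ∈ P, (pairE (φ) (y)) ≤ (pairE (φ) (x))}

/-- `v` is a vertex of `P`. -/
def IsVertexOf (P : Set (Vd d)) (v : Vd d) : Prop := IsFaceOf P {v}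

/-- the cone of feasible directions of `P` along the face `F` (computed at a point of the
relative interior of `F`). -/
def feasibleCone (P F : Set (Vd d)) : Set (Vd d) :=
  {u | ∃ x ∈ intrinsicInterior ℝ F, ∃ ε : ℝ, 0 < ε ∧ ∀ t : ℝ, 0 < t → t ≤ ε → x + t • u ∈ P}

/-- the supporting cone `<F> + c(P,F)` of `P` along its face `F`. -/
def suppCone (P F : Set (Vd d)) : Set (Vd d) :=
  {z | ∃ a ∈ (affineSpan ℝ F : Set (Vd d)), ∃ u ∈ feasibleCone P F, z = a + u}

/-- the recession cone (cone of directions) of a convex set. -/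
def recCone (P : Set (Vd d)) : Set (Vd d) :=
  {u | ∀ x ∈ P, ∀ t : ℝ, 0 ≤ t → x + t • u ∈ P}

/-- a rational affine cone with respect to the lattice `Λ`: a rational translate of a cone
generated by finitely many lattice vectors. -/
def IsRatAffineCone (Λ : AddSubgroup (Vd d)) (a : Set (Vd d)) : Prop :=
  ∃ (s : Vd d) (n : ℕ) (v : Fin n → Vd d), IsRatPoint Λ s ∧ (∀ i, v i ∈ Λ) ∧
    a = {x | ∃ t : Fin n → ℝ, (∀ i, 0 ≤ t i) ∧ x = s + ∑ i, t i • v i}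

/-- a rational (convex polyhedral) cone with vertex at the origin. -/
def IsRatCone (Λ : AddSubgroup (Vd d)) (c : Set (Vd d)) : Prop :=
  ∃ (n : ℕ) (v : Fin n → Vd d), (∀ i, v i ∈ Λ) ∧
    c = {x | ∃ t : Fin n → ℝ, (∀ i, 0 ≤ t i) ∧ x = ∑ i, t i • v i}

/-- `Q` is a rational scalar product: a symmetric positive definite bilinear form taking
rational values on lattice vectors. -/
def IsRatInner (Λ : AddSubgroup (Vd d)) (Q : Vd d →ₗ[ℝ] Vd d →ₗ[ℝ] ℝ) : Prop :=
  (∀ x y, Q x y = Q y x) ∧ (∀ x : Vd d, x ≠ 0 → 0 < Q x x) ∧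
  (∀ x ∈ Λ, ∀ y ∈ Λ, ∃ q : ℚ, Q x y = (q : ℝ))

/-- `π` realizes the quotient map `V → V/L` as the `Q`-orthogonal projection onto the
`Q`-orthogonal complement of `L`. -/
def IsQCoproj (Q : Vd d →ₗ[ℝ] Vd d →ₗ[ℝ] ℝ) (L : Submodule ℝ (Vd d))
    (π : Vd d →ₗ[ℝ] Vd d) : Prop :=
  (∀ x, x - π x ∈ L) ∧ (∀ x : Vd d, ∀ y ∈ L, Q (π x) y = 0)

/-- `Λ'` is the lattice of a rational quotient space of `(V, Λ)`, realized inside `V` via the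
`Q`-orthogonal projection along a rational subspace. -/
def IsQuotLattice (Q : Vd d →ₗ[ℝ] Vd d →ₗ[ℝ] ℝ) (Λ Λ' : AddSubgroup (Vd d)) : Prop :=
  ∃ (L : Submodule ℝ (Vd d)) (π : Vd d →ₗ[ℝ] Vd d),
    Submodule.span ℝ ((L : Set (Vd d)) ∩ (Λ : Set (Vd d))) = L ∧
    IsQCoproj Q L π ∧ Λ' = AddSubgroup.map π.toAddMonoidHom Λ

/-- a family of maps `I` indexed by the rational quotient spaces of `(V,Λ)`, each member
satisfying the characterizing properties of the integral generating function. -/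
def IsIFamily (Q : Vd d →ₗ[ℝ] Vd d →ₗ[ℝ] ℝ) (Λ : AddSubgroup (Vd d))
    (I : AddSubgroup (Vd d) → Set (Vd d) → Vd d → ℝ) : Prop :=
  ∀ Λ', IsQuotLattice Q Λ Λ' → IsIMap Λ' (I Λ')

/-- a family of maps `S` indexed by the rational quotient spaces of `(V,Λ)`, each member
satisfying the characterizing properties of the lattice-point generating function. -/
def IsSFamily (Q : Vd d →ₗ[ℝ] Vd d →ₗ[ℝ] ℝ) (Λ : AddSubgroup (Vd d))
    (S : AddSubgroup (Vd d) → Set (Vd d) → Vd d → ℝ) : Prop :=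
  ∀ Λ', IsQuotLattice Q Λ Λ' → IsSMap Λ' (S Λ')

/-- the defining properties (a),(b),(c) of the family `μ` of Berline--Vergne:
each `μ(a)` is meromorphic with rational coefficients near `0`, `μ_{0}({0}) = 1`, and for
every pointed rational affine cone `a` in a rational quotient `W` of `V` one has
`S(a) = ∑_{f ∈ F(a)} μ(t(a,f)) I(f)`, where the transverse cone `t(a,f)` is realized inside
`V` by the `Q`-orthogonal projection `π F` along `lin(f)`, and functions on quotient duals
are extended by `Q`-orthogonal projection. -/
def IsMuCore (Λ : AddSubgroup (Vd d)) (Q : Vd d →ₗ[ℝ] Vd d →ₗ[ℝ] ℝ)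
    (I S μ : AddSubgroup (Vd d) → Set (Vd d) → Vd d → ℝ) : Prop :=
  (∀ Λ', IsQuotLattice Q Λ Λ' → ∀ a, IsRatAffineCone Λ' a → ¬ ContainsLine a →
      RatMeromorphicAt0 Λ' (μ Λ' a)) ∧
  (∀ ξ, μ ⊥ ({0} : Set (Vd d)) ξ = 1) ∧
  (∀ Λ', IsQuotLattice Q Λ Λ' → ∀ a, IsRatAffineCone Λ' a → ¬ ContainsLine a →
    ∀ π : Set (Vd d) → (Vd d →ₗ[ℝ] Vd d),
      (∀ F, IsFaceOf a F → IsQCoproj Q (affineSpan ℝ F).direction (π F)) →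
      MeroEqAt0 (S Λ' a)
        (fun ξ => ∑ᶠ F ∈ {F | IsFaceOf a F},
          μ (AddSubgroup.map (π F).toAddMonoidHom Λ') ((π F) '' suppCone a F) ξ
            * I Λ' F ξ))

/-- the family `μ`, extended by `μ(a) = 0` on cones containing a straight line. -/
def IsMuFamily (Λ : AddSubgroup (Vd d)) (Q : Vd d →ₗ[ℝ] Vd d →ₗ[ℝ] ℝ)
    (I S μ : AddSubgroup (Vd d) → Set (Vd d) → Vd d → ℝ) : Prop :=
  IsMuCore Λ Q I S μ ∧
  (∀ Λ', IsQuotLattice Q Λ Λ' → ∀ a, IsRatAffineCone Λ' a → ContainsLine a →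
    ∀ ξ, μ Λ' a ξ = 0)

/-- the trace pairing of two `n`-multilinear forms on `ℝ^d`, computed in the standard basis. -/
def multiPair {n : ℕ} (p q : ContinuousMultilinearMap ℝ (fun _ : Fin n => Vd d) ℝ) : ℝ :=
  ∑ ι : Fin n → Fin d,
    p (fun j => (EuclideanSpace.basisFun (Fin d) ℝ) (ι j)) *
    q (fun j => (EuclideanSpace.basisFun (Fin d) ℝ) (ι j))

/-- the action on `h` of the infinite-order constant-coefficient differential operator whose
symbol has Taylor series `p` at `0`; on polynomials `h` the sum is finite.  Its defining
property is `D(Φ)e^{⟨ξ,·⟩} = Φ(ξ)e^{⟨ξ,·⟩}`. -/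
def DOp (p : FormalMultilinearSeries ℝ (Vd d) ℝ) (h : Vd d → ℝ) (x : Vd d) : ℝ :=
  ∑ᶠ n : ℕ, multiPair (p n) (iteratedFDeriv ℝ n h x)

/-- `h` is a polynomial function on `ℝ^d`. -/
def IsPolyFun (h : Vd d → ℝ) : Prop :=
  ∃ p : MvPolynomial (Fin d) ℝ, ∀ x : Vd d, h x = MvPolynomial.eval (fun i => x i) p

/-- `h` is a polynomial function of degree at most `r` on `ℝ^d`. -/
def IsPolyFunOfDeg (h : Vd d → ℝ) (r : ℕ) : Prop :=
  ∃ p : MvPolynomial (Fin d) ℝ, p.totalDegree ≤ r ∧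
    ∀ x : Vd d, h x = MvPolynomial.eval (fun i => x i) p

end

/-- the dual lattice `Λ^* ⊂ V^*` of `Λ`. -/
noncomputable def dualLattice {d : ℕ} (Λ : AddSubgroup (Vd d)) : AddSubgroup (Vd d) where
  carrier := {ξ | ∀ x ∈ Λ, ∃ n : ℤ, pairE ξ x = (n : ℝ)}
  zero_mem' := by
    intro x hx
    exact ⟨0, by simp [pairE]⟩
  add_mem' := by
    intro a b ha hb x hx
    obtain ⟨n, hn⟩ := ha x hx
    obtain ⟨m, hm⟩ := hb x hx
    refine ⟨n + m, ?_⟩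
    simp only [pairE] at *
    rw [inner_add_left, hn, hm]
    push_cast
    ring
  neg_mem' := by
    intro a ha x hx
    obtain ⟨n, hn⟩ := ha x hx
    refine ⟨-n, ?_⟩
    simp only [pairE] at *
    rw [inner_neg_left, hn]
    push_cast
    ring

/-- the dual cone `σ^* ⊆ V` of a cone `σ ⊆ V^*`. -/
def dualConeSet {d : ℕ} (σ : Set (Vd d)) : Set (Vd d) :=
  {x | ∀ ξ ∈ σ, 0 ≤ pairE ξ x}


open MeasureTheory Filter Topology Set
open scoped RealInnerProductSpace Pointwise BigOperators

/-! ### Rational cones: Fourier-Motzkin elimination -/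

/-- the cone generated by a list of vectors -/
def coneOf {d : ℕ} : List (Vd d) → Set (Vd d)
  | [] => {0}
  | v :: l => {x | ∃ t : ℝ, 0 ≤ t ∧ x - t • v ∈ coneOf l}

/-- the cone cut out by a list of linear inequalities -/
def hset {d : ℕ} (l : List (Vd d)) : Set (Vd d) := {x | ∀ g ∈ l, 0 ≤ ⟪g, x⟫}

/-- integral pairing of two groups -/
def IntPair {d : ℕ} (A B : AddSubgroup (Vd d)) : Prop :=
  ∀ a ∈ A, ∀ b ∈ B, ∃ n : ℤ, ⟪a, b⟫ = (n : ℝ)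

theorem IntPair.symm {d : ℕ} {A B : AddSubgroup (Vd d)} (h : IntPair A B) : IntPair B A := by
  intro a ha b hb
  obtain ⟨n, hn⟩ := h b hb a ha
  exact ⟨n, by rw [real_inner_comm]; exact hn⟩

theorem coneOf_zero_mem {d : ℕ} (l : List (Vd d)) : (0 : Vd d) ∈ coneOf l := by
  induction l with
  | nil => simp [coneOf]
  | cons v l ih => exact ⟨0, le_rfl, by simpa using ih⟩

theorem coneOf_add {d : ℕ} (l : List (Vd d)) : ∀ {x y : Vd d}, x ∈ coneOf l → y ∈ coneOf l →
    x + y ∈ coneOf l := by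
  induction l with
  | nil => intro x y hx hy; simp [coneOf] at *; simp [hx, hy]
  | cons v l ih =>
    rintro x y ⟨t, ht, hx⟩ ⟨u, hu, hy⟩
    refine ⟨t + u, by positivity, ?_⟩
    have := ih hx hy
    convert this using 1
    module

theorem coneOf_smul {d : ℕ} (l : List (Vd d)) : ∀ {x : Vd d} {c : ℝ}, 0 ≤ c → x ∈ coneOf l →
    c • x ∈ coneOf l := by
  induction l with
  | nil => intro x y hx hy; simp [coneOf] at *; simp [hy]
  | cons v l ih =>
    rintro x c hc ⟨t, ht, hx⟩
    refine ⟨c * t, by positivity, ?_⟩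
    have := ih hc hx
    convert this using 1
    module

theorem coneOf_mem {d : ℕ} (l : List (Vd d)) : ∀ v ∈ l, v ∈ coneOf l := by
  induction l with
  | nil => simp
  | cons v l ih =>
    intro w hw
    rcases List.mem_cons.1 hw with rfl | hw
    · exact ⟨1, by norm_num, by simpa using coneOf_zero_mem l⟩
    · exact ⟨0, le_rfl, by simpa using ih w hw⟩

theorem coneOf_le {d : ℕ} (l : List (Vd d)) (K : Set (Vd d)) (h0 : (0 : Vd d) ∈ K)
    (hadd : ∀ x ∈ K, ∀ y ∈ K, x + y ∈ K) (hsm : ∀ c : ℝ, 0 ≤ c → ∀ x ∈ K, c • x ∈ K)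
    (hl : ∀ v ∈ l, v ∈ K) : coneOf l ⊆ K := by
  induction l with
  | nil => intro x hx; simp [coneOf] at hx; simpa [hx] using h0
  | cons v l ih =>
    rintro x ⟨t, ht, hx⟩
    have h1 := ih (fun w hw => hl w (List.mem_cons_of_mem _ hw)) hx
    have h2 := hsm t ht v (hl v List.mem_cons_self)
    have := hadd _ h1 _ h2
    simpa using this

theorem coneOf_inner {d : ℕ} (l : List (Vd d)) (g : Vd d) (hl : ∀ v ∈ l, 0 ≤ ⟪g, v⟫) :
    ∀ x ∈ coneOf l, 0 ≤ ⟪g, x⟫ := by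
  have := coneOf_le l {x | 0 ≤ ⟪g, x⟫} (by simp) (by
    intro x hx y hy; simp only [mem_setOf_eq, inner_add_right] at *; linarith) (by
    intro c hc x hx; simp only [mem_setOf_eq, inner_smul_right] at *; positivity) hl
  exact this

theorem coneOf_span {d : ℕ} (l : List (Vd d)) (L : Submodule ℝ (Vd d)) (hl : ∀ v ∈ l, v ∈ L) :
    coneOf l ⊆ L :=
  coneOf_le l L L.zero_mem (fun _ hx _ hy => L.add_mem hx hy) (fun _ _ _ hx => L.smul_mem _ hx) hl

theorem exists_between_lists (L U : List ℝ) (h : ∀ a ∈ L, ∀ b ∈ U, a ≤ b) :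
    ∃ t, (∀ a ∈ L, a ≤ t) ∧ ∀ b ∈ U, t ≤ b := by
  classical
  by_cases hL : L = []
  · subst hL
    by_cases hU : U = []
    · subst hU; exact ⟨0, by simp, by simp⟩
    · have hne : U.toFinset.Nonempty := by simpa [List.toFinset_nonempty_iff] using hU
      exact ⟨U.toFinset.min' hne, by simp, fun b hb => Finset.min'_le _ _ (by simpa using hb)⟩
  · have hne : L.toFinset.Nonempty := by simpa [List.toFinset_nonempty_iff] using hL
    refine ⟨L.toFinset.max' hne, fun a ha => Finset.le_max' _ _ (by simpa using ha), ?_⟩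
    intro b hb
    exact Finset.max'_le _ _ _ (fun y hy => h y (by simpa using hy) b hb)

theorem fm_step {d : ℕ} {A B : AddSubgroup (Vd d)} (hAB : IntPair A B) (v : Vd d) (hv : v ∈ A)
    (h : List (Vd d)) (hh : ∀ g ∈ h, g ∈ B) :
    ∃ h' : List (Vd d), (∀ g ∈ h', g ∈ B) ∧
      {x | ∃ t : ℝ, 0 ≤ t ∧ x - t • v ∈ hset h} = hset h' := by
  classical
  let P := h.filter (fun g => 0 ≤ ⟪g, v⟫)
  let N := h.filter (fun g => ⟪g, v⟫ < 0)
  let Pr := P.flatMap (fun g₁ => N.map (fun g₂ => ⟪g₁, v⟫ • g₂ - ⟪g₂, v⟫ • g₁))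
  have hsmB : ∀ g ∈ B, ∀ g' ∈ B, ⟪g, v⟫ • g' ∈ B := by
    intro g hg g' hg'
    obtain ⟨n, hn⟩ := hAB.symm g hg v hv
    rw [hn, Int.cast_smul_eq_zsmul]
    exact B.zsmul_mem hg' n
  refine ⟨P ++ Pr, ?_, ?_⟩
  · intro g hg
    rcases List.mem_append.1 hg with hg | hg
    · exact hh g (List.mem_filter.1 hg).1
    · obtain ⟨g₁, h1, hg⟩ := List.mem_flatMap.1 hg
      obtain ⟨g₂, h2, rfl⟩ := List.mem_map.1 hg
      have h1 := hh _ (List.mem_filter.1 h1).1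
      have h2 := hh _ (List.mem_filter.1 h2).1
      exact B.sub_mem (hsmB _ h1 _ h2) (hsmB _ h2 _ h1)
  · ext x
    constructor
    · rintro ⟨t, ht, hx⟩ g hg
      rcases List.mem_append.1 hg with hg | hg
      · have h1 := List.mem_filter.1 hg
        have h2 := hx g h1.1
        have h3 : 0 ≤ ⟪g, v⟫ := by simpa using h1.2
        rw [inner_sub_right, inner_smul_right] at h2
        nlinarith [mul_nonneg ht h3]
      · obtain ⟨g₁, h1, hg⟩ := List.mem_flatMap.1 hg
        obtain ⟨g₂, h2, rfl⟩ := List.mem_map.1 hg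
        have h1' := List.mem_filter.1 h1
        have h2' := List.mem_filter.1 h2
        have e1 := hx _ h1'.1
        have e2 := hx _ h2'.1
        have s1 : 0 ≤ ⟪g₁, v⟫ := by simpa using h1'.2
        have s2 : ⟪g₂, v⟫ < 0 := by simpa using h2'.2
        rw [inner_sub_right, inner_smul_right] at e1 e2
        rw [inner_sub_left, inner_smul_left, inner_smul_left]
        simp only [conj_trivial]
        nlinarith [mul_nonneg s1 e2, mul_nonneg (neg_nonneg.2 s2.le) e1]
    · intro hx
      obtain ⟨t, ht1, ht2⟩ := exists_between_lists
        (0 :: N.map (fun g => ⟪g, x⟫ / ⟪g, v⟫))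
        ((P.filter (fun g => 0 < ⟪g, v⟫)).map (fun g => ⟪g, x⟫ / ⟪g, v⟫)) (by
          intro a ha b hb
          obtain ⟨g₁, h1, rfl⟩ := List.mem_map.1 hb
          have h1' := List.mem_filter.1 h1
          have s1 : 0 < ⟪g₁, v⟫ := by simpa using h1'.2
          rcases List.mem_cons.1 ha with rfl | ha
          · have := hx g₁ (List.mem_append_left _ h1'.1)
            positivity
          · obtain ⟨g₂, h2, rfl⟩ := List.mem_map.1 ha
            have h2' := List.mem_filter.1 h2
            have s2 : ⟪g₂, v⟫ < 0 := by simpa using h2'.2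
            have := hx (⟪g₁, v⟫ • g₂ - ⟪g₂, v⟫ • g₁) (List.mem_append_right _
              (List.mem_flatMap.2 ⟨g₁, h1'.1, List.mem_map.2 ⟨g₂, h2, rfl⟩⟩))
            rw [inner_sub_left, inner_smul_left, inner_smul_left] at this
            simp only [conj_trivial] at this
            rw [le_div_iff₀ s1, div_mul_eq_mul_div, div_le_iff_of_neg s2]
            linarith)
      have ht0 : 0 ≤ t := ht1 0 List.mem_cons_self
      refine ⟨t, ht0, ?_⟩
      intro g hg
      rw [inner_sub_right, inner_smul_right]
      rcases lt_trichotomy ⟪g, v⟫ 0 with hs | hs | hs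
      · have := ht1 (⟪g, x⟫ / ⟪g, v⟫) (List.mem_cons_of_mem _ (List.mem_map.2
          ⟨g, List.mem_filter.2 ⟨hg, by simpa using hs⟩, rfl⟩))
        rw [div_le_iff_of_neg hs] at this
        linarith
      · rw [hs]
        have := hx g (List.mem_append_left _ (List.mem_filter.2 ⟨hg, by simp [hs]⟩))
        linarith
      · have := ht2 (⟪g, x⟫ / ⟪g, v⟫) (List.mem_map.2
          ⟨g, List.mem_filter.2 ⟨List.mem_filter.2 ⟨hg, by simpa using hs.le⟩,
            by simpa using hs⟩, rfl⟩)
        rw [le_div_iff₀ hs] at this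
        linarith

/-- generated cones are cut out by inequalities -/
theorem fm_VH {d : ℕ} {A B : AddSubgroup (Vd d)} (hAB : IntPair A B)
    (hB : ∃ h : List (Vd d), (∀ g ∈ h, g ∈ B) ∧ hset h = {0})
    (l : List (Vd d)) (hl : ∀ v ∈ l, v ∈ A) :
    ∃ h : List (Vd d), (∀ g ∈ h, g ∈ B) ∧ coneOf l = hset h := by
  induction l with
  | nil =>
    obtain ⟨h, h1, h2⟩ := hB
    exact ⟨h, h1, by simp [coneOf, h2]⟩
  | cons v l ih =>
    obtain ⟨h, h1, h2⟩ := ih (fun w hw => hl w (List.mem_cons_of_mem _ hw))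
    obtain ⟨h', h1', h2'⟩ := fm_step hAB v (hl v List.mem_cons_self) h h1
    refine ⟨h', h1', ?_⟩
    rw [← h2', ← h2]
    rfl

/-- cones cut out by inequalities are generated -/
theorem fm_HV {d : ℕ} {A B : AddSubgroup (Vd d)} (hAB : IntPair A B)
    (hA : ∃ h : List (Vd d), (∀ g ∈ h, g ∈ A) ∧ hset h = {0})
    (hB : ∃ h : List (Vd d), (∀ g ∈ h, g ∈ B) ∧ hset h = {0})
    (h : List (Vd d)) (hh : ∀ g ∈ h, g ∈ A) :
    ∃ l : List (Vd d), (∀ v ∈ l, v ∈ B) ∧ hset h = coneOf l := by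
  obtain ⟨l, hl, e1⟩ := fm_VH hAB hB h hh
  obtain ⟨h2, hh2, e2⟩ := fm_VH hAB.symm hA l hl
  refine ⟨l, hl, Subset.antisymm ?_ ?_⟩
  · intro x hx
    rw [e2]
    intro g hg
    have hgl : g ∈ hset l := by
      intro v hv
      have : v ∈ hset h2 := e2 ▸ coneOf_mem l v hv
      rw [real_inner_comm]
      exact this g hg
    rw [← e1] at hgl
    rw [real_inner_comm]
    exact coneOf_inner h x (fun w hw => by rw [real_inner_comm]; exact hx w hw) g hgl
  · intro x hx g hg
    refine coneOf_inner l g (fun v hv => ?_) x hx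
    have : g ∈ hset l := e1 ▸ coneOf_mem h g hg
    rw [real_inner_comm]
    exact this v hv

open MeasureTheory Filter Topology Set
open scoped RealInnerProductSpace Pointwise BigOperators

theorem coneOf_ofFn {d : ℕ} : ∀ {n : ℕ} (v : Fin n → Vd d),
    coneOf (List.ofFn v) = {x | ∃ t : Fin n → ℝ, (∀ i, 0 ≤ t i) ∧ x = ∑ i, t i • v i} := by
  intro n
  induction n with
  | zero => intro v; ext x; simp [coneOf]
  | succ n ih =>
    intro v
    rw [List.ofFn_succ]
    ext x
    simp only [coneOf, ih]
    constructor
    · rintro ⟨t, ht, u, hu, h⟩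
      refine ⟨Fin.cons t u, ?_, ?_⟩
      · intro i; refine Fin.cases ?_ ?_ i
        · simpa using ht
        · simpa using hu
      · rw [Fin.sum_univ_succ]
        simp only [Fin.cons_zero, Fin.cons_succ]
        rw [← h]; module
    · rintro ⟨t, ht, rfl⟩
      refine ⟨t 0, ht 0, fun i => t i.succ, fun i => ht _, ?_⟩
      rw [Fin.sum_univ_succ]; simp

theorem isRatCone_iff {d : ℕ} (A : AddSubgroup (Vd d)) (c : Set (Vd d)) :
    IsRatCone A c ↔ ∃ l : List (Vd d), (∀ v ∈ l, v ∈ A) ∧ c = coneOf l := by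
  constructor
  · rintro ⟨n, v, hv, rfl⟩
    refine ⟨List.ofFn v, ?_, (coneOf_ofFn v).symm⟩
    intro w hw
    obtain ⟨i, rfl⟩ := (List.mem_ofFn' _ _).1 hw
    exact hv i
  · rintro ⟨l, hl, rfl⟩
    refine ⟨l.length, l.get, fun i => hl _ (List.get_mem _ _), ?_⟩
    rw [← coneOf_ofFn, List.ofFn_get]

theorem hset_append {d : ℕ} (l m : List (Vd d)) : hset (l ++ m) = hset l ∩ hset m := by
  ext x
  simp only [hset, mem_inter_iff]
  constructor
  · intro h
    exact ⟨fun g hg => h g (List.mem_append_left _ hg), fun g hg => h g (List.mem_append_right _ hg)⟩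
  · rintro ⟨h1, h2⟩ g hg
    rcases List.mem_append.1 hg with hg | hg
    · exact h1 g hg
    · exact h2 g hg

theorem intPair_dual {d : ℕ} (Λ : AddSubgroup (Vd d)) : IntPair (dualLattice Λ) Λ :=
  fun a ha b hb => ha b hb

theorem hset_pm_eq {d : ℕ} {n : ℕ} (v : Fin n → Vd d) (h : ∀ x : Vd d, (∀ i, ⟪v i, x⟫ = 0) → x = 0) :
    hset (List.ofFn v ++ List.ofFn (fun i => - v i)) = {0} := by
  ext x
  simp only [mem_singleton_iff]
  constructor
  · intro hx
    apply h
    intro i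
    have h1 := hx (v i) (List.mem_append_left _ ((List.mem_ofFn' _ _).2 ⟨i, rfl⟩))
    have h2 := hx (- v i) (List.mem_append_right _ ((List.mem_ofFn' _ _).2 ⟨i, rfl⟩))
    rw [inner_neg_left] at h2
    linarith
  · rintro rfl
    intro g _
    simp

theorem eq_zero_of_inner_span {d : ℕ} {s : Set (Vd d)} (hs : Submodule.span ℝ s = ⊤) (x : Vd d)
    (h : ∀ v ∈ s, ⟪v, x⟫ = 0) : x = 0 := by
  have : x ∈ Submodule.span ℝ s := by rw [hs]; trivial
  have h2 : ∀ y ∈ Submodule.span ℝ s, ⟪y, x⟫ = 0 := by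
    intro y hy
    induction hy using Submodule.span_induction with
    | mem y hy => exact h y hy
    | zero => simp
    | add a b _ _ ha hb => rw [inner_add_left, ha, hb, add_zero]
    | smul c a _ ha => rw [inner_smul_left, ha, mul_zero]
  exact inner_self_eq_zero.1 (h2 x this)

theorem full_basis {d : ℕ} {Λ : AddSubgroup (Vd d)} (hΛ : IsFullLattice Λ) :
    ∃ (k : ℕ) (v : Fin k → Vd d), LinearIndependent ℝ v ∧ Λ = AddSubgroup.closure (Set.range v) ∧
      Submodule.span ℝ (Set.range v) = ⊤ := by
  obtain ⟨⟨k, v, hv, rfl⟩, h⟩ := hΛ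
  refine ⟨k, v, hv, rfl, ?_⟩
  rw [eq_top_iff, ← h, Submodule.span_le]
  intro x hx
  have : AddSubgroup.closure (range v) ≤ (Submodule.span ℝ (range v)).toAddSubgroup := by
    rw [AddSubgroup.closure_le]
    exact Submodule.subset_span
  exact this hx

theorem hset_full {d : ℕ} {Λ : AddSubgroup (Vd d)} (hΛ : IsFullLattice Λ) :
    ∃ h : List (Vd d), (∀ g ∈ h, g ∈ Λ) ∧ hset h = {0} := by
  obtain ⟨k, v, hv, rfl, h⟩ := full_basis hΛ
  refine ⟨_, ?_, hset_pm_eq v (fun x hx => eq_zero_of_inner_span h x ?_)⟩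
  · intro g hg
    rcases List.mem_append.1 hg with hg | hg
    · exact AddSubgroup.subset_closure ((List.mem_ofFn' _ _).1 hg)
    · obtain ⟨i, rfl⟩ := (List.mem_ofFn' _ _).1 hg
      exact AddSubgroup.neg_mem _ (AddSubgroup.subset_closure ⟨i, rfl⟩)
  · rintro _ ⟨i, rfl⟩; exact hx i

theorem hset_full_dual {d : ℕ} {Λ : AddSubgroup (Vd d)} (hΛ : IsFullLattice Λ) :
    ∃ h : List (Vd d), (∀ g ∈ h, g ∈ dualLattice Λ) ∧ hset h = {0} := by
  obtain ⟨k, v, hv, rfl, h⟩ := full_basis hΛ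
  let b : Module.Basis (Fin k) ℝ (Vd d) := Module.Basis.mk hv (by rw [h])
  let g : Fin k → Vd d := fun i => (InnerProductSpace.toDual ℝ (Vd d)).symm
    (LinearMap.toContinuousLinearMap (b.coord i))
  have hg : ∀ i x, ⟪g i, x⟫ = b.coord i x := by
    intro i x
    simp only [g]
    rw [InnerProductSpace.toDual_symm_apply]
    rfl
  have hmem : ∀ i, g i ∈ dualLattice (AddSubgroup.closure (range v)) := by
    intro i x hx
    change ∃ n : ℤ, ⟪g i, x⟫ = (n : ℝ)
    induction hx using AddSubgroup.closure_induction with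
    | mem x hx =>
      obtain ⟨j, rfl⟩ := hx
      rw [hg]
      have : v j = b j := by simp [b]
      rw [this, Module.Basis.coord_apply, Module.Basis.repr_self]
      by_cases hij : j = i
      · subst hij; exact ⟨1, by simp⟩
      · exact ⟨0, by simp [Finsupp.single_apply, hij]⟩
    | zero => exact ⟨0, by simp⟩
    | add a b _ _ ha hb =>
      obtain ⟨n, hn⟩ := ha
      obtain ⟨m, hm⟩ := hb
      exact ⟨n + m, by rw [inner_add_right, hn, hm]; push_cast; ring⟩
    | neg a _ ha =>
      obtain ⟨n, hn⟩ := ha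
      exact ⟨-n, by rw [inner_neg_right, hn]; push_cast; ring⟩
  refine ⟨_, ?_, hset_pm_eq g (fun x hx => ?_)⟩
  · intro w hw
    rcases List.mem_append.1 hw with hg | hg
    · obtain ⟨i, rfl⟩ := (List.mem_ofFn' _ _).1 hg
      exact hmem i
    · obtain ⟨i, rfl⟩ := (List.mem_ofFn' _ _).1 hg
      exact AddSubgroup.neg_mem _ (hmem i)
  · apply b.ext_elem
    intro i
    have := hx i
    rw [hg] at this
    simpa using this

/-! rational cones: operations -/

theorem rc_H {d : ℕ} {Λ : AddSubgroup (Vd d)} (hΛ : IsFullLattice Λ) {κ : Set (Vd d)}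
    (hκ : IsRatCone (dualLattice Λ) κ) :
    ∃ h : List (Vd d), (∀ g ∈ h, g ∈ Λ) ∧ κ = hset h := by
  obtain ⟨l, hl, rfl⟩ := (isRatCone_iff _ _).1 hκ
  exact fm_VH (intPair_dual Λ) (hset_full hΛ) l hl

theorem rc_of_H {d : ℕ} {Λ : AddSubgroup (Vd d)} (hΛ : IsFullLattice Λ) (h : List (Vd d))
    (hh : ∀ g ∈ h, g ∈ Λ) : IsRatCone (dualLattice Λ) (hset h) :=
  (isRatCone_iff _ _).2 (fm_HV (intPair_dual Λ).symm (hset_full hΛ) (hset_full_dual hΛ) h hh)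

theorem rcP_of_H {d : ℕ} {Λ : AddSubgroup (Vd d)} (hΛ : IsFullLattice Λ) (h : List (Vd d))
    (hh : ∀ g ∈ h, g ∈ dualLattice Λ) :
    ∃ l : List (Vd d), (∀ v ∈ l, v ∈ Λ) ∧ hset h = coneOf l :=
  fm_HV (intPair_dual Λ) (hset_full_dual hΛ) (hset_full hΛ) h hh

theorem rc_inter {d : ℕ} {Λ : AddSubgroup (Vd d)} (hΛ : IsFullLattice Λ) {κ τ : Set (Vd d)}
    (hκ : IsRatCone (dualLattice Λ) κ) (hτ : IsRatCone (dualLattice Λ) τ) :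
    IsRatCone (dualLattice Λ) (κ ∩ τ) := by
  obtain ⟨h, h1, rfl⟩ := rc_H hΛ hκ
  obtain ⟨h', h1', rfl⟩ := rc_H hΛ hτ
  rw [← hset_append]
  apply rc_of_H hΛ
  intro g hg
  rcases List.mem_append.1 hg with hg | hg
  · exact h1 g hg
  · exact h1' g hg

/-- the half space `η ≥ 0` -/
def hp {d : ℕ} (η : Vd d) : Set (Vd d) := {y | 0 ≤ ⟪η, y⟫}

theorem hp_rc {d : ℕ} {Λ : AddSubgroup (Vd d)} (hΛ : IsFullLattice Λ) {η : Vd d} (h : η ∈ Λ) :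
    IsRatCone (dualLattice Λ) (hp η) := by
  have : hp η = hset [η] := by ext x; simp [hp, hset]
  rw [this]
  exact rc_of_H hΛ _ (by simpa using h)

theorem dualConeSet_coneOf {d : ℕ} (l : List (Vd d)) : dualConeSet (coneOf l) = hset l := by
  ext x
  constructor
  · intro hx g hg
    exact hx g (coneOf_mem l g hg)
  · intro hx ξ hξ
    change 0 ≤ ⟪ξ, x⟫
    rw [real_inner_comm]
    exact coneOf_inner l x (fun v hv => by rw [real_inner_comm]; exact hx v hv) ξ hξ

theorem rc_zero {d : ℕ} {A : AddSubgroup (Vd d)} {κ : Set (Vd d)} (hκ : IsRatCone A κ) :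
    (0 : Vd d) ∈ κ := by
  obtain ⟨l, hl, rfl⟩ := (isRatCone_iff _ _).1 hκ
  exact coneOf_zero_mem l

theorem rc_add {d : ℕ} {A : AddSubgroup (Vd d)} {κ : Set (Vd d)} (hκ : IsRatCone A κ)
    {x y : Vd d} (hx : x ∈ κ) (hy : y ∈ κ) : x + y ∈ κ := by
  obtain ⟨l, hl, rfl⟩ := (isRatCone_iff _ _).1 hκ
  exact coneOf_add l hx hy

theorem rc_smul {d : ℕ} {A : AddSubgroup (Vd d)} {κ : Set (Vd d)} (hκ : IsRatCone A κ)
    {x : Vd d} {c : ℝ} (hc : 0 ≤ c) (hx : x ∈ κ) : c • x ∈ κ := by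
  obtain ⟨l, hl, rfl⟩ := (isRatCone_iff _ _).1 hκ
  exact coneOf_smul l hc hx

/-- rational subspaces of the dual -/
def RatSub {d : ℕ} (Λ : AddSubgroup (Vd d)) (U : Submodule ℝ (Vd d)) : Prop :=
  ∃ l : List (Vd d), (∀ g ∈ l, g ∈ dualLattice Λ) ∧ Submodule.span ℝ {x | x ∈ l} = U

theorem span_coneOf {d : ℕ} (l : List (Vd d)) :
    Submodule.span ℝ (coneOf l) = Submodule.span ℝ {x | x ∈ l} := by
  apply le_antisymm
  · rw [Submodule.span_le]
    exact coneOf_span l _ (fun v hv => Submodule.subset_span hv)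
  · exact Submodule.span_mono (fun v hv => coneOf_mem l v hv)

theorem ratSub_span {d : ℕ} {Λ : AddSubgroup (Vd d)} {κ : Set (Vd d)}
    (hκ : IsRatCone (dualLattice Λ) κ) : RatSub Λ (Submodule.span ℝ κ) := by
  obtain ⟨l, hl, rfl⟩ := (isRatCone_iff _ _).1 hκ
  exact ⟨l, hl, (span_coneOf l).symm⟩

theorem coneOf_pm {d : ℕ} (l : List (Vd d)) :
    coneOf (l ++ l.map (fun x => -x)) = (Submodule.span ℝ {x | x ∈ l} : Set (Vd d)) := by
  apply Subset.antisymm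
  · apply coneOf_span
    intro v hv
    rcases List.mem_append.1 hv with hv | hv
    · exact Submodule.subset_span hv
    · obtain ⟨w, hw, rfl⟩ := List.mem_map.1 hv
      exact Submodule.neg_mem _ (Submodule.subset_span hw)
  · intro x hx
    set m := l ++ l.map (fun x => -x)
    have hneg : ∀ x ∈ coneOf m, -x ∈ coneOf m := by
      have := coneOf_le m {x | -x ∈ coneOf m} (by simpa using coneOf_zero_mem m)
        (fun x hx y hy => by
          change -(x + y) ∈ coneOf m
          rw [neg_add]; exact coneOf_add m hx hy)
        (fun c hc x hx => by
          change -(c • x) ∈ coneOf m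
          rw [← smul_neg]; exact coneOf_smul m hc hx) (fun v hv => by
          change - v ∈ coneOf m
          rcases List.mem_append.1 hv with hv | hv
          · exact coneOf_mem m _ (List.mem_append_right _ (List.mem_map.2 ⟨v, hv, rfl⟩))
          · obtain ⟨w, hw, rfl⟩ := List.mem_map.1 hv
            rw [neg_neg]
            exact coneOf_mem m _ (List.mem_append_left _ hw))
      exact this
    change x ∈ Submodule.span ℝ _ at hx
    induction hx using Submodule.span_induction with
    | mem y hy => exact coneOf_mem m _ (List.mem_append_left _ hy)
    | zero => exact coneOf_zero_mem m
    | add a b _ _ ha hb => exact coneOf_add m ha hb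
    | smul c a _ ha =>
      rcases le_total 0 c with hc | hc
      · exact coneOf_smul m hc ha
      · have := coneOf_smul m (neg_nonneg.2 hc) (hneg a ha)
        simpa using this

theorem ratSub_rc {d : ℕ} {Λ : AddSubgroup (Vd d)} {U : Submodule ℝ (Vd d)} (hU : RatSub Λ U) :
    IsRatCone (dualLattice Λ) (U : Set (Vd d)) := by
  obtain ⟨l, hl, rfl⟩ := hU
  rw [← coneOf_pm]
  refine (isRatCone_iff _ _).2 ⟨_, ?_, rfl⟩
  intro v hv
  rcases List.mem_append.1 hv with hv | hv
  · exact hl v hv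
  · obtain ⟨w, hw, rfl⟩ := List.mem_map.1 hv
    exact AddSubgroup.neg_mem _ (hl w hw)

theorem mem_orth_span {d : ℕ} (s : Set (Vd d)) (x : Vd d) :
    x ∈ (Submodule.span ℝ s)ᗮ ↔ ∀ v ∈ s, ⟪v, x⟫ = 0 := by
  rw [Submodule.mem_orthogonal]
  constructor
  · intro h v hv; exact h v (Submodule.subset_span hv)
  · intro h y hy
    induction hy using Submodule.span_induction with
    | mem y hy => exact h y hy
    | zero => simp
    | add a b _ _ ha hb => rw [inner_add_left, ha, hb, add_zero]
    | smul c a _ ha => rw [inner_smul_left, ha, mul_zero]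

/-- the dual of a rational cone, intersected with the annihilator of a rational subspace,
is generated by lattice vectors and cut out by dual lattice vectors -/
theorem dual_inter {d : ℕ} {Λ : AddSubgroup (Vd d)} (hΛ : IsFullLattice Λ) {κ : Set (Vd d)}
    (hκ : IsRatCone (dualLattice Λ) κ) {U : Submodule ℝ (Vd d)} (hU : RatSub Λ U)
    (E : Submodule ℝ (Vd d)) (hκE : κ ⊆ E) (hUE : U ≤ E) :
    ∃ h l : List (Vd d), (∀ g ∈ h, g ∈ dualLattice Λ ∧ g ∈ E) ∧ (∀ v ∈ l, v ∈ Λ) ∧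
      dualConeSet κ ∩ (Uᗮ : Set (Vd d)) = hset h ∧
      dualConeSet κ ∩ (Uᗮ : Set (Vd d)) = coneOf l := by
  obtain ⟨lk, hlk, rfl⟩ := (isRatCone_iff _ _).1 hκ
  obtain ⟨lu, hlu, rfl⟩ := hU
  have e : dualConeSet (coneOf lk) ∩ ((Submodule.span ℝ {x | x ∈ lu})ᗮ : Set (Vd d)) =
      hset (lk ++ (lu ++ lu.map (fun x => -x))) := by
    rw [hset_append, dualConeSet_coneOf]
    congr 1
    ext x
    rw [SetLike.mem_coe, mem_orth_span]
    constructor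
    · intro h g hg
      rcases List.mem_append.1 hg with hg | hg
      · exact (h g hg).ge
      · obtain ⟨w, hw, rfl⟩ := List.mem_map.1 hg
        rw [inner_neg_left, h w hw, neg_zero]
    · intro h v hv
      have h1 := h v (List.mem_append_left _ hv)
      have h2 := h (-v) (List.mem_append_right _ (List.mem_map.2 ⟨v, hv, rfl⟩))
      rw [inner_neg_left] at h2
      linarith
  have hh : ∀ g ∈ lk ++ (lu ++ lu.map (fun x => -x)), g ∈ dualLattice Λ ∧ g ∈ E := by
    intro g hg
    rcases List.mem_append.1 hg with hg | hg
    · exact ⟨hlk g hg, hκE (coneOf_mem _ _ hg)⟩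
    rcases List.mem_append.1 hg with hg | hg
    · exact ⟨hlu g hg, hUE (Submodule.subset_span hg)⟩
    · obtain ⟨w, hw, rfl⟩ := List.mem_map.1 hg
      exact ⟨AddSubgroup.neg_mem _ (hlu w hw), Submodule.neg_mem _ (hUE (Submodule.subset_span hw))⟩
  obtain ⟨l, hl, e2⟩ := rcP_of_H hΛ _ (fun g hg => (hh g hg).1)
  exact ⟨_, l, hh, hl, e, e.trans e2⟩

/-! ### `Q`-orthogonal projections -/

theorem qp_exists {d : ℕ} {Q : Vd d →ₗ[ℝ] Vd d →ₗ[ℝ] ℝ} (hs : ∀ x y, Q x y = Q y x)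
    (hp : ∀ x : Vd d, x ≠ 0 → 0 < Q x x) (L : Submodule ℝ (Vd d)) : ∃ π, IsQCoproj Q L π := by
  let B : LinearMap.BilinForm ℝ (Vd d) := Q
  have hrefl : B.IsRefl := fun x y h => by
    change Q y x = 0
    rw [hs]; exact h
  have hnd : (B.restrict L).Nondegenerate := by
    have key : ∀ x : L, (∀ y : L, B.restrict L x y = 0) → x = 0 := by
      intro x hx
      by_contra hne
      have h1 := hp (x : Vd d) (fun h => hne (by ext1; exact h))
      have h2 : Q (x : Vd d) x = 0 := hx x
      linarith
    refine ⟨key, fun x hx => key x (fun y => ?_)⟩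
    have : Q (y : Vd d) x = 0 := hx y
    change Q (x : Vd d) y = 0
    rw [hs]; exact this
  have hc := LinearMap.BilinForm.isCompl_orthogonal_of_restrict_nondegenerate hrefl hnd
  refine ⟨(Submodule.projection _ _ hc.symm), ?_, ?_⟩
  · intro x
    have h1 := Submodule.projection_add_projection_eq_self hc x
    have : x - (Submodule.projection _ _ hc.symm) x = Submodule.projection _ _ hc x := by
      rw [sub_eq_iff_eq_add]; exact h1.symm
    rw [this]
    exact Submodule.projection_apply_mem hc x
  · intro x y hy
    have := Submodule.projection_apply_mem hc.symm x
    rw [LinearMap.BilinForm.mem_orthogonal_iff] at this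
    have h2 : Q y ((Submodule.projection _ _ hc.symm) x) = 0 := this y hy
    rw [hs]; exact h2

theorem qp_unique {d : ℕ} {Q : Vd d →ₗ[ℝ] Vd d →ₗ[ℝ] ℝ}
    (hp : ∀ x : Vd d, x ≠ 0 → 0 < Q x x) {L : Submodule ℝ (Vd d)} {π π' : Vd d →ₗ[ℝ] Vd d}
    (h : IsQCoproj Q L π) (h' : IsQCoproj Q L π') : π = π' := by
  ext1 x
  by_contra hne
  have h1 : π x - π' x ∈ L := by
    have := L.sub_mem (h'.1 x) (h.1 x)
    simpa using this
  have h2 := hp _ (sub_ne_zero.2 hne)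
  have h3 : Q (π x - π' x) (π x - π' x) = 0 := by
    rw [Q.map_sub, LinearMap.sub_apply, h.2 x _ h1, h'.2 x _ h1, sub_zero]
  linarith

open Classical in
/-- the `Q`-orthogonal projection along `L` -/
noncomputable def qp {d : ℕ} (Q : Vd d →ₗ[ℝ] Vd d →ₗ[ℝ] ℝ) (L : Submodule ℝ (Vd d)) :
    Vd d →ₗ[ℝ] Vd d :=
  if h : ∃ π, IsQCoproj Q L π then h.choose else 0

theorem qp_spec {d : ℕ} {Λ : AddSubgroup (Vd d)} {Q : Vd d →ₗ[ℝ] Vd d →ₗ[ℝ] ℝ}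
    (hQ : IsRatInner Λ Q) (L : Submodule ℝ (Vd d)) : IsQCoproj Q L (qp Q L) := by
  have h := qp_exists hQ.1 hQ.2.1 L
  rw [qp, dif_pos h]
  exact h.choose_spec

open MeasureTheory Filter Topology Set
open scoped RealInnerProductSpace Pointwise BigOperators

/-! ### The filter of germs of meromorphic functions -/

/-- the filter describing `MeroEqAt0` -/
def mf (d : ℕ) : Filter (Vd d) where
  sets := {A | ∃ Z : Set (Vd d), IsClosed Z ∧ interior Z = ∅ ∧ ∀ᶠ ξ in 𝓝 (0 : Vd d), ξ ∉ Z → ξ ∈ A}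
  univ_sets := ⟨∅, isClosed_empty, interior_empty, by simp⟩
  sets_of_superset := by
    rintro A B ⟨Z, h1, h2, h3⟩ hAB
    exact ⟨Z, h1, h2, h3.mono (fun ξ h hz => hAB (h hz))⟩
  inter_sets := by
    rintro A B ⟨Z, h1, h2, h3⟩ ⟨Z', h1', h2', h3'⟩
    refine ⟨Z ∪ Z', h1.union h1', ?_, ?_⟩
    · rw [interior_union_isClosed_of_interior_empty h1 h2', h2]
    · filter_upwards [h3, h3'] with ξ h h' hz
      simp only [mem_union, not_or] at hz
      exact ⟨h hz.1, h' hz.2⟩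

theorem meroEq_iff {d : ℕ} (f g : Vd d → ℝ) : MeroEqAt0 f g ↔ f =ᶠ[mf d] g := Iff.rfl

theorem mf_of_nhds {d : ℕ} {p : Vd d → Prop} (h : ∀ᶠ ξ in 𝓝 (0 : Vd d), p ξ) :
    ∀ᶠ ξ in mf d, p ξ :=
  ⟨∅, isClosed_empty, interior_empty, h.mono (fun _ h _ => h)⟩

theorem zero_set_interior {d : ℕ} {h : Vd d → ℝ} {r : ℝ} (hr : 0 < r)
    (ha : AnalyticOnNhd ℝ h (Metric.ball 0 r)) (hnz : ¬ ∀ᶠ ξ in 𝓝 (0 : Vd d), h ξ = 0)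
    (x : Vd d) (hx : x ∈ Metric.ball (0 : Vd d) r) : ¬ ∀ᶠ ξ in 𝓝 x, h ξ = 0 := by
  intro hev
  apply hnz
  have := ha.eqOn_of_preconnected_of_eventuallyEq (g := fun _ => 0)
    (fun _ _ => analyticAt_const) (convex_ball (0 : Vd d) r).isPreconnected hx hev
  filter_upwards [Metric.ball_mem_nhds (0 : Vd d) hr] with ξ hξ
  exact this hξ

theorem exists_ball_analytic {d : ℕ} {h : Vd d → ℝ} (ha : AnalyticAt ℝ h 0) :
    ∃ r > 0, AnalyticOnNhd ℝ h (Metric.ball 0 r) := by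
  obtain ⟨r, hr, hb⟩ := Metric.eventually_nhds_iff_ball.1 ha.eventually_analyticAt
  exact ⟨r, hr, hb⟩

theorem mf_ne_zero {d : ℕ} {h : Vd d → ℝ} (ha : AnalyticAt ℝ h 0)
    (hnz : ¬ ∀ᶠ ξ in 𝓝 (0 : Vd d), h ξ = 0) : ∀ᶠ ξ in mf d, h ξ ≠ 0 := by
  obtain ⟨r, hr, hb⟩ := exists_ball_analytic ha
  have hsub : Metric.closedBall (0 : Vd d) (r / 2) ⊆ Metric.ball 0 r :=
    Metric.closedBall_subset_ball (by linarith)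
  refine ⟨Metric.closedBall 0 (r / 2) ∩ h ⁻¹' {0}, ?_, ?_, ?_⟩
  · exact (hb.continuousOn.mono hsub).preimage_isClosed_of_isClosed
      Metric.isClosed_closedBall isClosed_singleton
  · rw [eq_empty_iff_forall_notMem]
    intro x hx
    have hx' := interior_subset hx
    refine zero_set_interior hr hb hnz x (hsub hx'.1) ?_
    filter_upwards [mem_interior_iff_mem_nhds.1 hx] with y hy
    exact hy.2
  · filter_upwards [Metric.closedBall_mem_nhds (0 : Vd d) (by linarith : (0 : ℝ) < r / 2)]
      with ξ hξ hZ h0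
    exact hZ ⟨hξ, h0⟩

theorem mero_extend {d : ℕ} {Λ : AddSubgroup (Vd d)} {F D G : Vd d → ℝ}
    (hF : RatMeromorphicAt0 Λ F) (hD : ∀ ξ, AnalyticAt ℝ D ξ)
    (hG : ∀ ξ u : Vd d, ∀ t : ℝ, AnalyticAt ℝ (fun t : ℝ => G (ξ + t • u)) t)
    (Ω : Set (Vd d)) (hΩ : IsOpen Ω) (hΩ0 : ∀ r > 0, ∃ ξ ∈ Ω, ξ ∈ Metric.ball (0 : Vd d) r)
    (heq : ∀ ξ ∈ Ω, D ξ * F ξ = G ξ) : ∀ᶠ ξ in mf d, D ξ * F ξ = G ξ := by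
  obtain ⟨g, h, ⟨pg, hpg, -⟩, ⟨ph, hph, -⟩, hnz, hrel⟩ := hF
  obtain ⟨r1, hr1, hg⟩ := exists_ball_analytic hpg.analyticAt
  obtain ⟨r2, hr2, hh⟩ := exists_ball_analytic hph.analyticAt
  obtain ⟨r3, hr3, hrel⟩ := Metric.eventually_nhds_iff_ball.1 hrel
  obtain ⟨r, hr, hle1, hle2, hle3⟩ : ∃ r > 0, r ≤ r1 ∧ r ≤ r2 ∧ r ≤ r3 :=
    ⟨min r1 (min r2 r3), by positivity, by simp, by simp, by simp⟩
  replace hg := hg.mono (Metric.ball_subset_ball hle1)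
  replace hh := hh.mono (Metric.ball_subset_ball hle2)
  replace hrel : ∀ y ∈ Metric.ball (0 : Vd d) r, h y ≠ 0 → F y * h y = g y :=
    fun y hy => hrel y (Metric.ball_subset_ball hle3 hy)
  -- a good point
  obtain ⟨ξ₁, hξ₁Ω, hξ₁b, hξ₁⟩ : ∃ ξ₁ ∈ Ω, ξ₁ ∈ Metric.ball (0 : Vd d) r ∧ h ξ₁ ≠ 0 := by
    obtain ⟨ξ₀, h1, h2⟩ := hΩ0 r hr
    have := zero_set_interior hr hh hnz ξ₀ h2
    rw [not_eventually] at this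
    have k1 : ∀ᶠ y in 𝓝 ξ₀, y ∈ Ω := hΩ.mem_nhds h1
    have k2 : ∀ᶠ y in 𝓝 ξ₀, y ∈ Metric.ball (0 : Vd d) r := Metric.isOpen_ball.mem_nhds h2
    obtain ⟨y, hy1, hy2⟩ := (this.and_eventually (k1.and k2)).exists
    exact ⟨y, hy2.1, hy2.2, hy1⟩
  have hnear : ∀ᶠ y in 𝓝 ξ₁, D y * g y - G y * h y = 0 := by
    have hc : ∀ᶠ y in 𝓝 ξ₁, h y ≠ 0 := (hh ξ₁ hξ₁b).continuousAt.eventually_ne hξ₁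
    filter_upwards [hc, hΩ.mem_nhds hξ₁Ω, Metric.isOpen_ball.mem_nhds hξ₁b] with y h1 h2 h3
    rw [← hrel y h3 h1, ← heq y h2]; ring
  have hall : ∀ ξ ∈ Metric.ball (0 : Vd d) r, D ξ * g ξ = G ξ * h ξ := by
    intro ξ hξ
    let γ : ℝ → Vd d := fun t => ξ₁ + t • (ξ - ξ₁)
    have hγa : ∀ t, AnalyticAt ℝ γ t := fun t => by
      have : AnalyticAt ℝ (fun t : ℝ => ξ₁ + t • (ξ - ξ₁)) t := by fun_prop
      exact this
    have hγc : Continuous γ := by fun_prop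
    let T : Set ℝ := γ ⁻¹' Metric.ball 0 r
    have hTc : Convex ℝ T := by
      have : T = (AffineMap.lineMap ξ₁ ξ : ℝ →ᵃ[ℝ] Vd d) ⁻¹' Metric.ball 0 r := by
        ext t
        simp only [T, γ, mem_preimage, AffineMap.lineMap_apply, vsub_eq_sub, vadd_eq_add]
        rw [add_comm]
      rw [this]
      exact (convex_ball (0 : Vd d) r).affine_preimage _
    have hφ : AnalyticOnNhd ℝ (fun t => D (γ t) * g (γ t) - G (γ t) * h (γ t)) T := by
      intro t ht
      have e1 : AnalyticAt ℝ (fun t => D (γ t)) t := (hD _).fun_comp (hγa t)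
      have e2 : AnalyticAt ℝ (fun t => g (γ t)) t := (hg _ ht).fun_comp (hγa t)
      have e3 : AnalyticAt ℝ (fun t => h (γ t)) t := (hh _ ht).fun_comp (hγa t)
      have e4 : AnalyticAt ℝ (fun t => G (γ t)) t := hG ξ₁ (ξ - ξ₁) t
      exact (e1.mul e2).sub (e4.mul e3)
    have h0 : (0 : ℝ) ∈ T := by simpa [T, γ] using hξ₁b
    have h1 : (1 : ℝ) ∈ T := by simpa [T, γ] using hξ
    have hev : ∀ᶠ t in 𝓝 (0 : ℝ), D (γ t) * g (γ t) - G (γ t) * h (γ t) = 0 := by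
      have : Tendsto γ (𝓝 0) (𝓝 ξ₁) := by
        have := hγc.tendsto 0
        simpa [γ] using this
      exact this.eventually hnear
    have := hφ.eqOn_of_preconnected_of_eventuallyEq (g := fun _ => 0)
      (fun _ _ => analyticAt_const) hTc.isPreconnected h0 hev h1
    simp only [γ, one_smul, add_sub_cancel] at this
    linarith
  filter_upwards [mf_ne_zero hph.analyticAt hnz, mf_of_nhds (Metric.ball_mem_nhds (0 : Vd d) hr)]
    with ξ h1 h2
  have e1 := hall ξ h2
  rw [← hrel ξ h2 h1] at e1
  apply mul_right_cancel₀ h1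
  linarith

/-! ### Difference operators -/

/-- iterated difference operator -/
def Dl {d : ℕ} : List (Vd d) → (Vd d → ℝ) → Vd d → ℝ
  | [], f, x => f x
  | v :: l, f, x => Dl l f x - Dl l f (x - v)

/-- symbol of the iterated difference operator -/
noncomputable def Dfun {d : ℕ} : List (Vd d) → Vd d → ℝ
  | [], _ => 1
  | v :: l, ξ => (1 - Real.exp ⟪ξ, v⟫) * Dfun l ξ

/-- total length of a list of vectors -/
noncomputable def tlen {d : ℕ} : List (Vd d) → ℝ
  | [] => 0
  | v :: l => ‖v‖ + tlen l

theorem tlen_nonneg {d : ℕ} (l : List (Vd d)) : 0 ≤ tlen l := by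
  induction l with
  | nil => simp [tlen]
  | cons v l ih => simp only [tlen]; positivity

theorem Dl_zero {d : ℕ} (l : List (Vd d)) (f : Vd d → ℝ) : ∀ x,
    (∀ y, ‖y - x‖ ≤ tlen l → f y = 0) → Dl l f x = 0 := by
  induction l with
  | nil => intro x h; exact h x (by simp [tlen])
  | cons v l ih =>
    intro x h
    simp only [Dl]
    rw [ih x (fun y hy => h y (by simp only [tlen]; linarith [norm_nonneg v])),
      ih (x - v) (fun y hy => h y ?_), sub_zero]
    simp only [tlen]
    have : y - x = (y - (x - v)) - v := by abel
    rw [this]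
    linarith [norm_sub_le (y - (x - v)) v]

theorem Dl_T {d : ℕ} (l : List (Vd d)) (f : Vd d → ℝ) (v : Vd d) : ∀ x,
    Dl l (fun y => f y - f (y - v)) x = Dl l f x - Dl l f (x - v) := by
  induction l with
  | nil => intro x; rfl
  | cons w l ih =>
    intro x
    simp only [Dl]
    rw [ih x, ih (x - w), sub_right_comm x w v]
    ring

theorem Dl_zero_of_mem {d : ℕ} (l : List (Vd d)) (f : Vd d → ℝ) (v : Vd d) (hv : v ∈ l) : ∀ x,
    (∀ y, ‖y - x‖ ≤ tlen l → f y = f (y - v)) → Dl l f x = 0 := by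
  induction l with
  | nil => simp at hv
  | cons w l ih =>
    intro x h
    rcases List.mem_cons.1 hv with rfl | hv'
    · simp only [Dl]
      rw [← Dl_T]
      apply Dl_zero
      intro y hy
      rw [sub_eq_zero]
      exact h y (by simp only [tlen]; linarith [norm_nonneg v])
    · simp only [Dl]
      rw [ih hv' x (fun y hy => h y (by simp only [tlen]; linarith [norm_nonneg w])),
        ih hv' (x - w) (fun y hy => h y ?_), sub_zero]
      simp only [tlen]
      have : y - x = (y - (x - w)) - w := by abel
      rw [this]
      linarith [norm_sub_le (y - (x - w)) w]

theorem Dl_add {d : ℕ} (l : List (Vd d)) (f g : Vd d → ℝ) : ∀ x,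
    Dl l (fun y => f y + g y) x = Dl l f x + Dl l g x := by
  induction l with
  | nil => intro x; rfl
  | cons w l ih => intro x; simp only [Dl, ih]; ring

theorem Dl_meas {d : ℕ} (l : List (Vd d)) (f : Vd d → ℝ) (hf : Measurable f) :
    Measurable (Dl l f) := by
  induction l with
  | nil => exact hf
  | cons w l ih =>
    have : Dl (w :: l) f = fun x => Dl l f x - Dl l f (x - w) := rfl
    rw [this]
    exact ih.sub (ih.comp (measurable_id.sub_const w))

theorem Dl_bdd {d : ℕ} (l : List (Vd d)) (f : Vd d → ℝ) (C : ℝ) (hf : ∀ x, |f x| ≤ C) :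
    ∃ C', ∀ x, |Dl l f x| ≤ C' := by
  induction l with
  | nil => exact ⟨C, hf⟩
  | cons w l ih =>
    obtain ⟨C', h⟩ := ih
    refine ⟨C' + C', fun x => ?_⟩
    simp only [Dl]
    exact (abs_sub _ _).trans (add_le_add (h _) (h _))

theorem Dfun_analytic {d : ℕ} (l : List (Vd d)) (ξ : Vd d) : AnalyticAt ℝ (Dfun l) ξ := by
  induction l with
  | nil => exact analyticAt_const
  | cons v l ih =>
    have : Dfun (v :: l) = fun ξ => (1 - Real.exp ⟪ξ, v⟫) * Dfun l ξ := rfl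
    rw [this]
    have h1 : AnalyticAt ℝ (fun ξ : Vd d => ⟪ξ, v⟫) ξ := by
      have := (innerSL ℝ v).analyticAt ξ
      refine this.congr (Eventually.of_forall fun y => ?_)
      simp [real_inner_comm]
    exact (analyticAt_const.sub h1.rexp').mul ih

theorem Dfun_ne_zero {d : ℕ} (l : List (Vd d)) (hl : ∀ v ∈ l, v ≠ 0) :
    ∀ᶠ ξ in mf d, Dfun l ξ ≠ 0 := by
  induction l with
  | nil => exact Eventually.of_forall (fun _ => one_ne_zero)
  | cons v l ih =>
    have h1 := ih (fun w hw => hl w (List.mem_cons_of_mem _ hw))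
    have h2 : ∀ᶠ ξ in mf d, Dfun [v] ξ ≠ 0 := by
      apply mf_ne_zero (Dfun_analytic _ _)
      intro h
      have ht : Tendsto (fun t : ℝ => t • v) (𝓝[>] 0) (𝓝 0) := by
        have : Tendsto (fun t : ℝ => t • v) (𝓝 0) (𝓝 ((0 : ℝ) • v)) :=
          (continuous_id.smul continuous_const).tendsto 0
        rw [zero_smul] at this
        exact this.mono_left nhdsWithin_le_nhds
      obtain ⟨t, ht1, ht2⟩ := ((ht.eventually h).and self_mem_nhdsWithin).exists
      have ht2 : 0 < t := ht2
      simp only [Dfun, mul_one, inner_smul_left, conj_trivial, real_inner_self_eq_norm_sq] at ht1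
      have hv : 0 < ‖v‖ := norm_pos_iff.2 (hl v List.mem_cons_self)
      have : Real.exp (t * ‖v‖ ^ 2) = 1 := by linarith
      rw [Real.exp_eq_one_iff] at this
      have : 0 < t * ‖v‖ ^ 2 := by positivity
      linarith
    filter_upwards [h1, h2] with ξ h1 h2
    simp only [Dfun, mul_one] at h2 ⊢
    exact mul_ne_zero h2 h1

open MeasureTheory Filter Topology Set
open scoped RealInnerProductSpace Pointwise BigOperators

/-! ### Measures: analyticity, invariance, integrability on cones -/

theorem integrable_bdd_supp {d : ℕ} {m : Measure (Vd d)} (w : Vd d → ℝ) (hw : Measurable w)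
    (C R : ℝ) (hC : ∀ x, ‖x‖ ≤ R → |w x| ≤ C) (hR : ∀ x, R < ‖x‖ → w x = 0)
    (hm : m (Metric.closedBall 0 R) < ⊤) : Integrable w m := by
  have h1 : IntegrableOn w (Metric.closedBall 0 R) m := by
    apply Measure.integrableOn_of_bounded (M := C) hm.ne hw.aestronglyMeasurable
    rw [ae_restrict_iff' Metric.isClosed_closedBall.measurableSet]
    refine Eventually.of_forall (fun x hx => ?_)
    exact hC x (by simpa using hx)
  rwa [integrableOn_iff_integrable_of_support_subset] at h1
  intro x hx
  by_contra hn
  exact hx (hR x (by simpa using hn))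

theorem meas_exp {d : ℕ} (ξ : Vd d) : Measurable (fun x : Vd d => Real.exp ⟪ξ, x⟫) := by
  fun_prop

theorem line_analytic_pos {d : ℕ} {m : Measure (Vd d)} (w : Vd d → ℝ) (hw : Measurable w)
    (C R : ℝ) (hw0 : ∀ x, 0 ≤ w x) (hC : ∀ x, |w x| ≤ C) (hR : ∀ x, R < ‖x‖ → w x = 0)
    (hm : m (Metric.closedBall 0 R) < ⊤) (ξ u : Vd d) (t : ℝ) :
    AnalyticAt ℝ (fun t : ℝ => ∫ x, w x * Real.exp ⟪ξ + t • u, x⟫ ∂m) t := by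
  have hC0 : 0 ≤ C := (abs_nonneg _).trans (hC 0)
  let dens : Vd d → ENNReal := fun x => ENNReal.ofReal (w x * Real.exp ⟪ξ, x⟫)
  have hdens : Measurable dens := (hw.mul (meas_exp ξ)).ennreal_ofReal
  have hfin : ∀ᵐ x ∂m, dens x < ⊤ := Eventually.of_forall (fun x => ENNReal.ofReal_lt_top)
  let ν := m.withDensity dens
  have key : ∀ (t : ℝ) (x : Vd d), (dens x).toReal • Real.exp (t * ⟪u, x⟫) =
      w x * Real.exp ⟪ξ + t • u, x⟫ := by
    intro t x
    simp only [dens]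
    rw [ENNReal.toReal_ofReal (mul_nonneg (hw0 x) (Real.exp_pos _).le), inner_add_left,
      inner_smul_left, Real.exp_add, smul_eq_mul]
    simp only [conj_trivial]
    ring
  have hIntg : ∀ ζ : Vd d, Integrable (fun x => w x * Real.exp ⟪ζ, x⟫) m := by
    intro ζ
    apply integrable_bdd_supp _ (hw.mul (meas_exp ζ)) (C * Real.exp (‖ζ‖ * R)) R _ _ hm
    · intro x hx
      change |w x * Real.exp ⟪ζ, x⟫| ≤ _
      rw [abs_mul, Real.abs_exp]
      refine mul_le_mul (hC x) ?_ (Real.exp_pos _).le hC0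
      apply Real.exp_le_exp.2
      exact (real_inner_le_norm ζ x).trans (by gcongr)
    · intro x hx
      change w x * Real.exp ⟪ζ, x⟫ = 0
      rw [hR x hx, zero_mul]
  have hexp : ∀ t, t ∈ ProbabilityTheory.integrableExpSet (fun x : Vd d => ⟪u, x⟫) ν := by
    intro t
    change Integrable (fun x : Vd d => Real.exp (t * ⟪u, x⟫)) ν
    rw [integrable_withDensity_iff_integrable_smul' hdens hfin]
    simp only [key]
    exact hIntg _
  have hset : interior (ProbabilityTheory.integrableExpSet (fun x : Vd d => ⟪u, x⟫) ν) = univ := by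
    rw [show ProbabilityTheory.integrableExpSet (fun x : Vd d => ⟪u, x⟫) ν = univ from
      eq_univ_of_forall hexp, interior_univ]
  have := ProbabilityTheory.analyticAt_mgf (X := fun x : Vd d => ⟪u, x⟫) (μ := ν) (t := t)
    (by rw [hset]; trivial)
  refine this.congr (Eventually.of_forall fun t => ?_)
  simp only [ProbabilityTheory.mgf]
  rw [integral_withDensity_eq_integral_toReal_smul hdens hfin]
  simp only [key]

theorem line_analytic {d : ℕ} {m : Measure (Vd d)} (w : Vd d → ℝ) (hw : Measurable w)
    (C R : ℝ) (hC : ∀ x, |w x| ≤ C) (hR : ∀ x, R < ‖x‖ → w x = 0)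
    (hm : m (Metric.closedBall 0 R) < ⊤) (ξ u : Vd d) (t : ℝ) :
    AnalyticAt ℝ (fun t : ℝ => ∫ x, w x * Real.exp ⟪ξ + t • u, x⟫ ∂m) t := by
  have hC0 : 0 ≤ C := (abs_nonneg _).trans (hC 0)
  have b1 : ∀ x, |max (w x) 0| ≤ C := fun x => by
    rw [abs_of_nonneg (le_max_right _ _)]
    exact max_le ((le_abs_self _).trans (hC x)) hC0
  have b2 : ∀ x, |max (-w x) 0| ≤ C := fun x => by
    rw [abs_of_nonneg (le_max_right _ _)]
    exact max_le ((neg_le_abs _).trans (hC x)) hC0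
  have r1 : ∀ x, R < ‖x‖ → max (w x) 0 = 0 := fun x hx => by rw [hR x hx]; simp
  have r2 : ∀ x, R < ‖x‖ → max (-w x) 0 = 0 := fun x hx => by rw [hR x hx]; simp
  have m1 : Measurable (fun x => max (w x) 0) := hw.max measurable_const
  have m2 : Measurable (fun x => max (-w x) 0) := hw.neg.max measurable_const
  have h1 := line_analytic_pos (m := m) (fun x => max (w x) 0) m1 C R
    (fun x => le_max_right _ _) b1 r1 hm ξ u t
  have h2 := line_analytic_pos (m := m) (fun x => max (-w x) 0) m2 C R
    (fun x => le_max_right _ _) b2 r2 hm ξ u t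
  have hIntg : ∀ (f : Vd d → ℝ), Measurable f → (∀ x, |f x| ≤ C) → (∀ x, R < ‖x‖ → f x = 0) →
      ∀ ζ : Vd d, Integrable (fun x => f x * Real.exp ⟪ζ, x⟫) m := by
    intro f hf hC hR ζ
    apply integrable_bdd_supp _ (hf.mul (meas_exp ζ)) (C * Real.exp (‖ζ‖ * R)) R _ _ hm
    · intro x hx
      change |f x * Real.exp ⟪ζ, x⟫| ≤ _
      rw [abs_mul, Real.abs_exp]
      refine mul_le_mul (hC x) ?_ (Real.exp_pos _).le hC0
      apply Real.exp_le_exp.2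
      exact (real_inner_le_norm ζ x).trans (by gcongr)
    · intro x hx
      change f x * Real.exp ⟪ζ, x⟫ = 0
      rw [hR x hx, zero_mul]
  refine (h1.sub h2).congr (Eventually.of_forall fun t => ?_)
  simp only [Pi.sub_apply]
  rw [← integral_sub (hIntg _ m1 b1 r1 _) (hIntg _ m2 b2 r2 _)]
  congr 1
  ext x
  rw [← sub_mul]
  congr 1
  rcases le_total 0 (w x) with h | h
  · rw [max_eq_left h, max_eq_right (by linarith)]; ring
  · rw [max_eq_right h, max_eq_left (by linarith)]; ring

theorem Dl_integral {d : ℕ} {m : Measure (Vd d)} (l : List (Vd d))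
    (hinv : ∀ v ∈ l, MeasurePreserving (fun x => x + v) m m) (f : Vd d → ℝ) (ξ : Vd d)
    (hf : Integrable (fun x => f x * Real.exp ⟪ξ, x⟫) m) :
    Integrable (fun x => Dl l f x * Real.exp ⟪ξ, x⟫) m ∧
      ∫ x, Dl l f x * Real.exp ⟪ξ, x⟫ ∂m = Dfun l ξ * ∫ x, f x * Real.exp ⟪ξ, x⟫ ∂m := by
  induction l with
  | nil => exact ⟨hf, by simp [Dl, Dfun]⟩
  | cons v l ih =>
    obtain ⟨i1, e1⟩ := ih (fun w hw => hinv w (List.mem_cons_of_mem _ hw))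
    have hv := hinv v List.mem_cons_self
    have emb : MeasurableEmbedding (fun x : Vd d => x + v) := measurableEmbedding_addRight v
    have heq : (fun x => (fun x => Dl l f (x - v) * Real.exp ⟪ξ, x⟫) (x + v)) =
        fun x => Real.exp ⟪ξ, v⟫ * (Dl l f x * Real.exp ⟪ξ, x⟫) := by
      ext x
      simp only [add_sub_cancel_right, inner_add_right, Real.exp_add]
      ring
    have i2 : Integrable (fun x => Dl l f (x - v) * Real.exp ⟪ξ, x⟫) m := by
      rw [← hv.integrable_comp_emb emb]
      change Integrable (fun x => (fun x => Dl l f (x - v) * Real.exp ⟪ξ, x⟫) (x + v)) m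
      rw [heq]
      exact i1.const_mul _
    have e2 : ∫ x, Dl l f (x - v) * Real.exp ⟪ξ, x⟫ ∂m =
        Real.exp ⟪ξ, v⟫ * ∫ x, Dl l f x * Real.exp ⟪ξ, x⟫ ∂m := by
      rw [← hv.integral_comp emb, heq, integral_const_mul]
    have hs : (fun x => Dl (v :: l) f x * Real.exp ⟪ξ, x⟫) =
        fun x => Dl l f x * Real.exp ⟪ξ, x⟫ - Dl l f (x - v) * Real.exp ⟪ξ, x⟫ := by
      ext x; simp only [Dl]; ring
    refine ⟨by rw [hs]; exact i1.sub i2, ?_⟩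
    rw [hs, integral_sub i1 i2, e2, e1]
    simp only [Dfun]; ring

theorem cone_lintegral {d : ℕ} {m : Measure (Vd d)} (hfin : ∀ R, m (Metric.closedBall 0 R) < ⊤)
    (ξ : Vd d) (l : List (Vd d)) (hinv : ∀ v ∈ l, MeasurePreserving (fun x => x + v) m m)
    (hneg : ∀ v ∈ l, ⟪ξ, v⟫ < 0) : ∀ R : ℝ,
    ∫⁻ x in (Metric.closedBall 0 R + coneOf l), ENNReal.ofReal (Real.exp ⟪ξ, x⟫) ∂m < ⊤ := by
  induction l with
  | nil =>
    intro R
    simp only [coneOf, add_singleton, add_zero, image_id']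
    refine lt_of_le_of_lt (setLIntegral_mono (g := fun _ => ENNReal.ofReal (Real.exp (‖ξ‖ * R)))
      measurable_const (fun x hx => ?_)) ?_
    · apply ENNReal.ofReal_le_ofReal
      apply Real.exp_le_exp.2
      have : ‖x‖ ≤ R := by simpa using hx
      exact (real_inner_le_norm ξ x).trans (by gcongr)
    · rw [setLIntegral_const]
      exact ENNReal.mul_lt_top ENNReal.ofReal_lt_top (hfin R)
  | cons v l ih =>
    intro R
    have ih := ih (fun w hw => hinv w (List.mem_cons_of_mem _ hw))
      (fun w hw => hneg w (List.mem_cons_of_mem _ hw)) (R + ‖v‖)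
    have hv := hinv v List.mem_cons_self
    have hvn := hneg v List.mem_cons_self
    set A := Metric.closedBall (0 : Vd d) (R + ‖v‖) + coneOf l with hA
    have hcov : Metric.closedBall 0 R + coneOf (v :: l) ⊆
        ⋃ n : ℕ, (fun x => x + v)^[n] '' A := by
      rintro _ ⟨k, hk, y, ⟨t, ht, hy⟩, rfl⟩
      rw [mem_iUnion]
      refine ⟨⌊t⌋₊, (k + (t - ⌊t⌋₊) • v) + (y - t • v), ⟨_, ?_, _, hy, rfl⟩, ?_⟩
      · rw [mem_closedBall_zero_iff] at hk ⊢
        refine (norm_add_le _ _).trans (add_le_add hk ?_)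
        rw [norm_smul]
        have h1 := Nat.floor_le ht
        have h2 := Nat.lt_floor_add_one t
        have h3 : ‖t - (⌊t⌋₊ : ℝ)‖ ≤ 1 := by
          rw [Real.norm_eq_abs, abs_le]; constructor <;> linarith
        nlinarith [norm_nonneg v]
      · simp only [add_right_iterate]
        rw [← Nat.cast_smul_eq_nsmul ℝ]
        module
    have hit : ∀ n : ℕ, ∫⁻ x in (fun x => x + v)^[n] '' A, ENNReal.ofReal (Real.exp ⟪ξ, x⟫) ∂m =
        ENNReal.ofReal (Real.exp ⟪ξ, v⟫) ^ n * ∫⁻ x in A, ENNReal.ofReal (Real.exp ⟪ξ, x⟫) ∂m := by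
      intro n
      induction n with
      | zero => simp
      | succ n ihn =>
        have emb : MeasurableEmbedding (fun x : Vd d => x + v) := measurableEmbedding_addRight v
        rw [Function.iterate_succ', image_comp,
          ← hv.setLIntegral_comp_emb emb, pow_succ', mul_assoc, ← ihn,
          ← lintegral_const_mul _ (meas_exp ξ).ennreal_ofReal]
        congr 1
        ext x
        rw [inner_add_right, Real.exp_add, mul_comm, ENNReal.ofReal_mul (Real.exp_pos _).le]
    refine lt_of_le_of_lt (lintegral_mono_set hcov) ?_
    refine lt_of_le_of_lt (lintegral_iUnion_le _ _) ?_
    simp only [hit]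
    rw [ENNReal.tsum_mul_right, ENNReal.tsum_geometric]
    refine ENNReal.mul_lt_top ?_ ih
    rw [ENNReal.inv_lt_top, tsub_pos_iff_lt]
    rw [← ENNReal.ofReal_one]
    rw [ENNReal.ofReal_lt_ofReal_iff one_pos]
    exact Real.exp_lt_one_iff.2 hvn

open MeasureTheory Filter Topology Set
open scoped RealInnerProductSpace Pointwise BigOperators

/-! ### The valuation property -/

theorem coneOf_nz {d : ℕ} (l : List (Vd d)) :
    ∃ l' : List (Vd d), coneOf l' = coneOf l ∧ ∀ v ∈ l', v ≠ 0 ∧ v ∈ l := by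
  induction l with
  | nil => exact ⟨[], rfl, by simp⟩
  | cons v l ih =>
    obtain ⟨l', h1, h2⟩ := ih
    by_cases hv : v = 0
    · refine ⟨l', ?_, fun w hw => ⟨(h2 w hw).1, List.mem_cons_of_mem _ (h2 w hw).2⟩⟩
      rw [h1]
      ext x
      subst hv
      simp only [coneOf, smul_zero, sub_zero]
      exact ⟨fun h => ⟨0, le_rfl, h⟩, fun ⟨_, _, h⟩ => h⟩
    · refine ⟨v :: l', ?_, ?_⟩
      · simp only [coneOf, h1]
      · intro w hw
        rcases List.mem_cons.1 hw with rfl | hw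
        · exact ⟨hv, List.mem_cons_self⟩
        · exact ⟨(h2 w hw).1, List.mem_cons_of_mem _ (h2 w hw).2⟩

theorem coneOf_large {d : ℕ} (l : List (Vd d)) (K : ℝ) (hK : 0 ≤ K) : ∀ y ∈ coneOf l,
    ‖y‖ ≤ K * tlen l ∨ ∃ v ∈ l, y - K • v ∈ coneOf l := by
  induction l with
  | nil =>
    intro y hy
    left
    have : y = 0 := hy
    simp [this, tlen]
  | cons v l ih =>
    rintro y ⟨t, ht, hy⟩
    by_cases htK : K ≤ t
    · right
      refine ⟨v, List.mem_cons_self, t - K, by linarith, ?_⟩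
      convert hy using 1
      module
    · push Not at htK
      rcases ih _ hy with h | ⟨w, hw, h⟩
      · left
        have : ‖y‖ ≤ ‖y - t • v‖ + ‖t • v‖ := by
          simpa using norm_add_le (y - t • v) (t • v)
        rw [norm_smul, Real.norm_of_nonneg ht] at this
        simp only [tlen]
        nlinarith [norm_nonneg v]
      · right
        refine ⟨w, List.mem_cons_of_mem _ hw, t, ht, ?_⟩
        convert h using 1
        module

/-- indicator function -/
noncomputable def ind {d : ℕ} (P : Set (Vd d)) : Vd d → ℝ := P.indicator (fun _ => 1)

theorem ind_congr {d : ℕ} {P : Set (Vd d)} {x y : Vd d} (h : x ∈ P ↔ y ∈ P) :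
    ind P x = ind P y := by
  unfold ind
  by_cases hx : x ∈ P
  · rw [indicator_of_mem hx, indicator_of_mem (h.1 hx)]
  · rw [indicator_of_notMem hx, indicator_of_notMem (fun hy => hx (h.2 hy))]

theorem Dl_supp {d : ℕ} (h lv l : List (Vd d)) (hc : hset h = coneOf lv)
    (hlv : ∀ v ∈ lv, v ∈ l) (s : Vd d) :
    ∃ R, ∀ x, R < ‖x‖ → Dl l (ind {x | x - s ∈ hset h}) x = 0 := by
  set T := tlen l
  have hT : 0 ≤ T := tlen_nonneg l
  have hK : ∀ᶠ K : ℝ in atTop, 0 ≤ K ∧ ∀ g ∈ h, ∀ v ∈ lv, 0 < ⟪g, v⟫ →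
      ‖g‖ * (2 * T) + ⟪g, v⟫ ≤ K * ⟪g, v⟫ := by
    refine (eventually_ge_atTop 0).and ?_
    refine (Filter.eventually_all_finite (List.finite_toSet h)).2 (fun g hg => ?_)
    refine (Filter.eventually_all_finite (List.finite_toSet lv)).2 (fun v hv => ?_)
    by_cases hp : 0 < ⟪g, v⟫
    · filter_upwards [eventually_ge_atTop ((‖g‖ * (2 * T) + ⟪g, v⟫) / ⟪g, v⟫)] with K hK _
      rwa [div_le_iff₀ hp] at hK
    · exact Eventually.of_forall fun K h => absurd h hp
  obtain ⟨K, hK0, hK⟩ := hK.exists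
  refine ⟨K * tlen lv + ‖s‖ + T, fun x hx => ?_⟩
  by_cases hex : ∃ y0, ‖y0 - x‖ ≤ T ∧ y0 - s ∈ hset h
  · obtain ⟨y0, hy0, hy0P⟩ := hex
    have hbig : K * tlen lv < ‖y0 - s‖ := by
      have h1 : ‖x‖ ≤ ‖y0 - s‖ + ‖s‖ + ‖y0 - x‖ := by
        calc ‖x‖ = ‖(y0 - s) + s - (y0 - x)‖ := by congr 1; abel
          _ ≤ ‖(y0 - s) + s‖ + ‖y0 - x‖ := norm_sub_le _ _
          _ ≤ _ := by gcongr; exact norm_add_le _ _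
      linarith
    rcases coneOf_large lv K hK0 (y0 - s) (hc ▸ hy0P) with hh | ⟨v, hv, hyv⟩
    · linarith
    · rw [← hc] at hyv
      apply Dl_zero_of_mem l _ v (hlv v hv)
      intro y hy
      apply ind_congr
      have hvc : v ∈ hset h := hc ▸ coneOf_mem lv v hv
      have hg : ∀ g ∈ h, (0 ≤ ⟪g, y - s⟫ ↔ 0 ≤ ⟪g, y - v - s⟫) := by
        intro g hg
        have e1 : ⟪g, y - v - s⟫ = ⟪g, y - s⟫ - ⟪g, v⟫ := by
          rw [← inner_sub_right]; congr 1; abel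
        rcases (hvc g hg).lt_or_eq with hp | hp
        · have h1 := hK g hg v hv hp
          have h2 := hyv g hg
          rw [inner_sub_right, inner_smul_right] at h2
          have e2 : ⟪g, y - s⟫ = ⟪g, y0 - s⟫ - ⟪g, y0 - y⟫ := by
            rw [← inner_sub_right]; congr 1; abel
          have h3 : ⟪g, y0 - y⟫ ≤ ‖g‖ * (2 * T) := by
            refine (real_inner_le_norm _ _).trans ?_
            gcongr
            calc ‖y0 - y‖ = ‖(y0 - x) - (y - x)‖ := by congr 1; abel
              _ ≤ _ := norm_sub_le _ _
              _ ≤ _ := by linarith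
          constructor <;> intro <;> linarith
        · rw [e1, ← hp, sub_zero]
      exact ⟨fun hy g hgm => (hg g hgm).1 (hy g hgm), fun hy g hgm => (hg g hgm).2 (hy g hgm)⟩
  · push Not at hex
    apply Dl_zero
    intro y hy
    exact indicator_of_notMem (s := {x | x - s ∈ hset h}) (hex y hy) _

theorem hset_closed {d : ℕ} (h : List (Vd d)) : IsClosed (hset h) := by
  have : hset h = ⋂ g ∈ h, {x | 0 ≤ ⟪g, x⟫} := by
    ext x; simp [hset]
  rw [this]
  refine isClosed_biInter fun g _ => isClosed_le continuous_const (by fun_prop)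

theorem ind_meas {d : ℕ} (h : List (Vd d)) (s : Vd d) :
    MeasurableSet {x | x - s ∈ hset h} := by
  have : IsClosed {x | x - s ∈ hset h} :=
    (hset_closed h).preimage (by fun_prop : Continuous fun x : Vd d => x - s)
  exact this.measurableSet

/-- regularized valuation property -/
def VP {d : ℕ} (m : Measure (Vd d)) (l : List (Vd d)) (P : Set (Vd d)) (F : Vd d → ℝ) : Prop :=
  (∀ ξ : Vd d, Integrable (fun x => Dl l (ind P) x * Real.exp ⟪ξ, x⟫) m) ∧
    ∀ᶠ ξ in mf d, Dfun l ξ * F ξ = ∫ x, Dl l (ind P) x * Real.exp ⟪ξ, x⟫ ∂m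

theorem vp_main {d : ℕ} {m : Measure (Vd d)} (hfin : ∀ R, m (Metric.closedBall 0 R) < ⊤)
    {Λ' : AddSubgroup (Vd d)} (h lv l : List (Vd d)) (hc : hset h = coneOf lv)
    (hlv : ∀ v ∈ lv, v ∈ l) (hl0 : ∀ v ∈ l, v ≠ 0)
    (hinv : ∀ v ∈ l, MeasurePreserving (fun x => x + v) m m) (s : Vd d) (F : Vd d → ℝ)
    (hF : RatMeromorphicAt0 Λ' F) (hline : ContainsLine {x | x - s ∈ hset h} → ∀ ξ, F ξ = 0)
    (hconv : ∀ ξ : Vd d, IntegrableOn (fun x => Real.exp ⟪ξ, x⟫) {x | x - s ∈ hset h} m →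
      F ξ = ∫ x in {x | x - s ∈ hset h}, Real.exp ⟪ξ, x⟫ ∂m) :
    VP m l {x | x - s ∈ hset h} F := by
  set P := {x | x - s ∈ hset h} with hP
  have hPm : MeasurableSet P := ind_meas h s
  have indm : Measurable (ind P) := measurable_const.indicator hPm
  obtain ⟨R, hR⟩ := Dl_supp h lv l hc hlv s
  obtain ⟨C, hC⟩ := Dl_bdd l (ind P) 1 (fun x => by
    unfold ind indicator; split_ifs <;> simp)
  have hC0 : 0 ≤ C := (abs_nonneg _).trans (hC 0)
  have hDm := Dl_meas l _ indm
  refine ⟨fun ζ => ?_, ?_⟩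
  · apply integrable_bdd_supp _ (hDm.mul (meas_exp ζ)) (C * Real.exp (‖ζ‖ * R)) R _ _ (hfin R)
    · intro x hx
      change |Dl l (ind P) x * Real.exp ⟪ζ, x⟫| ≤ _
      rw [abs_mul, Real.abs_exp]
      refine mul_le_mul (hC x) ?_ (Real.exp_pos _).le hC0
      apply Real.exp_le_exp.2
      exact (real_inner_le_norm ζ x).trans (by gcongr)
    · intro x hx
      change Dl l (ind P) x * Real.exp ⟪ζ, x⟫ = 0
      rw [hR x hx, zero_mul]
  by_cases hA : ∃ v ∈ lv, ∀ g ∈ h, ⟪g, v⟫ = 0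
  · obtain ⟨v, hv, hg⟩ := hA
    have h1 : ContainsLine P := by
      refine ⟨s, v, hl0 v (hlv v hv), fun t g hgm => ?_⟩
      rw [add_sub_cancel_left, inner_smul_right, hg g hgm, mul_zero]
    have h2 : ∀ x, Dl l (ind P) x = 0 := by
      intro x
      apply Dl_zero_of_mem l _ v (hlv v hv)
      intro y _
      apply ind_congr
      have : ∀ g ∈ h, ⟪g, y - v - s⟫ = ⟪g, y - s⟫ := by
        intro g hgm
        rw [show y - v - s = (y - s) - v by abel, inner_sub_right, hg g hgm, sub_zero]
      exact ⟨fun hy g hgm => by rw [this g hgm]; exact hy g hgm,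
        fun hy g hgm => by rw [← this g hgm]; exact hy g hgm⟩
    refine Eventually.of_forall fun ξ => ?_
    simp [h2, hline h1 ξ]
  · push Not at hA
    refine mero_extend hF (Dfun_analytic l) (fun ξ u t => ?_)
      {ξ | ∀ v ∈ lv, ⟪ξ, v⟫ < 0} ?_ ?_ ?_
    · exact line_analytic _ hDm C R hC hR (hfin R) ξ u t
    · have : {ξ : Vd d | ∀ v ∈ lv, ⟪ξ, v⟫ < 0} = ⋂ v ∈ lv, {ξ | ⟪ξ, v⟫ < 0} := by
        ext; simp
      rw [this]
      exact (List.finite_toSet lv).isOpen_biInter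
        fun v _ => isOpen_lt (by fun_prop) continuous_const
    · intro r hr
      have hneg : ∀ v ∈ lv, ⟪-h.sum, v⟫ < 0 := by
        intro v hv
        have hvc : v ∈ hset h := hc ▸ coneOf_mem lv v hv
        obtain ⟨g, hg, hgv⟩ := hA v hv
        have hsum : ∀ h' : List (Vd d), (∀ g ∈ h', 0 ≤ ⟪g, v⟫) →
            (0 ≤ ⟪h'.sum, v⟫ ∧ ∀ g ∈ h', ⟪g, v⟫ ≤ ⟪h'.sum, v⟫) := by
          intro h'
          induction h' with
          | nil => simp
          | cons a h' ih =>
            intro hh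
            obtain ⟨i1, i2⟩ := ih (fun g hg => hh g (List.mem_cons_of_mem _ hg))
            have ha := hh a List.mem_cons_self
            rw [List.sum_cons, inner_add_left]
            refine ⟨by linarith, fun g hg => ?_⟩
            rcases List.mem_cons.1 hg with rfl | hg
            · linarith
            · have := i2 g hg; linarith
        have h1 := (hsum h hvc).2 g hg
        have h2 := (hvc g hg).lt_of_ne (Ne.symm hgv)
        rw [inner_neg_left]; linarith
      set ξ0 := -h.sum
      refine ⟨(r / 2 / (‖ξ0‖ + 1)) • ξ0, fun v hv => ?_, ?_⟩
      · rw [inner_smul_left]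
        exact mul_neg_of_pos_of_neg (by simp; positivity) (hneg v hv)
      · rw [mem_ball_zero_iff, norm_smul, Real.norm_of_nonneg (by positivity), div_mul_eq_mul_div,
          div_lt_iff₀ (by positivity)]
        nlinarith [norm_nonneg ξ0]
    · intro ξ hξ
      have hIntg : IntegrableOn (fun x => Real.exp ⟪ξ, x⟫) P m := by
        refine ⟨(meas_exp ξ).aestronglyMeasurable, ?_⟩
        rw [hasFiniteIntegral_iff_ofReal (Eventually.of_forall fun x => (Real.exp_pos _).le)]
        refine lt_of_le_of_lt (lintegral_mono_set ?_)
          (cone_lintegral hfin ξ lv (fun v hv => hinv v (hlv v hv)) hξ ‖s‖)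
        intro x hx
        exact ⟨s, by simp, x - s, hc ▸ hx, by simp⟩
      have e : (fun x => ind P x * Real.exp ⟪ξ, x⟫) = P.indicator (fun x => Real.exp ⟪ξ, x⟫) := by
        ext x
        unfold ind indicator
        split_ifs <;> simp
      rw [(Dl_integral l hinv (ind P) ξ (by rw [e]; exact hIntg.integrable_indicator hPm)).2, e,
        integral_indicator hPm, hconv ξ hIntg]

theorem vp_null {d : ℕ} {m : Measure (Vd d)} (l : List (Vd d))
    (hinv : ∀ v ∈ l, MeasurePreserving (fun x => x + v) m m) (P : Set (Vd d)) (hP : m P = 0)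
    (F : Vd d → ℝ) (hF : ∀ ξ, F ξ = 0) : VP m l P F := by
  have h0 : ∀ ξ : Vd d, (fun x => ind P x * Real.exp ⟪ξ, x⟫) =ᵐ[m] 0 := by
    intro ξ
    have : ∀ᵐ x ∂m, x ∉ P := measure_eq_zero_iff_ae_notMem.1 hP
    filter_upwards [this] with x hx
    simp [ind, hx]
  have hi : ∀ ξ : Vd d, Integrable (fun x => ind P x * Real.exp ⟪ξ, x⟫) m := fun ξ =>
    (integrable_zero _ _ _).congr (h0 ξ).symm
  refine ⟨fun ξ => (Dl_integral l hinv _ ξ (hi ξ)).1, Eventually.of_forall fun ξ => ?_⟩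
  rw [(Dl_integral l hinv _ ξ (hi ξ)).2, integral_congr_ae (h0 ξ), hF ξ]
  simp

theorem vp_four {d : ℕ} {m : Measure (Vd d)} (l : List (Vd d)) (hl0 : ∀ v ∈ l, v ≠ 0)
    {P1 P2 P3 P4 : Set (Vd d)} {F1 F2 F3 F4 : Vd d → ℝ} (h1 : VP m l P1 F1) (h2 : VP m l P2 F2)
    (h3 : VP m l P3 F3) (h4 : VP m l P4 F4)
    (hu : P1 ∪ P2 = P3) (hi : P1 ∩ P2 = P4) :
    ∀ᶠ ξ in mf d, F1 ξ + F2 ξ = F3 ξ + F4 ξ := by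
  have hind : (fun y => ind P1 y + ind P2 y) = fun y => ind P3 y + ind P4 y := by
    ext y
    subst hu hi
    unfold ind
    have := congrFun (indicator_union_add_inter (fun _ => (1 : ℝ)) P1 P2) y
    simpa using this.symm
  filter_upwards [h1.2, h2.2, h3.2, h4.2, Dfun_ne_zero l hl0] with ξ e1 e2 e3 e4 hD
  apply mul_left_cancel₀ hD
  rw [mul_add, mul_add, e1, e2, e3, e4, ← integral_add (h1.1 ξ) (h2.1 ξ),
    ← integral_add (h3.1 ξ) (h4.1 ξ)]
  congr 1
  ext x
  rw [← add_mul, ← add_mul, ← Dl_add, ← Dl_add, hind]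

open MeasureTheory Filter Topology Set
open scoped RealInnerProductSpace Pointwise BigOperators

/-! ### Discrete subgroups -/

theorem discrete_basis {d : ℕ} (A : AddSubgroup (Vd d)) (ε : ℝ) (hε : 0 < ε)
    (hA : ∀ x ∈ A, x ≠ 0 → ε ≤ ‖x‖) :
    ∃ (k : ℕ) (v : Fin k → Vd d), (∀ i, v i ∈ A) ∧ LinearIndependent ℝ v ∧
      ∀ y ∈ A, ∃ c : Fin k → ℤ, y = ∑ i, (c i : ℝ) • v i := by
  let L : Submodule ℤ (Vd d) := AddSubgroup.toIntSubmodule A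
  have hL : ∀ x, x ∈ L ↔ x ∈ A := fun x => Iff.rfl
  have : DiscreteTopology L := by
    refine DiscreteTopology.of_forall_le_dist hε fun x y hne => ?_
    change ε ≤ dist x y
    rw [Subtype.dist_eq, dist_eq_norm]
    refine hA _ (A.sub_mem ((hL _).1 x.2) ((hL _).1 y.2)) ?_
    rw [sub_ne_zero]
    exact fun h => hne (Subtype.ext h)
  let b := Module.finBasis ℤ L
  have hspan : Submodule.span ℤ (Set.range (fun i => (b i : Vd d))) = L := by
    have := congrArg (Submodule.map L.subtype) b.span_eq
    rw [Submodule.map_span, Submodule.map_top, Submodule.range_subtype, ← Set.range_comp] at this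
    exact this
  refine ⟨Module.finrank ℤ L, fun i => (b i : Vd d), fun i => (hL _).1 (b i).2, ?_, ?_⟩
  · rw [linearIndependent_iff_card_eq_finrank_span]
    have := Real.finrank_eq_int_finrank_of_discrete (s := Set.range (fun i => (b i : Vd d)))
      (by rw [hspan]; infer_instance)
    rw [this]
    rw [Set.finrank, hspan]
    simp
  · intro y hy
    refine ⟨fun i => b.repr ⟨y, hy⟩ i, ?_⟩
    have := congrArg (fun z : L => (z : Vd d)) (b.sum_repr ⟨y, hy⟩)
    simp only [Submodule.coe_sum, Submodule.coe_smul] at this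
    refine this.symm.trans (Finset.sum_congr rfl fun i _ => ?_)
    exact (Int.cast_smul_eq_zsmul ℝ _ _).symm

theorem discrete_finite {d : ℕ} (A : AddSubgroup (Vd d)) (ε : ℝ) (hε : 0 < ε)
    (hA : ∀ x ∈ A, x ≠ 0 → ε ≤ ‖x‖) (R : ℝ) :
    (Metric.closedBall (0 : Vd d) R ∩ (A : Set (Vd d))).Finite := by
  have : DiscreteTopology A := by
    refine DiscreteTopology.of_forall_le_dist hε fun x y hne => ?_
    change ε ≤ dist x y
    rw [Subtype.dist_eq, dist_eq_norm]
    refine hA _ (A.sub_mem x.2 y.2) ?_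
    rw [sub_ne_zero]
    exact fun h => hne (Subtype.ext h)
  exact Metric.finite_isBounded_inter_isClosed DiscreteTopology.isDiscrete
        Metric.isBounded_closedBall inferInstance

/-! ### The counting measure on a discrete subgroup -/

/-- counting measure -/
noncomputable def cm {d : ℕ} (A : AddSubgroup (Vd d)) : Measure (Vd d) :=
  Measure.count.restrict (A : Set (Vd d))

theorem sub_countable {d : ℕ} {A : AddSubgroup (Vd d)}
    (hA : ∀ R, (Metric.closedBall (0 : Vd d) R ∩ (A : Set (Vd d))).Finite) :
    (A : Set (Vd d)).Countable := by
  have : (A : Set (Vd d)) = ⋃ n : ℕ, (Metric.closedBall (0 : Vd d) n ∩ (A : Set (Vd d))) := by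
    rw [← iUnion_inter, Metric.iUnion_closedBall_nat, univ_inter]
  rw [this]
  exact countable_iUnion fun n => (hA n).countable

theorem cm_fin {d : ℕ} {A : AddSubgroup (Vd d)}
    (hA : ∀ R, (Metric.closedBall (0 : Vd d) R ∩ (A : Set (Vd d))).Finite) (R : ℝ) :
    cm A (Metric.closedBall 0 R) < ⊤ := by
  rw [cm, Measure.restrict_apply Metric.isClosed_closedBall.measurableSet]
  exact Measure.count_apply_lt_top.2 (hA R)

theorem cm_inv {d : ℕ} {A : AddSubgroup (Vd d)}
    (hA : ∀ R, (Metric.closedBall (0 : Vd d) R ∩ (A : Set (Vd d))).Finite) (v : Vd d)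
    (hv : v ∈ A) : MeasurePreserving (fun x => x + v) (cm A) (cm A) := by
  have hm : MeasurableSet (A : Set (Vd d)) := (sub_countable hA).measurableSet
  have h1 : MeasurePreserving (fun x : Vd d => x + v) Measure.count Measure.count := by
    refine ⟨measurable_add_const v, ?_⟩
    ext s hs
    rw [Measure.map_apply (measurable_add_const v) hs, Measure.count_apply hs,
      Measure.count_apply (hs.preimage (measurable_add_const v))]
    congr 1
    exact Set.encard_preimage_of_bijective (Equiv.addRight v).bijective s
  have h2 := h1.restrict_preimage hm
  have h3 : (fun x : Vd d => x + v) ⁻¹' (A : Set (Vd d)) = A := by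
    ext x
    exact A.add_mem_cancel_right hv
  rw [h3] at h2
  exact h2

theorem cm_sum {d : ℕ} {A : AddSubgroup (Vd d)}
    (hA : ∀ R, (Metric.closedBall (0 : Vd d) R ∩ (A : Set (Vd d))).Finite)
    (P : Set (Vd d)) (hP : MeasurableSet P) (f : Vd d → ℝ) (hf : IntegrableOn f P (cm A)) :
    Summable (fun x : ↥(P ∩ (A : Set (Vd d))) => f x) ∧
    ∫ x in P, f x ∂(cm A) = ∑' x : ↥(P ∩ (A : Set (Vd d))), f x := by
  have hc := (sub_countable hA).mono (inter_subset_right (s := P))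
  have hm : MeasurableSet (P ∩ (A : Set (Vd d))) := hc.measurableSet
  have : Countable ↥(P ∩ (A : Set (Vd d))) := hc.to_subtype
  have e : (cm A).restrict P = Measure.count.restrict (P ∩ (A : Set (Vd d))) := by
    rw [cm, Measure.restrict_restrict hP]
  have hcount : Measure.comap (Subtype.val : ↥(P ∩ (A : Set (Vd d))) → Vd d) Measure.count =
      Measure.count := by
    ext s hs
    rw [(MeasurableEmbedding.subtype_coe hm).comap_apply,
      Measure.count_apply ((MeasurableEmbedding.subtype_coe hm).measurableSet_image.2 hs),
      Measure.count_apply hs, Subtype.val_injective.encard_image]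
  unfold IntegrableOn at hf
  rw [e] at hf ⊢
  have hf' : Integrable (fun x : ↥(P ∩ (A : Set (Vd d))) => f x) Measure.count := by
    rw [← hcount]
    exact (integrableOn_iff_comap_subtypeVal hm).1 hf
  refine ⟨(integrable_count_iff.1 hf').of_norm, ?_⟩
  rw [← integral_subtype_comap hm, hcount, integral_countable hf']
  simp

open MeasureTheory Filter Topology Set
open scoped RealInnerProductSpace Pointwise BigOperators

/-! ### The canonical measure -/

/-- linear parametrization -/
noncomputable def par {d k : ℕ} (v : Fin k → Vd d) : (Fin k → ℝ) →ₗ[ℝ] Vd d :=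
  Fintype.linearCombination ℝ v

theorem par_apply {d k : ℕ} (v : Fin k → Vd d) (t : Fin k → ℝ) : par v t = ∑ i, t i • v i := by
  simp [par, Fintype.linearCombination_apply]

theorem par_range {d k : ℕ} (v : Fin k → Vd d) :
    LinearMap.range (par v) = Submodule.span ℝ (Set.range v) := by
  simp [par, Fintype.range_linearCombination]

theorem par_inj {d k : ℕ} (v : Fin k → Vd d) (hv : LinearIndependent ℝ v) :
    Function.Injective (par v) := hv.fintypeLinearCombination_injective

theorem par_cont {d k : ℕ} (v : Fin k → Vd d) : Continuous (par v) :=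
  LinearMap.continuous_of_finiteDimensional _

/-- canonical measure -/
noncomputable def im {d k : ℕ} (x₀ : Vd d) (v : Fin k → Vd d) : Measure (Vd d) :=
  Measure.map (fun t : Fin k → ℝ => x₀ + par v t) volume

theorem im_meas {d k : ℕ} (x₀ : Vd d) (v : Fin k → Vd d) :
    Measurable (fun t : Fin k → ℝ => x₀ + par v t) :=
  (continuous_const.add (par_cont v)).measurable

theorem im_fin {d k : ℕ} (x₀ : Vd d) (v : Fin k → Vd d) (hv : LinearIndependent ℝ v) (R : ℝ) :
    im x₀ v (Metric.closedBall 0 R) < ⊤ := by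
  rw [im, Measure.map_apply (im_meas x₀ v) Metric.isClosed_closedBall.measurableSet]
  apply Bornology.IsBounded.measure_lt_top
  obtain ⟨K, -, hK⟩ := (par v).exists_antilipschitzWith (LinearMap.ker_eq_bot.2 (par_inj v hv))
  have : (fun t : Fin k → ℝ => x₀ + par v t) ⁻¹' (Metric.closedBall 0 R) =
      par v ⁻¹' (Metric.closedBall (-x₀) R) := by
    ext t
    simp [Metric.mem_closedBall, dist_eq_norm, add_comm]
  rw [this]
  exact hK.isBounded_preimage Metric.isBounded_closedBall

theorem im_inv {d k : ℕ} (x₀ : Vd d) (v : Fin k → Vd d) (w : Vd d)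
    (hw : w ∈ Submodule.span ℝ (Set.range v)) :
    MeasurePreserving (fun x => x + w) (im x₀ v) (im x₀ v) := by
  rw [← par_range] at hw
  obtain ⟨c, rfl⟩ := hw
  refine ⟨measurable_add_const _, ?_⟩
  have h1 := (measurePreserving_add_right (volume : Measure (Fin k → ℝ)) c).map_eq
  conv_rhs => rw [im, ← h1]
  rw [im, Measure.map_map (measurable_add_const _) (im_meas x₀ v),
    Measure.map_map (im_meas x₀ v) (measurable_add_const c)]
  congr 1
  ext t : 1
  simp [add_assoc]

theorem im_null {d k : ℕ} (x₀ : Vd d) (v : Fin k → Vd d) (P : Set (Vd d)) (hP : MeasurableSet P)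
    (T : Submodule ℝ (Vd d)) (hPT : ∀ x ∈ P, x - x₀ ∈ T)
    (hT : ¬ Submodule.span ℝ (Set.range v) ≤ T) : im x₀ v P = 0 := by
  rw [im, Measure.map_apply (im_meas x₀ v) hP]
  refine measure_mono_null (t := ((T.comap (par v) : Submodule ℝ (Fin k → ℝ)) : Set _)) ?_ ?_
  · intro t ht
    have := hPT _ ht
    rwa [add_sub_cancel_left] at this
  · apply Measure.addHaar_submodule
    intro htop
    apply hT
    rw [← par_range]
    rintro _ ⟨t, rfl⟩
    have : t ∈ T.comap (par v) := by rw [htop]; trivial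
    exact this

theorem im_canonical {d k : ℕ} (A : AddSubgroup (Vd d)) (x₀ : Vd d) (v : Fin k → Vd d)
    (hvA : ∀ i, v i ∈ A) (hv : LinearIndependent ℝ v)
    (hb : ∀ y ∈ A, y ∈ Submodule.span ℝ (Set.range v) → ∃ c : Fin k → ℤ, y = ∑ i, (c i : ℝ) • v i)
    (B : Set (Vd d)) (hB : ∀ x, x ∈ B ↔ x - x₀ ∈ Submodule.span ℝ (Set.range v)) :
    IsCanonicalMeasure A B (im x₀ v) := by
  refine ⟨k, x₀, v, ?_, hvA, hv, ?_, hb, ?_⟩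
  · rw [hB, sub_self]; exact Submodule.zero_mem _
  · ext x
    rw [hB, ← par_range]
    constructor
    · rintro ⟨t, ht⟩
      exact ⟨t, by rw [← par_apply, ht]; abel⟩
    · rintro ⟨t, rfl⟩
      exact ⟨t, by rw [par_apply]; abel⟩
  · simp only [im, par_apply]

/-! ### Geometry of the quotient -/

section geom

variable {d : ℕ} {Λ : AddSubgroup (Vd d)} {Q : Vd d →ₗ[ℝ] Vd d →ₗ[ℝ] ℝ}

/-- projection to the quotient attached to `E` -/
noncomputable def pE (Q : Vd d →ₗ[ℝ] Vd d →ₗ[ℝ] ℝ) (E : Submodule ℝ (Vd d)) :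
    Vd d →ₗ[ℝ] Vd d := qp Q Eᗮ

/-- the quotient lattice -/
noncomputable def LatE (Λ : AddSubgroup (Vd d)) (Q : Vd d →ₗ[ℝ] Vd d →ₗ[ℝ] ℝ)
    (E : Submodule ℝ (Vd d)) : AddSubgroup (Vd d) :=
  AddSubgroup.map (pE Q E).toAddMonoidHom Λ

/-- the quotient space -/
noncomputable def WE (Q : Vd d →ₗ[ℝ] Vd d →ₗ[ℝ] ℝ) (E : Submodule ℝ (Vd d)) :
    Submodule ℝ (Vd d) := LinearMap.range (pE Q E)

/-- the cone in the quotient -/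
noncomputable def cn (Q : Vd d →ₗ[ℝ] Vd d →ₗ[ℝ] ℝ) (E : Submodule ℝ (Vd d)) (κ : Set (Vd d))
    (U : Submodule ℝ (Vd d)) : Set (Vd d) :=
  {x | x ∈ WE Q E ∧ x ∈ dualConeSet κ ∧ x ∈ Uᗮ}

/-- the affine cone in the quotient -/
noncomputable def PE (Q : Vd d →ₗ[ℝ] Vd d →ₗ[ℝ] ℝ) (s : Vd d) (E : Submodule ℝ (Vd d))
    (κ : Set (Vd d)) (U : Submodule ℝ (Vd d)) : Set (Vd d) :=
  {x | x - pE Q E s ∈ cn Q E κ U}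

theorem pE_inner (hQ : IsRatInner Λ Q) {E : Submodule ℝ (Vd d)} {g : Vd d} (hg : g ∈ E)
    (x : Vd d) : ⟪g, pE Q E x⟫ = ⟪g, x⟫ := by
  have := (qp_spec hQ Eᗮ).1 x
  have h := (Submodule.mem_orthogonal E _).1 this g hg
  rw [inner_sub_right] at h
  exact (sub_eq_zero.1 h).symm

theorem pE_ker (hQ : IsRatInner Λ Q) {E : Submodule ℝ (Vd d)} {x : Vd d} :
    pE Q E x = 0 ↔ x ∈ Eᗮ := by
  have h := qp_spec hQ Eᗮ
  constructor
  · intro hx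
    have := h.1 x
    change x - pE Q E x ∈ _ at this
    rwa [hx, sub_zero] at this
  · intro hx
    have h1 : pE Q E x ∈ Eᗮ := by
      have := Submodule.sub_mem _ hx (h.1 x)
      rwa [sub_sub_cancel] at this
    by_contra hne
    have := hQ.2.1 _ hne
    rw [show Q (pE Q E x) (pE Q E x) = 0 from h.2 x _ h1] at this
    exact lt_irrefl _ this

theorem pE_W (hQ : IsRatInner Λ Q) {E : Submodule ℝ (Vd d)} {x : Vd d} (hx : x ∈ WE Q E) :
    pE Q E x = x := by
  obtain ⟨y, rfl⟩ := hx
  have := (pE_ker hQ).2 ((qp_spec hQ Eᗮ).1 y)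
  rw [map_sub, sub_eq_zero] at this
  exact this.symm

theorem W_zero (hQ : IsRatInner Λ Q) {E : Submodule ℝ (Vd d)} {x : Vd d} (hx : x ∈ WE Q E)
    (h : ∀ g ∈ E, ⟪g, x⟫ = 0) : x = 0 := by
  rw [← pE_W hQ hx, pE_ker hQ, Submodule.mem_orthogonal]
  exact h

theorem pE_mem_W (E : Submodule ℝ (Vd d)) (x : Vd d) : pE Q E x ∈ WE Q E := ⟨x, rfl⟩

theorem PE_eq (hQ : IsRatInner Λ Q) (s : Vd d) {E U : Submodule ℝ (Vd d)} {κ : Set (Vd d)}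
    (hκ : κ ⊆ E) (hU : U ≤ E) :
    pE Q E '' ((fun x => s + x) '' (dualConeSet κ ∩ (Uᗮ : Set (Vd d)))) = PE Q s E κ U := by
  ext y
  constructor
  · rintro ⟨_, ⟨x, ⟨hx1, hx2⟩, rfl⟩, rfl⟩
    simp only [PE, map_add, add_sub_cancel_left, mem_ofPred_eq, cn]
    refine ⟨pE_mem_W _ _, fun g hg => ?_, ?_⟩
    · change 0 ≤ ⟪g, pE Q E x⟫
      rw [pE_inner hQ (hκ hg)]; exact hx1 g hg
    · rw [Submodule.mem_orthogonal]
      intro g hg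
      rw [pE_inner hQ (hU hg)]
      exact (Submodule.mem_orthogonal _ _).1 hx2 g hg
  · rintro ⟨h1, h2, h3⟩
    refine ⟨s + (y - pE Q E s), ⟨_, ⟨h2, h3⟩, rfl⟩, ?_⟩
    rw [map_add, pE_W hQ h1]; abel

theorem coneOf_map (p : Vd d →ₗ[ℝ] Vd d) (l : List (Vd d)) : p '' coneOf l = coneOf (l.map p) := by
  induction l with
  | nil => simp [coneOf]
  | cons v l ih =>
    ext y
    simp only [coneOf, List.map_cons]
    constructor
    · rintro ⟨x, ⟨t, ht, hx⟩, rfl⟩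
      refine ⟨t, ht, ?_⟩
      rw [← ih]
      exact ⟨_, hx, by simp⟩
    · rintro ⟨t, ht, hy⟩
      rw [← ih] at hy
      obtain ⟨x, hx, hxy⟩ := hy
      refine ⟨x + t • v, ⟨t, ht, by simpa using hx⟩, ?_⟩
      rw [map_add, map_smul, hxy]; abel

/-- H- and V-representation of the cones in the quotient -/
theorem cn_rep (hΛ : IsFullLattice Λ) (hQ : IsRatInner Λ Q) {E U : Submodule ℝ (Vd d)}
    (hU : RatSub Λ U) (hUE : U ≤ E) {κ : Set (Vd d)} (hκ : IsRatCone (dualLattice Λ) κ)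
    (hκE : κ ⊆ E) : ∃ h l : List (Vd d), (∀ g ∈ h, g ∈ dualLattice Λ ∧ g ∈ E) ∧
      (∀ v ∈ l, v ∈ LatE Λ Q E) ∧ cn Q E κ U = hset h ∩ WE Q E ∧ cn Q E κ U = coneOf l := by
  obtain ⟨h, l, h1, h2, h3, h4⟩ := dual_inter hΛ hκ hU E hκE hUE
  refine ⟨h, l.map (pE Q E), h1, ?_, ?_, ?_⟩
  · intro v hv
    obtain ⟨x, hx, rfl⟩ := List.mem_map.1 hv
    exact ⟨x, h2 x hx, rfl⟩
  · rw [← h3]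
    ext x
    simp only [cn, mem_inter_iff, mem_ofPred_eq, SetLike.mem_coe]
    tauto
  · rw [← coneOf_map, ← h4]
    have := PE_eq hQ 0 hκE hUE
    simp only [zero_add, image_id'] at this
    rw [this]
    simp [PE]

theorem orth_rep (hΛ : IsFullLattice Λ) {E : Submodule ℝ (Vd d)} (hE : RatSub Λ E) :
    ∃ l : List (Vd d), (∀ v ∈ l, v ∈ Λ) ∧ (Eᗮ : Set (Vd d)) = coneOf l := by
  have h0 : IsRatCone (dualLattice Λ) ({0} : Set (Vd d)) :=
    (isRatCone_iff _ _).2 ⟨[], by simp, rfl⟩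
  obtain ⟨-, l, -, h2, -, h4⟩ := dual_inter hΛ h0 hE E (by simp) le_rfl
  refine ⟨l, h2, ?_⟩
  rw [← h4]
  ext x
  simp [dualConeSet, pairE]

theorem LatE_quot (hΛ : IsFullLattice Λ) (hQ : IsRatInner Λ Q) {E : Submodule ℝ (Vd d)}
    (hE : RatSub Λ E) : IsQuotLattice Q Λ (LatE Λ Q E) := by
  refine ⟨Eᗮ, pE Q E, ?_, qp_spec hQ _, rfl⟩
  obtain ⟨l, h1, h2⟩ := orth_rep hΛ hE
  apply le_antisymm
  · exact Submodule.span_le.2 inter_subset_left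
  · intro x hx
    have : x ∈ coneOf l := h2 ▸ hx
    refine coneOf_span l _ (fun v hv => ?_) this
    apply Submodule.subset_span
    refine ⟨?_, h1 v hv⟩
    rw [h2]; exact coneOf_mem l v hv

theorem LatE_sub_W {E : Submodule ℝ (Vd d)} {x : Vd d} (hx : x ∈ LatE Λ Q E) : x ∈ WE Q E := by
  obtain ⟨y, -, rfl⟩ := hx
  exact ⟨y, rfl⟩

theorem LatE_int (hQ : IsRatInner Λ Q) {E : Submodule ℝ (Vd d)} {g : Vd d} (hg : g ∈ dualLattice Λ)
    (hgE : g ∈ E) {x : Vd d} (hx : x ∈ LatE Λ Q E) : ∃ n : ℤ, ⟪g, x⟫ = n := by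
  obtain ⟨y, hy, rfl⟩ := hx
  obtain ⟨n, hn⟩ := hg y hy
  exact ⟨n, by rw [← hn]; exact pE_inner hQ hgE y⟩

theorem LatE_sep (hQ : IsRatInner Λ Q) {E : Submodule ℝ (Vd d)} (hE : RatSub Λ E) :
    ∃ ε > 0, ∀ x ∈ LatE Λ Q E, x ≠ 0 → ε ≤ ‖x‖ := by
  obtain ⟨l, hl, hlE⟩ := hE
  have hlE' : ∀ g ∈ l, g ∈ E := fun g hg => hlE ▸ Submodule.subset_span hg
  refine ⟨1 / (tlen l + 1), by have := tlen_nonneg l; positivity, fun x hx hne => ?_⟩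
  have : ∃ g ∈ l, ⟪g, x⟫ ≠ 0 := by
    by_contra hcon
    push Not at hcon
    apply hne
    apply W_zero hQ (LatE_sub_W hx)
    have : x ∈ Eᗮ := by
      rw [← hlE, mem_orth_span]; exact hcon
    exact (Submodule.mem_orthogonal _ _).1 this
  obtain ⟨g, hg, hgx⟩ := this
  obtain ⟨n, hn⟩ := LatE_int hQ (hl g hg) (hlE' g hg) hx
  have h1 : (1 : ℝ) ≤ |⟪g, x⟫| := by
    rw [hn] at hgx ⊢
    have : n ≠ 0 := by exact_mod_cast hgx
    exact_mod_cast Int.one_le_abs this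
  have h2 := abs_real_inner_le_norm g x
  have h3 : ∀ l : List (Vd d), ∀ g ∈ l, ‖g‖ ≤ tlen l := by
    intro l
    induction l with
    | nil => simp
    | cons a l ih =>
      intro g hg
      simp only [tlen]
      rcases List.mem_cons.1 hg with rfl | hg
      · linarith [tlen_nonneg l]
      · linarith [ih g hg, norm_nonneg a]
  have h4 := h3 l g hg
  have h5 := tlen_nonneg l
  rw [div_le_iff₀ (by positivity)]
  nlinarith [norm_nonneg x]

end geom

open MeasureTheory Filter Topology Set
open scoped RealInnerProductSpace Pointwise BigOperators

/-! ### Cut properties of `S` and `I` -/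

section cut

variable {d : ℕ} {Λ : AddSubgroup (Vd d)} {Q : Vd d →ₗ[ℝ] Vd d →ₗ[ℝ] ℝ}

theorem sub_hset (W : Submodule ℝ (Vd d)) : ∃ h : List (Vd d), hset h = (W : Set (Vd d)) := by
  obtain ⟨S, hS⟩ := (IsNoetherian.noetherian Wᗮ : (Wᗮ).FG)
  refine ⟨S.toList ++ S.toList.map (fun x => -x), ?_⟩
  ext x
  have h1 : x ∈ W ↔ ∀ g ∈ S, ⟪g, x⟫ = 0 := by
    conv_lhs => rw [← Submodule.orthogonal_orthogonal W, ← hS, mem_orth_span]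
    rfl
  rw [SetLike.mem_coe, h1]
  simp only [hset, mem_ofPred_eq, List.mem_append, List.mem_map, Finset.mem_toList]
  constructor
  · intro h g hg
    apply le_antisymm _ (h g (Or.inl hg))
    have := h (-g) (Or.inr ⟨g, hg, rfl⟩)
    rw [inner_neg_left] at this
    linarith
  · rintro h g (hg | ⟨g, hg, rfl⟩)
    · rw [h g hg]
    · rw [inner_neg_left, h g hg, neg_zero]

theorem span_LatE (hΛ : IsFullLattice Λ) (E : Submodule ℝ (Vd d)) :
    Submodule.span ℝ (LatE Λ Q E : Set (Vd d)) = WE Q E := by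
  have : (LatE Λ Q E : Set (Vd d)) = pE Q E '' Λ := rfl
  rw [this, Submodule.span_image, hΛ.2, Submodule.map_top]; rfl

theorem PE_cone (hΛ : IsFullLattice Λ) (hQ : IsRatInner Λ Q) {s : Vd d} (hs : IsRatPoint Λ s)
    {E U : Submodule ℝ (Vd d)}
    (hU : RatSub Λ U) (hUE : U ≤ E) {κ : Set (Vd d)} (hκ : IsRatCone (dualLattice Λ) κ)
    (hκE : κ ⊆ E) : IsRatAffineCone (LatE Λ Q E) (PE Q s E κ U) := by
  obtain ⟨h, l, h1, h2, h3, h4⟩ := cn_rep hΛ hQ hU hUE hκ hκE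
  obtain ⟨q, hq, hqs⟩ := hs
  refine ⟨pE Q E s, l.length, l.get, ⟨q, hq, ⟨_, hqs, ?_⟩⟩, fun i => h2 _ (List.get_mem l i), ?_⟩
  · change pE Q E _ = _
    rw [map_smul]
  · have := coneOf_ofFn l.get
    rw [List.ofFn_get] at this
    ext x
    simp only [PE, h4, this]
    constructor
    · rintro ⟨t, ht, hx⟩
      exact ⟨t, ht, by rw [← hx]; abel⟩
    · rintro ⟨t, ht, hx⟩
      exact ⟨t, ht, by rw [hx]; abel⟩

theorem PE_poly (hΛ : IsFullLattice Λ) (hQ : IsRatInner Λ Q) {s : Vd d} (hs : IsRatPoint Λ s)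
    {E U : Submodule ℝ (Vd d)}
    (hU : RatSub Λ U) (hUE : U ≤ E) {κ : Set (Vd d)} (hκ : IsRatCone (dualLattice Λ) κ)
    (hκE : κ ⊆ E) : IsRatPolyhedron (LatE Λ Q E) (PE Q s E κ U) := by
  obtain ⟨h, l, h1, h2, h3, h4⟩ := cn_rep hΛ hQ hU hUE hκ hκE
  obtain ⟨q, hq, hqs⟩ := hs
  have hrat : ∀ i : Fin h.length, ∃ c : ℚ, -⟪h.get i, s⟫ = (c : ℝ) := by
    intro i
    obtain ⟨n, hn⟩ := (h1 _ (List.get_mem h i)).1 _ hqs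
    change ⟪h.get i, (q : ℝ) • s⟫ = _ at hn
    rw [inner_smul_right] at hn
    refine ⟨-(n / q), ?_⟩
    have hq' : (q : ℝ) ≠ 0 := by exact_mod_cast hq
    push_cast
    rw [← hn]
    field_simp
  choose c hc using hrat
  refine ⟨h.length, fun i => -h.get i, c, fun i x hx => ?_, ?_⟩
  · obtain ⟨hg1, hg2⟩ := h1 _ (List.get_mem h i)
    obtain ⟨n, hn⟩ := LatE_int hQ hg1 hg2 hx
    refine ⟨-n, ?_⟩
    change ⟪-h.get i, x⟫ = _
    rw [inner_neg_left, hn]; push_cast; rfl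
  · rw [span_LatE hΛ]
    ext x
    simp only [PE, h3, mem_ofPred_eq, mem_inter_iff, SetLike.mem_coe]
    have hW : x - pE Q E s ∈ WE Q E ↔ x ∈ WE Q E :=
      Submodule.sub_mem_iff_left _ (pE_mem_W E s)
    rw [hW, and_comm]
    refine and_congr_right fun hx => ?_
    have key : ∀ i : Fin h.length, (0 ≤ ⟪h.get i, x - pE Q E s⟫ ↔ pairE (-h.get i) x ≤ c i) := by
      intro i
      rw [← hc]
      change _ ↔ ⟪-h.get i, x⟫ ≤ _
      rw [inner_neg_left, inner_sub_right, pE_inner hQ (h1 _ (List.get_mem h i)).2]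
      constructor <;> intro <;> linarith
    constructor
    · intro hh i
      exact (key i).1 (hh _ (List.get_mem h i))
    · intro hh g hg
      obtain ⟨i, rfl⟩ := List.mem_iff_get.1 hg
      exact (key i).2 (hh i)

theorem cn_H (hΛ : IsFullLattice Λ) (hQ : IsRatInner Λ Q) {E U : Submodule ℝ (Vd d)}
    (hU : RatSub Λ U) (hUE : U ≤ E) {κ : Set (Vd d)} (hκ : IsRatCone (dualLattice Λ) κ)
    (hκE : κ ⊆ E) : ∃ h l : List (Vd d), (∀ v ∈ l, v ∈ LatE Λ Q E ∧ v ∈ Uᗮ ∧ v ≠ 0) ∧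
      cn Q E κ U = hset h ∧ hset h = coneOf l := by
  obtain ⟨h, l, h1, h2, h3, h4⟩ := cn_rep hΛ hQ hU hUE hκ hκE
  obtain ⟨h', hW⟩ := sub_hset (WE Q E)
  obtain ⟨l', hl1, hl2⟩ := coneOf_nz l
  have e : cn Q E κ U = hset (h ++ h') := by rw [hset_append, hW, h3]
  refine ⟨h ++ h', l', fun v hv => ⟨h2 v (hl2 v hv).2, ?_, (hl2 v hv).1⟩, e, ?_⟩
  · have : v ∈ cn Q E κ U := by rw [h4]; exact coneOf_mem l v (hl2 v hv).2
    exact this.2.2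
  · rw [← e, h4, hl1]

theorem S_vp (hΛ : IsFullLattice Λ) (hQ : IsRatInner Λ Q) {s : Vd d} (hs : IsRatPoint Λ s)
    {E U : Submodule ℝ (Vd d)} (hE : RatSub Λ E)
    (hU : RatSub Λ U) (hUE : U ≤ E) {κ : Set (Vd d)} (hκ : IsRatCone (dualLattice Λ) κ)
    (hκE : κ ⊆ E) {S : Set (Vd d) → Vd d → ℝ} (hS : IsSMap (LatE Λ Q E) S) :
    ∃ lv : List (Vd d), (∀ v ∈ lv, v ∈ LatE Λ Q E ∧ v ≠ 0) ∧
      ∀ l : List (Vd d), (∀ v ∈ lv, v ∈ l) → (∀ v ∈ l, v ∈ LatE Λ Q E ∧ v ≠ 0) →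
        VP (cm (LatE Λ Q E)) l (PE Q s E κ U) (S (PE Q s E κ U)) := by
  obtain ⟨h, lv, h1, h2, h3⟩ := cn_H hΛ hQ hU hUE hκ hκE
  obtain ⟨ε, hε, hsep⟩ := LatE_sep hQ hE
  have hfin := discrete_finite _ ε hε hsep
  have hpoly := PE_poly hΛ hQ hs hU hUE hκ hκE
  refine ⟨lv, fun v hv => ⟨(h1 v hv).1, (h1 v hv).2.2⟩, fun l hl1 hl2 => ?_⟩
  have e : PE Q s E κ U = {x | x - pE Q E s ∈ hset h} := by rw [PE, h2]
  have hm : MeasurableSet (PE Q s E κ U) := by rw [e]; exact ind_meas h _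
  have := vp_main (m := cm (LatE Λ Q E)) (cm_fin hfin) h lv l h3 hl1 (fun v hv => (hl2 v hv).2)
    (fun v hv => cm_inv hfin v (hl2 v hv).1) (pE Q E s) (S (PE Q s E κ U)) (hS.1 _ hpoly)
    (by rw [← e]; exact hS.2.1 _ hpoly)
    (by
      rw [← e]
      intro ξ hξ
      obtain ⟨s1, s2⟩ := cm_sum hfin _ hm _ hξ
      rw [s2]
      exact hS.2.2 _ hpoly ξ s1)
  rwa [← e] at this

theorem mem_affineSpan_PE (s : Vd d) (E U : Submodule ℝ (Vd d)) (κ : Set (Vd d)) :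
    (∀ x, x ∈ affineSpan ℝ (PE Q s E κ U) ↔ x - pE Q E s ∈ Submodule.span ℝ (cn Q E κ U)) ∧
    (affineSpan ℝ (PE Q s E κ U)).direction = Submodule.span ℝ (cn Q E κ U) := by
  have h0 : pE Q E s ∈ PE Q s E κ U := by
    simp only [PE, cn, mem_ofPred_eq, sub_self, Submodule.zero_mem, true_and, and_true]
    intro g _
    simp [pairE]
  have hd : (affineSpan ℝ (PE Q s E κ U)).direction = Submodule.span ℝ (cn Q E κ U) := by
    rw [direction_affineSpan, vectorSpan_eq_span_vsub_set_right ℝ h0]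
    congr 1
    ext x
    simp only [PE, vsub_eq_sub, mem_image, mem_ofPred_eq]
    constructor
    · rintro ⟨y, hy, rfl⟩; exact hy
    · intro hx; exact ⟨x + pE Q E s, by simpa using hx, by simp⟩
  refine ⟨fun x => ?_, hd⟩
  rw [← hd]
  have h1 := (subset_affineSpan ℝ _) h0
  exact (AffineSubspace.vsub_right_mem_direction_iff_mem h1 x).symm

open Classical in
/-- the regularized integral -/
noncomputable def IU (Q : Vd d →ₗ[ℝ] Vd d →ₗ[ℝ] ℝ) (I : Set (Vd d) → Vd d → ℝ) (s : Vd d)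
    (E : Submodule ℝ (Vd d)) (κ : Set (Vd d)) (U : Submodule ℝ (Vd d)) (ξ : Vd d) : ℝ :=
  if Submodule.span ℝ (cn Q E κ U) = WE Q E ⊓ Uᗮ then I (PE Q s E κ U) ξ else 0

theorem W_orth_span (hΛ : IsFullLattice Λ) (hQ : IsRatInner Λ Q)
    {E U : Submodule ℝ (Vd d)} (hU : RatSub Λ U) (hUE : U ≤ E) :
    ∃ l : List (Vd d), (∀ v ∈ l, v ∈ LatE Λ Q E ∧ v ∈ Uᗮ) ∧
      ((WE Q E ⊓ Uᗮ : Submodule ℝ (Vd d)) : Set (Vd d)) = coneOf l := by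
  have h0 : IsRatCone (dualLattice Λ) ({0} : Set (Vd d)) :=
    (isRatCone_iff _ _).2 ⟨[], by simp, rfl⟩
  obtain ⟨h, l, h1, h2, h3⟩ := cn_H hΛ hQ hU hUE h0 (by simp)
  refine ⟨l, fun v hv => ⟨(h1 v hv).1, (h1 v hv).2.1⟩, ?_⟩
  rw [← h3, ← h2]
  ext x
  simp [cn, dualConeSet, pairE]

theorem I_basis (hΛ : IsFullLattice Λ) (hQ : IsRatInner Λ Q)
    {E U : Submodule ℝ (Vd d)} (hE : RatSub Λ E) (hU : RatSub Λ U) (hUE : U ≤ E) :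
    ∃ (k : ℕ) (v : Fin k → Vd d), (∀ i, v i ∈ LatE Λ Q E) ∧ LinearIndependent ℝ v ∧
      Submodule.span ℝ (Set.range v) = WE Q E ⊓ Uᗮ ∧
      (∀ y ∈ LatE Λ Q E, y ∈ Submodule.span ℝ (Set.range v) →
        ∃ c : Fin k → ℤ, y = ∑ i, (c i : ℝ) • v i) := by
  obtain ⟨ε, hε, hsep⟩ := LatE_sep hQ hE
  obtain ⟨k, v, h1, h2, h3⟩ := discrete_basis (LatE Λ Q E ⊓ Uᗮ.toAddSubgroup) ε hε
    (fun x hx => hsep x hx.1)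
  have hsp : Submodule.span ℝ (Set.range v) = WE Q E ⊓ Uᗮ := by
    apply le_antisymm
    · rw [Submodule.span_le]
      rintro _ ⟨i, rfl⟩
      exact ⟨LatE_sub_W (h1 i).1, (h1 i).2⟩
    · obtain ⟨l, hl1, hl2⟩ := W_orth_span hΛ hQ hU hUE
      intro x hx
      have : x ∈ coneOf l := hl2 ▸ hx
      refine coneOf_span l _ (fun w hw => ?_) this
      obtain ⟨c, rfl⟩ := h3 w ⟨(hl1 w hw).1, (hl1 w hw).2⟩
      exact Submodule.sum_mem _ fun i _ =>
        Submodule.smul_mem _ _ (Submodule.subset_span ⟨i, rfl⟩)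
  refine ⟨k, v, fun i => (h1 i).1, h2, hsp, fun y hy hys => h3 y ⟨hy, ?_⟩⟩
  rw [hsp] at hys
  exact hys.2

theorem cn_sub (E U : Submodule ℝ (Vd d)) (κ : Set (Vd d)) :
    Submodule.span ℝ (cn Q E κ U) ≤ WE Q E ⊓ Uᗮ := by
  rw [Submodule.span_le]
  exact fun x hx => ⟨hx.1, hx.2.2⟩

theorem I_vp (hΛ : IsFullLattice Λ) (hQ : IsRatInner Λ Q) {s : Vd d} (hs : IsRatPoint Λ s)
    {E U : Submodule ℝ (Vd d)}
    (hU : RatSub Λ U) (hUE : U ≤ E) {κ : Set (Vd d)} (hκ : IsRatCone (dualLattice Λ) κ)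
    (hκE : κ ⊆ E) {I : Set (Vd d) → Vd d → ℝ} (hI : IsIMap (LatE Λ Q E) I)
    {k : ℕ} (v : Fin k → Vd d) (hv1 : ∀ i, v i ∈ LatE Λ Q E) (hv2 : LinearIndependent ℝ v)
    (hv3 : Submodule.span ℝ (Set.range v) = WE Q E ⊓ Uᗮ)
    (hv4 : ∀ y ∈ LatE Λ Q E, y ∈ Submodule.span ℝ (Set.range v) →
        ∃ c : Fin k → ℤ, y = ∑ i, (c i : ℝ) • v i) :
    ∃ lv : List (Vd d), (∀ v ∈ lv, v ∈ WE Q E ⊓ Uᗮ ∧ v ≠ 0) ∧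
      ∀ l : List (Vd d), (∀ v ∈ lv, v ∈ l) → (∀ v ∈ l, v ∈ WE Q E ⊓ Uᗮ ∧ v ≠ 0) →
        VP (im (pE Q E s) v) l (PE Q s E κ U) (IU Q I s E κ U) := by
  obtain ⟨h, lv, h1, h2, h3⟩ := cn_H hΛ hQ hU hUE hκ hκE
  have hpoly := PE_poly hΛ hQ hs hU hUE hκ hκE
  refine ⟨lv, fun v hv => ⟨⟨LatE_sub_W (h1 v hv).1, (h1 v hv).2.1⟩, (h1 v hv).2.2⟩,
    fun l hl1 hl2 => ?_⟩
  have e : PE Q s E κ U = {x | x - pE Q E s ∈ hset h} := by rw [PE, h2]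
  have hm : MeasurableSet (PE Q s E κ U) := by rw [e]; exact ind_meas h _
  have hinv : ∀ w ∈ l, MeasurePreserving (fun x => x + w) (im (pE Q E s) v) (im (pE Q E s) v) :=
    fun w hw => im_inv _ v w (by rw [hv3]; exact (hl2 w hw).1)
  by_cases hspan : Submodule.span ℝ (cn Q E κ U) = WE Q E ⊓ Uᗮ
  · have eI : IU Q I s E κ U = I (PE Q s E κ U) := by
      ext ξ; rw [IU, if_pos hspan]
    have hcan : IsCanonicalMeasure (LatE Λ Q E)
        ((affineSpan ℝ (PE Q s E κ U) : AffineSubspace ℝ (Vd d)) : Set (Vd d))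
        (im (pE Q E s) v) := by
      refine im_canonical _ _ v hv1 hv2 hv4 _ fun x => ?_
      rw [hv3, ← hspan]
      exact (mem_affineSpan_PE s E U κ).1 x
    have := vp_main (m := im (pE Q E s) v) (im_fin _ v hv2) h lv l h3 hl1
      (fun v hv => (hl2 v hv).2) hinv (pE Q E s) (I (PE Q s E κ U)) (hI.1 _ hpoly)
      (by rw [← e]; exact hI.2.1 _ hpoly)
      (by
        rw [← e]
        intro ξ hξ
        exact hI.2.2 _ hpoly _ hcan ξ hξ)
    rw [eI]
    rwa [← e] at this
  · apply vp_null l hinv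
    · apply im_null _ v _ hm (Submodule.span ℝ (cn Q E κ U))
      · exact fun x hx => Submodule.subset_span hx
      · rw [hv3]
        exact fun hle => hspan (le_antisymm (cn_sub E U κ) hle)
    · intro ξ
      rw [IU, if_neg hspan]

theorem dual_cut {κ : Set (Vd d)} (hκ : IsRatCone (dualLattice Λ) κ) (η : Vd d) :
    dualConeSet (κ ∩ hp η) ∪ dualConeSet (κ ∩ hp (-η)) = dualConeSet (κ ∩ hp η ∩ hp (-η)) ∧
    dualConeSet (κ ∩ hp η) ∩ dualConeSet (κ ∩ hp (-η)) = dualConeSet κ := by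
  constructor
  · ext x
    constructor
    · rintro (h | h) y ⟨⟨hy1, hy2⟩, hy3⟩
      · exact h y ⟨hy1, hy2⟩
      · exact h y ⟨hy1, hy3⟩
    · intro h
      by_contra hcon
      rw [mem_union, not_or] at hcon
      obtain ⟨h1, h2⟩ := hcon
      simp only [dualConeSet, mem_ofPred_eq, not_forall, not_le] at h1 h2
      obtain ⟨y, ⟨hy1, hy2⟩, hyx⟩ := h1
      obtain ⟨z, ⟨hz1, hz2⟩, hzx⟩ := h2
      change ⟪y, x⟫ < 0 at hyx
      change ⟪z, x⟫ < 0 at hzx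
      change 0 ≤ ⟪η, y⟫ at hy2
      change 0 ≤ ⟪-η, z⟫ at hz2
      rw [inner_neg_left] at hz2
      by_cases h0 : ⟪η, y⟫ = 0
      · have := h y ⟨⟨hy1, by change 0 ≤ ⟪η, y⟫; rw [h0]⟩,
          by change 0 ≤ ⟪-η, y⟫; rw [inner_neg_left, h0, neg_zero]⟩
        change 0 ≤ ⟪y, x⟫ at this
        linarith
      · have hpos : 0 < ⟪η, y⟫ := lt_of_le_of_ne hy2 (Ne.symm h0)
        have hw : ⟪η, (-⟪η, z⟫) • y + ⟪η, y⟫ • z⟫ = 0 := by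
          rw [inner_add_right, inner_smul_right, inner_smul_right]; ring
        have := h ((-⟪η, z⟫) • y + ⟪η, y⟫ • z)
          ⟨⟨rc_add hκ (rc_smul hκ hz2 hy1) (rc_smul hκ hy2 hz1), by
            change 0 ≤ ⟪η, _⟫; rw [hw]⟩, by
            change 0 ≤ ⟪-η, _⟫; rw [inner_neg_left, hw, neg_zero]⟩
        change 0 ≤ ⟪_, x⟫ at this
        rw [inner_add_left, inner_smul_left, inner_smul_left] at this
        simp only [conj_trivial] at this
        nlinarith
  · ext x
    constructor
    · rintro ⟨h1, h2⟩ y hy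
      rcases le_total 0 ⟪η, y⟫ with h | h
      · exact h1 y ⟨hy, h⟩
      · exact h2 y ⟨hy, by change 0 ≤ ⟪-η, y⟫; rw [inner_neg_left]; linarith⟩
    · intro h
      exact ⟨fun y hy => h y hy.1, fun y hy => h y hy.1⟩

theorem PE_cut {κ : Set (Vd d)} (hκ : IsRatCone (dualLattice Λ) κ) (η s : Vd d)
    (E U : Submodule ℝ (Vd d)) :
    PE Q s E (κ ∩ hp η) U ∪ PE Q s E (κ ∩ hp (-η)) U = PE Q s E (κ ∩ hp η ∩ hp (-η)) U ∧
    PE Q s E (κ ∩ hp η) U ∩ PE Q s E (κ ∩ hp (-η)) U = PE Q s E κ U := by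
  obtain ⟨h1, h2⟩ := dual_cut hκ η
  constructor
  · ext x
    simp only [PE, cn, ← h1, mem_union, mem_ofPred_eq]
    tauto
  · ext x
    simp only [PE, cn, ← h2, mem_inter_iff, mem_ofPred_eq]
    tauto

theorem S_cut (hΛ : IsFullLattice Λ) (hQ : IsRatInner Λ Q) {s : Vd d} (hs : IsRatPoint Λ s)
    {E U : Submodule ℝ (Vd d)} (hE : RatSub Λ E)
    (hU : RatSub Λ U) (hUE : U ≤ E) {κ : Set (Vd d)} (hκ : IsRatCone (dualLattice Λ) κ)
    (hκE : κ ⊆ E) {S : Set (Vd d) → Vd d → ℝ} (hS : IsSMap (LatE Λ Q E) S)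
    {η : Vd d} (hη : η ∈ Λ) :
    ∀ᶠ ξ in mf d, S (PE Q s E (κ ∩ hp η) U) ξ + S (PE Q s E (κ ∩ hp (-η)) U) ξ =
      S (PE Q s E (κ ∩ hp η ∩ hp (-η)) U) ξ + S (PE Q s E κ U) ξ := by
  have r1 := rc_inter hΛ hκ (hp_rc hΛ hη)
  have r2 := rc_inter hΛ hκ (hp_rc hΛ (neg_mem hη))
  have r3 := rc_inter hΛ r1 (hp_rc hΛ (neg_mem hη))
  obtain ⟨l1, a1, b1⟩ := S_vp hΛ hQ hs hE hU hUE r1 (fun x hx => hκE hx.1) hS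
  obtain ⟨l2, a2, b2⟩ := S_vp hΛ hQ hs hE hU hUE r2 (fun x hx => hκE hx.1) hS
  obtain ⟨l3, a3, b3⟩ := S_vp hΛ hQ hs hE hU hUE r3 (fun x hx => hκE hx.1.1) hS
  obtain ⟨l4, a4, b4⟩ := S_vp hΛ hQ hs hE hU hUE hκ hκE hS
  obtain ⟨c1, c2⟩ := PE_cut (Q := Q) hκ η s E U
  have hl : ∀ v ∈ l1 ++ l2 ++ l3 ++ l4, v ∈ LatE Λ Q E ∧ v ≠ 0 := by
    intro v hv
    simp only [List.mem_append] at hv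
    rcases hv with ((hv | hv) | hv) | hv
    exacts [a1 v hv, a2 v hv, a3 v hv, a4 v hv]
  exact vp_four (l1 ++ l2 ++ l3 ++ l4) (fun v hv => (hl v hv).2)
    (b1 _ (fun v hv => by simp [hv]) hl) (b2 _ (fun v hv => by simp [hv]) hl)
    (b3 _ (fun v hv => by simp [hv]) hl) (b4 _ (fun v hv => by simp [hv]) hl) c1 c2

theorem I_cut (hΛ : IsFullLattice Λ) (hQ : IsRatInner Λ Q) {s : Vd d} (hs : IsRatPoint Λ s)
    {E U : Submodule ℝ (Vd d)} (hE : RatSub Λ E)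
    (hU : RatSub Λ U) (hUE : U ≤ E) {κ : Set (Vd d)} (hκ : IsRatCone (dualLattice Λ) κ)
    (hκE : κ ⊆ E) {I : Set (Vd d) → Vd d → ℝ} (hI : IsIMap (LatE Λ Q E) I)
    {η : Vd d} (hη : η ∈ Λ) :
    ∀ᶠ ξ in mf d, IU Q I s E (κ ∩ hp η) U ξ + IU Q I s E (κ ∩ hp (-η)) U ξ =
      IU Q I s E (κ ∩ hp η ∩ hp (-η)) U ξ + IU Q I s E κ U ξ := by
  have r1 := rc_inter hΛ hκ (hp_rc hΛ hη)
  have r2 := rc_inter hΛ hκ (hp_rc hΛ (neg_mem hη))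
  have r3 := rc_inter hΛ r1 (hp_rc hΛ (neg_mem hη))
  obtain ⟨k, v, v1, v2, v3, v4⟩ := I_basis hΛ hQ hE hU hUE
  obtain ⟨l1, a1, b1⟩ := I_vp hΛ hQ hs hU hUE r1 (fun x hx => hκE hx.1) hI v v1 v2 v3 v4
  obtain ⟨l2, a2, b2⟩ := I_vp hΛ hQ hs hU hUE r2 (fun x hx => hκE hx.1) hI v v1 v2 v3 v4
  obtain ⟨l3, a3, b3⟩ := I_vp hΛ hQ hs hU hUE r3 (fun x hx => hκE hx.1.1) hI v v1 v2 v3 v4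
  obtain ⟨l4, a4, b4⟩ := I_vp hΛ hQ hs hU hUE hκ hκE hI v v1 v2 v3 v4
  obtain ⟨c1, c2⟩ := PE_cut (Q := Q) hκ η s E U
  have hl : ∀ v ∈ l1 ++ l2 ++ l3 ++ l4, v ∈ WE Q E ⊓ Uᗮ ∧ v ≠ 0 := by
    intro v hv
    simp only [List.mem_append] at hv
    rcases hv with ((hv | hv) | hv) | hv
    exacts [a1 v hv, a2 v hv, a3 v hv, a4 v hv]
  exact vp_four (l1 ++ l2 ++ l3 ++ l4) (fun v hv => (hl v hv).2)
    (b1 _ (fun v hv => by simp [hv]) hl) (b2 _ (fun v hv => by simp [hv]) hl)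
    (b3 _ (fun v hv => by simp [hv]) hl) (b4 _ (fun v hv => by simp [hv]) hl) c1 c2

end cut

open MeasureTheory Filter Topology Set
open scoped RealInnerProductSpace Pointwise BigOperators

section star

variable {d : ℕ} {Λ : AddSubgroup (Vd d)} {Q : Vd d →ₗ[ℝ] Vd d →ₗ[ℝ] ℝ}

theorem small_eps (l : List (Vd d)) (c₀ c : Vd d)
    (h : ∀ g ∈ l, 0 < ⟪g, c₀⟫ ∨ (0 ≤ ⟪g, c₀⟫ ∧ 0 ≤ ⟪g, c⟫)) :
    ∃ ε : ℝ, 0 < ε ∧ ∀ t : ℝ, 0 < t → t ≤ ε → ∀ g ∈ l, 0 ≤ ⟪g, c₀ + t • c⟫ := by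
  induction l with
  | nil => exact ⟨1, one_pos, by simp⟩
  | cons a l ih =>
    obtain ⟨ε, hε, h1⟩ := ih (fun g hg => h g (List.mem_cons_of_mem _ hg))
    have : ∃ δ : ℝ, 0 < δ ∧ ∀ t : ℝ, 0 < t → t ≤ δ → 0 ≤ ⟪a, c₀ + t • c⟫ := by
      rcases h a List.mem_cons_self with h | ⟨h, h'⟩
      · refine ⟨⟪a, c₀⟫ / (|⟪a, c⟫| + 1), by positivity, ?_⟩
        intro t ht ht2
        rw [inner_add_right, inner_smul_right]
        rw [le_div_iff₀ (by positivity)] at ht2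
        have := neg_abs_le ⟪a, c⟫
        nlinarith
      · refine ⟨1, one_pos, fun t ht _ => ?_⟩
        rw [inner_add_right, inner_smul_right]
        positivity
    obtain ⟨δ, hδ, h2⟩ := this
    refine ⟨min ε δ, lt_min hε hδ, ?_⟩
    intro t ht ht2 g hg
    rcases List.mem_cons.1 hg with rfl | hg
    · exact h2 t ht (ht2.trans (min_le_right _ _))
    · exact h1 t ht (ht2.trans (min_le_left _ _)) g hg

/-- the subspaces indexing faces -/
def VV (Q : Vd d →ₗ[ℝ] Vd d →ₗ[ℝ] ℝ) (E : Submodule ℝ (Vd d)) (κ : Set (Vd d)) :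
    Set (Submodule ℝ (Vd d)) :=
  {U | U ≤ E ∧ Submodule.span ℝ (κ ∩ U) = U ∧ Submodule.span ℝ (cn Q E κ U) = WE Q E ⊓ Uᗮ}

theorem no_line (hQ : IsRatInner Λ Q) (s : Vd d) {E : Submodule ℝ (Vd d)} {κ : Set (Vd d)}
    (hκE : Submodule.span ℝ κ = E) (U : Submodule ℝ (Vd d)) :
    ¬ ContainsLine (PE Q s E κ U) := by
  rintro ⟨x, u, hu, h⟩
  apply hu
  have hW : u ∈ WE Q E := by
    have h1 := (h 1).1
    have h0 := (h 0).1
    have := Submodule.sub_mem _ h1 h0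
    simpa using this
  apply W_zero hQ hW
  have : u ∈ Eᗮ := by
    rw [← hκE, mem_orth_span]
    intro g hg
    have h1 : ∀ t : ℝ, 0 ≤ ⟪g, x - pE Q E s⟫ + t * ⟪g, u⟫ := by
      intro t
      have := (h t).2.1 g hg
      change 0 ≤ ⟪g, x + t • u - pE Q E s⟫ at this
      rw [add_sub_right_comm, inner_add_right, inner_smul_right] at this
      exact this
    by_contra hne
    have := h1 (-(⟪g, x - pE Q E s⟫ + 1) / ⟪g, u⟫)
    rw [div_mul_cancel₀ _ hne] at this
    linarith
  exact (Submodule.mem_orthogonal _ _).1 this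

theorem ps_mem (s : Vd d) (E U : Submodule ℝ (Vd d)) (κ : Set (Vd d)) :
    pE Q E s ∈ PE Q s E κ U := by
  simp only [PE, cn, mem_ofPred_eq, sub_self, Submodule.zero_mem, true_and, and_true]
  intro g _
  simp [pairE]

theorem cn_cone (E U : Submodule ℝ (Vd d)) (κ : Set (Vd d)) {x : Vd d} (hx : x ∈ cn Q E κ U)
    {t : ℝ} (ht : 0 ≤ t) : t • x ∈ cn Q E κ U := by
  refine ⟨Submodule.smul_mem _ _ hx.1, ?_, Submodule.smul_mem _ _ hx.2.2⟩
  intro g hg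
  change 0 ≤ ⟪g, t • x⟫
  rw [inner_smul_right]
  exact mul_nonneg ht (hx.2.1 g hg)

theorem cn_add (E U : Submodule ℝ (Vd d)) (κ : Set (Vd d)) {x y : Vd d} (hx : x ∈ cn Q E κ U)
    (hy : y ∈ cn Q E κ U) : x + y ∈ cn Q E κ U := by
  refine ⟨Submodule.add_mem _ hx.1 hy.1, ?_, Submodule.add_mem _ hx.2.2 hy.2.2⟩
  intro g hg
  change 0 ≤ ⟪g, x + y⟫
  rw [inner_add_right]
  exact add_nonneg (hx.2.1 g hg) (hy.2.1 g hg)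

theorem VV_face {E U : Submodule ℝ (Vd d)} {κ : Set (Vd d)} (s : Vd d)
    (hU : U ∈ VV Q E κ) : IsFaceOf (PE Q s E κ ⊥) (PE Q s E κ U) := by
  obtain ⟨hUE, hU1, hU2⟩ := hU
  refine ⟨⟨_, ps_mem s E U κ⟩, ?_⟩
  -- finite spanning set inside
  have hfg : (Submodule.span ℝ (κ ∩ U)).FG := IsNoetherian.noetherian _
  obtain ⟨T, hT1, hT2⟩ := Submodule.fg_span_iff_fg_span_finset_subset (κ ∩ (U : Set (Vd d))) |>.1 hfg
  refine ⟨-∑ g ∈ T, g, ?_⟩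
  have key : ∀ x, x ∈ PE Q s E κ ⊥ → ∀ g ∈ T, 0 ≤ ⟪g, x - pE Q E s⟫ :=
    fun x hx g hg => hx.2.1 g (hT1 hg).1
  have hval : ∀ x, pairE (-∑ g ∈ T, g) x =
      - (∑ g ∈ T, ⟪g, x - pE Q E s⟫) - ⟪∑ g ∈ T, g, pE Q E s⟫ := by
    intro x
    change ⟪_, _⟫ = _
    simp only [inner_neg_left, inner_sub_right, Finset.sum_sub_distrib, sum_inner]
    ring
  ext x
  constructor
  · intro hx
    have hx' : x ∈ PE Q s E κ ⊥ := ⟨hx.1, hx.2.1, by simp⟩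
    refine ⟨hx', fun y hy => ?_⟩
    rw [hval, hval]
    have h1 : ∑ g ∈ T, ⟪g, x - pE Q E s⟫ = 0 := Finset.sum_eq_zero fun g hg =>
      (Submodule.mem_orthogonal _ _).1 hx.2.2 g (hT1 hg).2
    have h2 := Finset.sum_nonneg (key y hy)
    linarith
  · rintro ⟨hx, hm⟩
    refine ⟨hx.1, hx.2.1, ?_⟩
    have := hm _ (ps_mem s E ⊥ κ)
    rw [hval, hval] at this
    simp only [sub_self, inner_zero_right, Finset.sum_const_zero] at this
    have h0 : ∑ g ∈ T, ⟪g, x - pE Q E s⟫ = 0 :=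
      le_antisymm (by linarith) (Finset.sum_nonneg (key x hx))
    rw [Finset.sum_eq_zero_iff_of_nonneg (key x hx)] at h0
    rw [← hU1, hT2, mem_orth_span]
    exact h0

theorem face_VV {E : Submodule ℝ (Vd d)} (l : List (Vd d)) (hl : coneOf l ⊆ E) (s : Vd d)
    {F : Set (Vd d)} (hF : IsFaceOf (PE Q s E (coneOf l) ⊥) F) :
    ∃ l' : List (Vd d), l' ∈ l.sublists ∧ Submodule.span ℝ {x | x ∈ l'} ∈ VV Q E (coneOf l) ∧
      F = PE Q s E (coneOf l) (Submodule.span ℝ {x | x ∈ l'}) := by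
  classical
  obtain ⟨⟨x₀, hx₀⟩, φ, hφ⟩ := hF
  set ps := pE Q E s
  have hdual : ∀ x, x ∈ dualConeSet (coneOf l) ↔ ∀ g ∈ l, 0 ≤ ⟪g, x⟫ := by
    intro x
    rw [dualConeSet_coneOf]; rfl
  have hbot : ∀ x, x ∈ cn Q E (coneOf l) ⊥ ↔ x ∈ WE Q E ∧ ∀ g ∈ l, 0 ≤ ⟪g, x⟫ := by
    intro x
    simp only [cn, mem_ofPred_eq, hdual, Submodule.bot_orthogonal_eq_top, Submodule.mem_top, and_true]
  have hPm : ∀ c, c ∈ cn Q E (coneOf l) ⊥ → ps + c ∈ PE Q s E (coneOf l) ⊥ := by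
    intro c hc
    change ps + c - ps ∈ cn Q E (coneOf l) ⊥
    rwa [add_sub_cancel_left]
  have hneg : ∀ c ∈ cn Q E (coneOf l) ⊥, ⟪φ, c⟫ ≤ 0 := by
    intro c hc
    rw [hφ] at hx₀
    have h1 : ∀ t : ℝ, 0 ≤ t → t * ⟪φ, c⟫ ≤ ⟪φ, x₀⟫ - ⟪φ, ps⟫ := by
      intro t ht
      have := hx₀.2 _ (hPm _ (cn_cone E ⊥ _ hc ht))
      change ⟪φ, ps + t • c⟫ ≤ ⟪φ, x₀⟫ at this
      rw [inner_add_right, inner_smul_right] at this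
      linarith
    by_contra hpos
    push Not at hpos
    have h0 := h1 0 le_rfl
    rw [zero_mul] at h0
    have := h1 ((⟪φ, x₀⟫ - ⟪φ, ps⟫ + 1) / ⟪φ, c⟫) (by positivity)
    rw [div_mul_cancel₀ _ hpos.ne'] at this
    linarith
  have hF' : ∀ x, x ∈ F ↔ x - ps ∈ cn Q E (coneOf l) ⊥ ∧ ⟪φ, x - ps⟫ = 0 := by
    intro x
    rw [hφ]
    constructor
    · rintro ⟨h1, h2⟩
      refine ⟨h1, le_antisymm (hneg _ h1) ?_⟩
      have := h2 _ (ps_mem s E ⊥ _)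
      change ⟪φ, ps⟫ ≤ ⟪φ, x⟫ at this
      rw [inner_sub_right]; linarith
    · rintro ⟨h1, h2⟩
      refine ⟨h1, fun y hy => ?_⟩
      have := hneg _ hy
      change ⟪φ, y - ps⟫ ≤ 0 at this
      change ⟪φ, y⟫ ≤ ⟪φ, x⟫
      rw [inner_sub_right] at this h2
      linarith
  -- the cone of the face
  let f₀ : Set (Vd d) := {c | c ∈ cn Q E (coneOf l) ⊥ ∧ ⟪φ, c⟫ = 0}
  have hf0 : (0 : Vd d) ∈ f₀ := ⟨(hbot 0).2 ⟨Submodule.zero_mem _, by simp⟩, by simp⟩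
  have hfadd : ∀ x ∈ f₀, ∀ y ∈ f₀, x + y ∈ f₀ := fun x hx y hy =>
    ⟨cn_add _ _ _ hx.1 hy.1, by rw [inner_add_right, hx.2, hy.2, add_zero]⟩
  let p : Vd d → Prop := fun g => ∀ c ∈ f₀, ⟪g, c⟫ = 0
  have hc0 : ∃ c₀ ∈ f₀, ∀ g ∈ l, ¬ p g → 0 < ⟪g, c₀⟫ := by
    have : ∀ l' : List (Vd d), (∀ g ∈ l', g ∈ l) → ∃ c₀ ∈ f₀, ∀ g ∈ l', ¬ p g → 0 < ⟪g, c₀⟫ := by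
      intro l'
      induction l' with
      | nil => intro _; exact ⟨0, hf0, by simp⟩
      | cons a l' ih =>
        intro hl'
        obtain ⟨c, hc, h⟩ := ih (fun g hg => hl' g (List.mem_cons_of_mem _ hg))
        by_cases hp : p a
        · refine ⟨c, hc, fun g hg hgp => ?_⟩
          rcases List.mem_cons.1 hg with rfl | hg
          · exact absurd hp hgp
          · exact h g hg hgp
        · have hp2 := hp
          simp only [p] at hp2
          push Not at hp2
          obtain ⟨c', hc', hne⟩ := hp2
          have hpos : 0 < ⟪a, c'⟫ :=
            lt_of_le_of_ne (((hbot _).1 hc'.1).2 a (hl' a List.mem_cons_self)) (Ne.symm hne)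
          refine ⟨c + c', hfadd _ hc _ hc', fun g hg hgp => ?_⟩
          rw [inner_add_right]
          have h1 := ((hbot _).1 hc'.1).2 g (hl' g hg)
          have h2 := ((hbot _).1 hc.1).2 g (hl' g hg)
          rcases List.mem_cons.1 hg with rfl | hg
          · linarith
          · linarith [h g hg hgp]
    exact this l (fun g hg => hg)
  obtain ⟨c₀, hc₀, hc₀p⟩ := hc0
  set l' := l.filter (fun g => decide (p g)) with hl'
  have hml : ∀ g, g ∈ l' ↔ g ∈ l ∧ p g := by intro g; simp [hl']
  set U := Submodule.span ℝ {x | x ∈ l'} with hU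
  have hUo : ∀ x, x ∈ Uᗮ ↔ ∀ g ∈ l, p g → ⟪g, x⟫ = 0 := by
    intro x
    rw [hU, mem_orth_span]
    constructor
    · intro h g hg hp
      exact h g ((hml g).2 ⟨hg, hp⟩)
    · intro h g hg
      exact h g ((hml g).1 hg).1 ((hml g).1 hg).2
  have hcnU : ∀ x, x ∈ cn Q E (coneOf l) U ↔ x ∈ f₀ := by
    intro x
    constructor
    · rintro ⟨h1, h2, h3⟩
      have hxb : x ∈ cn Q E (coneOf l) ⊥ := ⟨h1, h2, by simp⟩
      refine ⟨hxb, le_antisymm (hneg _ hxb) ?_⟩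
      obtain ⟨ε, hε, he⟩ := small_eps l c₀ (-x) (by
        intro g hg
        by_cases hp : p g
        · right
          refine ⟨((hbot _).1 hc₀.1).2 g hg, ?_⟩
          rw [inner_neg_right, (hUo x).1 h3 g hg hp]; simp
        · exact Or.inl (hc₀p g hg hp))
      have h4 := hneg (c₀ + ε • (-x)) ((hbot _).2 ⟨Submodule.add_mem _ hc₀.1.1
        (Submodule.smul_mem _ _ (Submodule.neg_mem _ h1)), he ε hε le_rfl⟩)
      rw [inner_add_right, inner_smul_right, inner_neg_right, hc₀.2] at h4
      nlinarith
    · rintro ⟨h1, h2⟩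
      exact ⟨h1.1, h1.2.1, (hUo x).2 fun g hg hp => hp x ⟨h1, h2⟩⟩
  refine ⟨l', List.mem_sublists.2 List.filter_sublist, ⟨?_, ?_, ?_⟩, ?_⟩
  · rw [Submodule.span_le]
    intro g hg
    exact hl (coneOf_mem l g ((hml g).1 hg).1)
  · apply le_antisymm
    · rw [Submodule.span_le]; exact inter_subset_right
    · apply Submodule.span_mono
      intro g hg
      exact ⟨coneOf_mem l g ((hml g).1 hg).1, Submodule.subset_span hg⟩
  · apply le_antisymm (cn_sub _ _ _)
    rintro w ⟨hw1, hw2⟩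
    obtain ⟨ε, hε, he⟩ := small_eps l c₀ w (by
        intro g hg
        by_cases hp : p g
        · right
          exact ⟨((hbot _).1 hc₀.1).2 g hg, ((hUo w).1 hw2 g hg hp).ge⟩
        · exact Or.inl (hc₀p g hg hp))
    have hc₀' := (hcnU c₀).2 hc₀
    have h1 : c₀ + ε • w ∈ cn Q E (coneOf l) U :=
      ⟨Submodule.add_mem _ hc₀.1.1 (Submodule.smul_mem _ _ hw1), (hdual _).2 (he ε hε le_rfl),
        Submodule.add_mem _ hc₀'.2.2 (Submodule.smul_mem _ _ hw2)⟩
    have h2 := Submodule.sub_mem _ (Submodule.subset_span (R := ℝ) h1)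
      (Submodule.subset_span (R := ℝ) hc₀')
    rw [add_sub_cancel_left] at h2
    have h3 := Submodule.smul_mem _ ε⁻¹ h2
    rwa [smul_smul, inv_mul_cancel₀ hε.ne', one_smul] at h3
  · ext x
    rw [hF']
    change _ ↔ x - ps ∈ cn Q E (coneOf l) U
    rw [hcnU]; rfl

theorem orth_le (hQ : IsRatInner Λ Q) {E U U' : Submodule ℝ (Vd d)} (hU : U ≤ E) (hU' : U' ≤ E)
    (h : WE Q E ⊓ Uᗮ ≤ U'ᗮ) : U' ≤ U := by
  rw [← Submodule.orthogonal_orthogonal U, Submodule.le_orthogonal_iff_le_orthogonal]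
  intro x hx
  have h1 : pE Q E x ∈ U'ᗮ := by
    apply h
    refine ⟨pE_mem_W E x, ?_⟩
    rw [SetLike.mem_coe, Submodule.mem_orthogonal]
    intro g hg
    rw [pE_inner hQ (hU hg)]
    exact (Submodule.mem_orthogonal _ _).1 hx g hg
  rw [Submodule.mem_orthogonal] at h1 ⊢
  intro g hg
  rw [← pE_inner hQ (hU' hg)]
  exact h1 g hg

theorem VV_inj (hQ : IsRatInner Λ Q) {E : Submodule ℝ (Vd d)} {κ : Set (Vd d)} (s : Vd d) :
    Set.InjOn (fun U => PE Q s E κ U) (VV Q E κ) := by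
  intro U hU U' hU' h
  have h1 : cn Q E κ U = cn Q E κ U' := by
    ext x
    have : pE Q E s + x ∈ PE Q s E κ U ↔ pE Q E s + x ∈ PE Q s E κ U' := by
      simp only at h
      rw [h]
    change pE Q E s + x - pE Q E s ∈ cn Q E κ U ↔ pE Q E s + x - pE Q E s ∈ cn Q E κ U' at this
    rwa [add_sub_cancel_left] at this
  have h2 : WE Q E ⊓ Uᗮ = WE Q E ⊓ U'ᗮ := by rw [← hU.2.2, h1, hU'.2.2]
  exact le_antisymm (orth_le hQ hU'.1 hU.1 (h2 ▸ inf_le_right))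
    (orth_le hQ hU.1 hU'.1 (h2 ▸ inf_le_right))

theorem VV_sub (hQ : IsRatInner Λ Q) {E : Submodule ℝ (Vd d)} (l : List (Vd d))
    (hl : coneOf l ⊆ E) : VV Q E (coneOf l) ⊆
      (fun l' : List (Vd d) => Submodule.span ℝ {x | x ∈ l'}) '' {l' | l' ∈ l.sublists} := by
  intro U hU
  obtain ⟨l', h1, h2, h3⟩ := face_VV l hl 0 (VV_face 0 hU)
  exact ⟨l', h1, (VV_inj hQ 0 hU h2 h3).symm⟩

theorem VV_finite (hQ : IsRatInner Λ Q) {E : Submodule ℝ (Vd d)} {κ : Set (Vd d)}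
    (hκ : IsRatCone (dualLattice Λ) κ) (hκE : κ ⊆ E) : (VV Q E κ).Finite := by
  obtain ⟨l, hl, rfl⟩ := (isRatCone_iff _ _).1 hκ
  exact ((List.finite_toSet _).image _).subset (VV_sub hQ l hκE)

theorem VV_rat (hQ : IsRatInner Λ Q) {E : Submodule ℝ (Vd d)} {κ : Set (Vd d)}
    (hκ : IsRatCone (dualLattice Λ) κ) (hκE : κ ⊆ E) : ∀ U ∈ VV Q E κ, RatSub Λ U := by
  obtain ⟨l, hl, rfl⟩ := (isRatCone_iff _ _).1 hκ
  intro U hU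
  obtain ⟨l', h1, rfl⟩ := VV_sub hQ l hκE hU
  exact ⟨l', fun g hg => hl g ((List.mem_sublists.1 h1).subset hg), rfl⟩

end star

open MeasureTheory Filter Topology Set
open scoped RealInnerProductSpace Pointwise BigOperators

section star2

variable {d : ℕ} {Λ : AddSubgroup (Vd d)} {Q : Vd d →ₗ[ℝ] Vd d →ₗ[ℝ] ℝ}

theorem PE_convex (s : Vd d) (E U : Submodule ℝ (Vd d)) (κ : Set (Vd d)) :
    Convex ℝ (PE Q s E κ U) := by
  intro x hx y hy a b ha hb hab
  change a • x + b • y - pE Q E s ∈ cn Q E κ U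
  have : a • x + b • y - pE Q E s = a • (x - pE Q E s) + b • (y - pE Q E s) := by
    have : pE Q E s = (a + b) • pE Q E s := by rw [hab, one_smul]
    rw [smul_sub, smul_sub]
    nth_rw 1 [this]
    rw [add_smul]; abel
  rw [this]
  exact cn_add _ _ _ (cn_cone _ _ _ hx ha) (cn_cone _ _ _ hy hb)

theorem prolong {F : Set (Vd d)} {x w : Vd d} (hx : x ∈ intrinsicInterior ℝ F)
    (hw : w ∈ (affineSpan ℝ F).direction) : ∃ t : ℝ, 0 < t ∧ x + t • w ∈ F ∧ x - t • w ∈ F := by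
  obtain ⟨y, hy, rfl⟩ := hx
  have hmem : ∀ t : ℝ, (y : Vd d) + t • w ∈ affineSpan ℝ F := by
    intro t
    rw [add_comm]
    exact AffineSubspace.vadd_mem_of_mem_direction (Submodule.smul_mem _ t hw) y.2
  let f : ℝ → affineSpan ℝ F := fun t => ⟨(y : Vd d) + t • w, hmem t⟩
  have hf : Continuous f := by
    apply Continuous.subtype_mk
    fun_prop
  have hf0 : f 0 = y := by
    apply Subtype.ext
    simp [f]
  have h1 : ∀ᶠ t in 𝓝 (0 : ℝ), f t ∈ interior ((↑) ⁻¹' F : Set (affineSpan ℝ F)) :=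
    hf.continuousAt.eventually_mem (by rw [hf0]; exact isOpen_interior.mem_nhds hy)
  obtain ⟨r, hr, hb⟩ := Metric.eventually_nhds_iff.1 h1
  refine ⟨r / 2, by positivity, ?_, ?_⟩
  · have := interior_subset (hb (y := r / 2) (by simp [abs_of_pos hr]; linarith))
    exact this
  · have := interior_subset (hb (y := -(r / 2)) (by simp [abs_of_pos hr]; linarith))
    change (y : Vd d) + (-(r / 2)) • w ∈ F at this
    rwa [neg_smul, ← sub_eq_add_neg] at this

theorem suppCone_eq (hQ : IsRatInner Λ Q) {E U : Submodule ℝ (Vd d)} (l : List (Vd d))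
    (hl : coneOf l ⊆ E) (s : Vd d) (hU : U ∈ VV Q E (coneOf l)) :
    suppCone (PE Q s E (coneOf l) ⊥) (PE Q s E (coneOf l) U) = PE Q s E (coneOf l ∩ U) ⊥ := by
  obtain ⟨hUE, hU1, hU2⟩ := hU
  obtain ⟨haf, hdir⟩ := mem_affineSpan_PE (Q := Q) s E U (coneOf l)
  rw [hU2] at haf hdir
  ext z
  constructor
  · rintro ⟨a, ha, u, ⟨x, hx, ε, hε, hu⟩, rfl⟩
    have ha' := (haf a).1 ha
    have hx' := intrinsicInterior_subset hx
    have hxu := hu ε hε le_rfl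
    have huW : u ∈ WE Q E := by
      have := Submodule.sub_mem _ hxu.1 hx'.1
      rw [sub_sub_sub_cancel_right, add_sub_cancel_left] at this
      have := Submodule.smul_mem _ ε⁻¹ this
      rwa [smul_smul, inv_mul_cancel₀ hε.ne', one_smul] at this
    change a + u - pE Q E s ∈ cn Q E (coneOf l ∩ U) ⊥
    rw [add_sub_right_comm]
    refine ⟨Submodule.add_mem _ ha'.1 huW, ?_, by simp⟩
    rintro g ⟨hg1, hg2⟩
    change 0 ≤ ⟪g, a - pE Q E s + u⟫
    have h1 : ⟪g, a - pE Q E s⟫ = 0 := (Submodule.mem_orthogonal _ _).1 ha'.2 g hg2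
    have h2 : ⟪g, x - pE Q E s⟫ = 0 := (Submodule.mem_orthogonal _ _).1 hx'.2.2 g hg2
    have h3 : 0 ≤ ⟪g, x + ε • u - pE Q E s⟫ := hxu.2.1 g hg1
    rw [add_sub_right_comm, inner_add_right, h2, inner_smul_right, zero_add] at h3
    rw [inner_add_right, h1, zero_add]
    exact nonneg_of_mul_nonneg_right h3 hε
  · intro hz
    have hne : (PE Q s E (coneOf l) U).Nonempty := ⟨_, ps_mem s E U _⟩
    obtain ⟨x, hx⟩ := hne.intrinsicInterior (PE_convex s E U _)
    have hx' := intrinsicInterior_subset hx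
    refine ⟨pE Q E s, ?_, z - pE Q E s, ⟨x, hx, ?_⟩, by abel⟩
    · exact (haf _).2 (by rw [sub_self]; exact Submodule.zero_mem _)
    · obtain ⟨ε, hε, h⟩ := small_eps l (x - pE Q E s) (z - pE Q E s) (by
        intro g hg
        have hgκ := coneOf_mem l g hg
        have h0 : 0 ≤ ⟪g, x - pE Q E s⟫ := hx'.2.1 g hgκ
        by_cases hgU : g ∈ U
        · exact Or.inr ⟨h0, hz.2.1 g ⟨hgκ, hgU⟩⟩
        · left
          refine lt_of_le_of_ne h0 (fun he => hgU ?_)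
          have hz0 : ∀ w ∈ WE Q E ⊓ Uᗮ, ⟪g, w⟫ = 0 := by
            intro w hw
            obtain ⟨t, ht, h1, h2⟩ := prolong (w := w) hx (by rw [hdir]; exact hw)
            have h1 : 0 ≤ ⟪g, x + t • w - pE Q E s⟫ := h1.2.1 g hgκ
            have h2 : 0 ≤ ⟪g, x - t • w - pE Q E s⟫ := h2.2.1 g hgκ
            rw [add_sub_right_comm, inner_add_right, ← he, inner_smul_right, zero_add] at h1
            rw [sub_right_comm, inner_sub_right, ← he, inner_smul_right, zero_sub] at h2
            nlinarith
          have := orth_le hQ (U := U) (U' := Submodule.span ℝ {g}) hUE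
            (by rw [Submodule.span_singleton_le_iff_mem]; exact hl hgκ) (by
              intro w hw
              rw [mem_orth_span]
              rintro v rfl
              exact hz0 w hw)
          exact this (Submodule.mem_span_singleton_self g))
      refine ⟨ε, hε, fun t ht ht2 => ?_⟩
      change x + t • (z - pE Q E s) - pE Q E s ∈ cn Q E (coneOf l) ⊥
      rw [add_sub_right_comm]
      refine ⟨Submodule.add_mem _ hx'.1 (Submodule.smul_mem _ _ hz.1), ?_, by simp⟩
      rw [dualConeSet_coneOf]
      exact h t ht ht2

theorem qp_comp (hQ : IsRatInner Λ Q) {E U : Submodule ℝ (Vd d)} (hUE : U ≤ E) :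
    (qp Q (WE Q E ⊓ Uᗮ)).comp (pE Q E) = pE Q U := by
  refine qp_unique hQ.2.1 (L := Uᗮ) ⟨?_, ?_⟩ (qp_spec hQ _)
  · intro x
    have h1 := (qp_spec hQ (WE Q E ⊓ Uᗮ)).1 (pE Q E x)
    have h2 : x - pE Q E x ∈ Uᗮ := Submodule.orthogonal_le hUE ((qp_spec hQ Eᗮ).1 x)
    have := Submodule.add_mem _ h2 h1.2
    rwa [sub_add_sub_cancel] at this
  · intro x y hy
    have h1 := (qp_spec hQ (WE Q E ⊓ Uᗮ)).1 (pE Q E x)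
    have h2 := (qp_spec hQ (WE Q E ⊓ Uᗮ)).2 (pE Q E x)
    have hW : qp Q (WE Q E ⊓ Uᗮ) (pE Q E x) ∈ WE Q E := by
      have := Submodule.sub_mem _ (pE_mem_W E x) h1.1
      rwa [sub_sub_cancel] at this
    have hy' : pE Q E y ∈ WE Q E ⊓ Uᗮ := by
      refine ⟨pE_mem_W E y, ?_⟩
      rw [SetLike.mem_coe, Submodule.mem_orthogonal]
      intro g hg
      rw [pE_inner hQ (hUE hg)]
      exact (Submodule.mem_orthogonal _ _).1 hy g hg
    have h3 : Q (qp Q (WE Q E ⊓ Uᗮ) (pE Q E x)) (y - pE Q E y) = 0 := by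
      rw [← pE_W hQ hW]
      exact (qp_spec hQ Eᗮ).2 _ _ ((qp_spec hQ Eᗮ).1 y)
    rw [map_sub, h2 _ hy', sub_zero] at h3
    exact h3

/-- the local function attached to `κ ∩ U` -/
noncomputable def MU (Λ : AddSubgroup (Vd d)) (Q : Vd d →ₗ[ℝ] Vd d →ₗ[ℝ] ℝ)
    (μ : AddSubgroup (Vd d) → Set (Vd d) → Vd d → ℝ) (s : Vd d)
    (U : Submodule ℝ (Vd d)) (κ : Set (Vd d)) (ξ : Vd d) : ℝ :=
  open Classical in
  if Submodule.span ℝ (κ ∩ U) = U then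
    μ (LatE Λ Q U) (pE Q U '' ((fun x => s + x) '' dualConeSet (κ ∩ U))) ξ else 0

theorem star_span (hΛ : IsFullLattice Λ) (hQ : IsRatInner Λ Q) {s : Vd d} (hs : IsRatPoint Λ s)
    {I S μ : AddSubgroup (Vd d) → Set (Vd d) → Vd d → ℝ} (hμ : IsMuFamily Λ Q I S μ)
    {E : Submodule ℝ (Vd d)} {κ : Set (Vd d)}
    (hκ : IsRatCone (dualLattice Λ) κ) (hκE : Submodule.span ℝ κ = E)
    (T : Finset (Submodule ℝ (Vd d))) (hT1 : ∀ U ∈ T, U ≤ E)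
    (hT2 : ∀ U ∈ VV Q E κ, U ∈ T) :
    ∀ᶠ ξ in mf d, S (LatE Λ Q E) (PE Q s E κ ⊥) ξ =
      ∑ U ∈ T, MU Λ Q μ s U κ ξ * IU Q (I (LatE Λ Q E)) s E κ U ξ := by
  classical
  have hE : RatSub Λ E := hκE ▸ ratSub_span hκ
  have hsub : κ ⊆ E := by rw [← hκE]; exact Submodule.subset_span
  have hbot : RatSub Λ ⊥ := ⟨[], by simp, by simp⟩
  obtain ⟨l, hl, hκl⟩ := (isRatCone_iff _ _).1 hκ
  have hmain := hμ.1.2.2 (LatE Λ Q E) (LatE_quot hΛ hQ hE) (PE Q s E κ ⊥)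
    (PE_cone hΛ hQ hs hbot bot_le hκ hsub) (no_line hQ s hκE ⊥)
    (fun F => qp Q (affineSpan ℝ F).direction) (fun F _ => qp_spec hQ _)
  have hmain' : ∀ᶠ ξ in mf d, S (LatE Λ Q E) (PE Q s E κ ⊥) ξ = _ := hmain
  filter_upwards [hmain'] with ξ hξ
  refine hξ.trans ?_
  have himg : {F | IsFaceOf (PE Q s E κ ⊥) F} = (fun U => PE Q s E κ U) '' VV Q E κ := by
    ext F
    constructor
    · intro hF
      rw [mem_ofPred_eq, hκl] at hF
      obtain ⟨l', -, h1, h2⟩ := face_VV l (hκl ▸ hsub) s hF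
      rw [← hκl] at h1 h2
      exact ⟨_, h1, h2.symm⟩
    · rintro ⟨U, hU, rfl⟩
      exact VV_face s hU
  change (∑ᶠ F ∈ {F | IsFaceOf (PE Q s E κ ⊥) F}, _) = _
  rw [himg, finsum_mem_image (VV_inj hQ s), finsum_mem_eq_finite_toFinset_sum _ (VV_finite hQ hκ hsub)]
  rw [← Finset.sum_subset (s₁ := (VV_finite hQ hκ hsub).toFinset) (s₂ := T)]
  · apply Finset.sum_congr rfl
    intro U hU
    rw [Set.Finite.mem_toFinset] at hU
    have hdir := (mem_affineSpan_PE (Q := Q) s E U κ).2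
    rw [hU.2.2] at hdir
    rw [IU, if_pos hU.2.2, MU, if_pos hU.2.1]
    congr 1
    simp only [hdir]
    have e1 : AddSubgroup.map (qp Q (WE Q E ⊓ Uᗮ)).toAddMonoidHom (LatE Λ Q E) = LatE Λ Q U := by
      rw [LatE, AddSubgroup.map_map, LatE, ← qp_comp hQ hU.1]
      rfl
    have e2 : suppCone (PE Q s E κ ⊥) (PE Q s E κ U) = PE Q s E (κ ∩ U) ⊥ := by
      rw [hκl]
      exact suppCone_eq hQ l (hκl ▸ hsub) s (hκl ▸ hU)
    rw [e1, e2, ← PE_eq hQ s (inter_subset_left.trans hsub) bot_le, ← image_comp,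
      ← LinearMap.coe_comp, qp_comp hQ hU.1]
    simp
  · intro U hU
    rw [Set.Finite.mem_toFinset] at hU
    exact hT2 U hU
  · intro U hUT hU
    rw [Set.Finite.mem_toFinset] at hU
    by_cases h1 : Submodule.span ℝ (κ ∩ U) = U
    · rw [IU, if_neg, mul_zero]
      exact fun h2 => hU ⟨hT1 U hUT, h1, h2⟩
    · rw [MU, if_neg h1, zero_mul]

theorem star_nonspan (hΛ : IsFullLattice Λ) (hQ : IsRatInner Λ Q) {s : Vd d}
    (hs : IsRatPoint Λ s)
    {I S μ : AddSubgroup (Vd d) → Set (Vd d) → Vd d → ℝ}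
    (hI : IsIFamily Q Λ I) (hS : IsSFamily Q Λ S)
    {E : Submodule ℝ (Vd d)} (hE : RatSub Λ E) {κ : Set (Vd d)}
    (hκ : IsRatCone (dualLattice Λ) κ) (hκE : κ ⊆ E) (hne : Submodule.span ℝ κ ≠ E)
    (T : Finset (Submodule ℝ (Vd d))) (hT1 : ∀ U ∈ T, U ≤ E ∧ RatSub Λ U) (ξ : Vd d) :
    S (LatE Λ Q E) (PE Q s E κ ⊥) ξ =
      ∑ U ∈ T, MU Λ Q μ s U κ ξ * IU Q (I (LatE Λ Q E)) s E κ U ξ := by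
  have hbot : RatSub Λ ⊥ := ⟨[], by simp, by simp⟩
  -- a direction
  obtain ⟨u, hu0, huW, huκ⟩ : ∃ u : Vd d, u ≠ 0 ∧ u ∈ WE Q E ∧ ∀ g ∈ κ, ⟪g, u⟫ = 0 := by
    by_contra hno
    push Not at hno
    apply hne
    apply le_antisymm (Submodule.span_le.2 hκE)
    apply orth_le hQ (Submodule.span_le.2 hκE) le_rfl
    rintro x ⟨hx1, hx2⟩
    have : x = 0 := by
      by_contra hx0
      obtain ⟨g, hg, h⟩ := hno x hx0 hx1
      exact h ((mem_orth_span _ _).1 hx2 g hg)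
    rw [this]; exact Submodule.zero_mem _
  have hline : ∀ U : Submodule ℝ (Vd d), u ∈ Uᗮ → ContainsLine (PE Q s E κ U) := by
    intro U hU
    refine ⟨pE Q E s, u, hu0, fun t => ?_⟩
    change pE Q E s + t • u - pE Q E s ∈ cn Q E κ U
    rw [add_sub_cancel_left]
    refine ⟨Submodule.smul_mem _ _ huW, ?_, Submodule.smul_mem _ _ hU⟩
    intro g hg
    change 0 ≤ ⟪g, t • u⟫
    rw [inner_smul_right, huκ g hg, mul_zero]
  have hq := LatE_quot hΛ hQ hE
  rw [(hS _ hq).2.1 _ (PE_poly hΛ hQ hs hbot bot_le hκ hκE) (hline ⊥ (by simp))]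
  symm
  apply Finset.sum_eq_zero
  intro U hU
  by_cases h1 : Submodule.span ℝ (κ ∩ U) = U
  · have : IU Q (I (LatE Λ Q E)) s E κ U ξ = 0 := by
      rw [IU]
      split_ifs
      · apply (hI _ hq).2.1 _ (PE_poly hΛ hQ hs (hT1 U hU).2 (hT1 U hU).1 hκ hκE)
        apply hline
        rw [← h1, mem_orth_span]
        exact fun v hv => huκ v hv.1
      · rfl
    rw [this, mul_zero]
  · rw [MU, if_neg h1, zero_mul]

theorem star (hΛ : IsFullLattice Λ) (hQ : IsRatInner Λ Q) {s : Vd d}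
    (hs : IsRatPoint Λ s)
    {I S μ : AddSubgroup (Vd d) → Set (Vd d) → Vd d → ℝ}
    (hI : IsIFamily Q Λ I) (hS : IsSFamily Q Λ S) (hμ : IsMuFamily Λ Q I S μ)
    {E : Submodule ℝ (Vd d)} (hE : RatSub Λ E) {κ : Set (Vd d)}
    (hκ : IsRatCone (dualLattice Λ) κ) (hκE : κ ⊆ E)
    (T : Finset (Submodule ℝ (Vd d))) (hT1 : ∀ U ∈ T, U ≤ E ∧ RatSub Λ U)
    (hT2 : ∀ U ∈ VV Q E κ, U ∈ T) :
    ∀ᶠ ξ in mf d, S (LatE Λ Q E) (PE Q s E κ ⊥) ξ =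
      ∑ U ∈ T, MU Λ Q μ s U κ ξ * IU Q (I (LatE Λ Q E)) s E κ U ξ := by
  by_cases h : Submodule.span ℝ κ = E
  · exact star_span hΛ hQ hs hμ hκ h T (fun U hU => (hT1 U hU).1) hT2
  · exact Filter.Eventually.of_forall (star_nonspan hΛ hQ hs hI hS hE hκ hκE h T hT1)

/-- the vertex integral is nonzero -/
theorem IU_E (hΛ : IsFullLattice Λ) (hQ : IsRatInner Λ Q) {s : Vd d}
    (hs : IsRatPoint Λ s) {E : Submodule ℝ (Vd d)} (hE : RatSub Λ E) {κ : Set (Vd d)}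
    (hκ : IsRatCone (dualLattice Λ) κ) (hκE : κ ⊆ E)
    {I : Set (Vd d) → Vd d → ℝ} (hI : IsIMap (LatE Λ Q E) I) (ξ : Vd d) :
    IU Q I s E κ E ξ = Real.exp ⟪ξ, pE Q E s⟫ := by
  have hWE : WE Q E ⊓ Eᗮ = ⊥ := by
    rw [eq_bot_iff]
    rintro x ⟨h1, h2⟩
    exact W_zero hQ h1 ((Submodule.mem_orthogonal _ _).1 h2)
  have hcn : cn Q E κ E = {0} := by
    ext x
    constructor
    · intro hx
      have : x ∈ WE Q E ⊓ Eᗮ := ⟨hx.1, hx.2.2⟩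
      rw [hWE] at this
      exact this
    · rintro rfl
      refine ⟨Submodule.zero_mem _, ?_, Submodule.zero_mem _⟩
      intro g _
      simp [pairE]
  have hPE : PE Q s E κ E = {pE Q E s} := by
    ext x
    change x - pE Q E s ∈ cn Q E κ E ↔ _
    rw [hcn]
    simp [sub_eq_zero]
  have hpoly := PE_poly hΛ hQ hs hE le_rfl hκ hκE
  rw [IU, if_pos (by rw [hcn, hWE]; simp)]
  rw [hPE] at hpoly ⊢
  let m : Measure (Vd d) := Measure.map (fun t : Fin 0 → ℝ => pE Q E s + ∑ i, t i • (Fin.elim0 i : Vd d)) volume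
  have hm : m = Measure.dirac (pE Q E s) := by
    have : (volume : Measure (Fin 0 → ℝ)) = Measure.dirac (fun i => Fin.elim0 i) := by
      rw [volume_pi, Measure.pi_of_empty]
      congr 1
    simp only [m, this, Finset.univ_eq_empty, Finset.sum_empty, add_zero]
    exact Measure.map_dirac' measurable_const _
  have h := hI.2.2 _ hpoly m ⟨0, pE Q E s, fun i => Fin.elim0 i, by simp, fun i => i.elim0,
    linearIndependent_empty_type, by ext x; simp, by
      intro y _ hy
      have : y = 0 := by simpa using hy
      exact ⟨fun i => i.elim0, by simp [this]⟩, rfl⟩ ξ (by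
        rw [hm]
        apply Integrable.integrableOn
        exact integrable_dirac (by simp))
  rw [h, hm]
  simp [pairE]

end star2

open MeasureTheory Filter Topology Set
open scoped RealInnerProductSpace Pointwise BigOperators

section cutclaim

variable {d : ℕ} {Λ : AddSubgroup (Vd d)} {Q : Vd d →ₗ[ℝ] Vd d →ₗ[ℝ] ℝ}

theorem MU_congr {μ : AddSubgroup (Vd d) → Set (Vd d) → Vd d → ℝ} {s : Vd d}
    {U : Submodule ℝ (Vd d)} {κ κ' : Set (Vd d)} (h : κ ∩ U = κ' ∩ U) (ξ : Vd d) :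
    MU Λ Q μ s U κ ξ = MU Λ Q μ s U κ' ξ := by
  rw [MU, MU, h]

theorem IU_congr {I : Set (Vd d) → Vd d → ℝ} {s : Vd d}
    {E U : Submodule ℝ (Vd d)} {κ κ' : Set (Vd d)} (h : cn Q E κ U = cn Q E κ' U) (ξ : Vd d) :
    IU Q I s E κ U ξ = IU Q I s E κ' U ξ := by
  rw [IU, IU, PE, PE, h]

theorem cn_half {κ : Set (Vd d)} (hκ : IsRatCone (dualLattice Λ) κ) {η : Vd d}
    {E U : Submodule ℝ (Vd d)} (hU : Submodule.span ℝ (κ ∩ hp η ∩ U) = U)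
    (hη : ¬ ∀ u ∈ U, ⟪η, u⟫ = 0) : cn Q E (κ ∩ hp η) U = cn Q E κ U := by
  ext x
  constructor
  · rintro ⟨h1, h2, h3⟩
    refine ⟨h1, ?_, h3⟩
    have : ∃ g ∈ κ ∩ hp η ∩ U, ⟪η, g⟫ ≠ 0 := by
      by_contra hno
      push Not at hno
      apply hη
      intro u hu
      have : η ∈ (Submodule.span ℝ (κ ∩ hp η ∩ U))ᗮ := by
        rw [mem_orth_span]
        intro v hv
        rw [real_inner_comm]
        exact hno v hv
      rw [hU, Submodule.mem_orthogonal] at this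
      rw [real_inner_comm]
      exact this u hu
    obtain ⟨g, hg, hg0⟩ := this
    have hpos : 0 < ⟪η, g⟫ := lt_of_le_of_ne hg.1.2 (Ne.symm hg0)
    intro y hy
    have ht : 0 ≤ |⟪η, y⟫| / ⟪η, g⟫ := by positivity
    have hmem : y + (|⟪η, y⟫| / ⟪η, g⟫) • g ∈ κ ∩ hp η := by
      refine ⟨rc_add hκ hy (rc_smul hκ ht hg.1.1), ?_⟩
      change 0 ≤ ⟪η, _⟫
      rw [inner_add_right, inner_smul_right, div_mul_cancel₀ _ hg0]
      linarith [neg_abs_le ⟪η, y⟫]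
    have h4 : 0 ≤ ⟪y + (|⟪η, y⟫| / ⟪η, g⟫) • g, x⟫ := h2 _ hmem
    have h5 : ⟪g, x⟫ = 0 := (Submodule.mem_orthogonal _ _).1 h3 g hg.2
    rw [inner_add_left, real_inner_smul_left, h5, mul_zero, add_zero] at h4
    exact h4
  · rintro ⟨h1, h2, h3⟩
    exact ⟨h1, fun g hg => h2 g hg.1, h3⟩

theorem MU_IU_half {μ : AddSubgroup (Vd d) → Set (Vd d) → Vd d → ℝ} {s : Vd d}
    {I : Set (Vd d) → Vd d → ℝ}
    {κ : Set (Vd d)} (hκ : IsRatCone (dualLattice Λ) κ) {η : Vd d}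
    {E U : Submodule ℝ (Vd d)} (hη : ¬ ∀ u ∈ U, ⟪η, u⟫ = 0) (ξ : Vd d) :
    MU Λ Q μ s U (κ ∩ hp η) ξ * IU Q I s E (κ ∩ hp η) U ξ =
      MU Λ Q μ s U (κ ∩ hp η) ξ * IU Q I s E κ U ξ := by
  by_cases h : Submodule.span ℝ (κ ∩ hp η ∩ U) = U
  · rw [IU_congr (cn_half hκ h hη)]
  · rw [MU, if_neg h, zero_mul, zero_mul]

theorem hp_pm {η x : Vd d} (h1 : x ∈ hp η) (h2 : x ∈ hp (-η)) : ⟪η, x⟫ = 0 := by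
  have h1 : 0 ≤ ⟪η, x⟫ := h1
  have h2 : 0 ≤ ⟪-η, x⟫ := h2
  rw [inner_neg_left] at h2
  linarith

theorem MU_zero {μ : AddSubgroup (Vd d) → Set (Vd d) → Vd d → ℝ} {s : Vd d}
    {κ : Set (Vd d)} {η : Vd d}
    {U : Submodule ℝ (Vd d)} (hη : ¬ ∀ u ∈ U, ⟪η, u⟫ = 0) (ξ : Vd d) :
    MU Λ Q μ s U (κ ∩ hp η ∩ hp (-η)) ξ = 0 := by
  rw [MU, if_neg]
  intro h
  apply hη
  intro u hu
  have : η ∈ (Submodule.span ℝ (κ ∩ hp η ∩ hp (-η) ∩ U))ᗮ := by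
    rw [mem_orth_span]
    intro v hv
    rw [real_inner_comm]
    exact hp_pm hv.1.1.2 hv.1.2
  rw [h, Submodule.mem_orthogonal] at this
  rw [real_inner_comm]
  exact this u hu

theorem MU_cut (hΛ : IsFullLattice Λ) (hQ : IsRatInner Λ Q) {s : Vd d}
    (hs : IsRatPoint Λ s)
    {I S μ : AddSubgroup (Vd d) → Set (Vd d) → Vd d → ℝ}
    (hI : IsIFamily Q Λ I) (hS : IsSFamily Q Λ S) (hμ : IsMuFamily Λ Q I S μ)
    {η : Vd d} (hη : η ∈ Λ) (n : ℕ) :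
    ∀ (E : Submodule ℝ (Vd d)), RatSub Λ E → Module.finrank ℝ E = n → ∀ (κ : Set (Vd d)),
    IsRatCone (dualLattice Λ) κ → ∀ᶠ ξ in mf d,
      MU Λ Q μ s E (κ ∩ hp η) ξ + MU Λ Q μ s E (κ ∩ hp (-η)) ξ =
      MU Λ Q μ s E (κ ∩ hp η ∩ hp (-η)) ξ + MU Λ Q μ s E κ ξ := by
  classical
  induction n using Nat.strong_induction_on with
  | _ n ih =>
  intro E hE hn
  -- reduce to cones inside `E`
  suffices H : ∀ κ : Set (Vd d), κ ⊆ E → IsRatCone (dualLattice Λ) κ → ∀ᶠ ξ in mf d,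
      MU Λ Q μ s E (κ ∩ hp η) ξ + MU Λ Q μ s E (κ ∩ hp (-η)) ξ =
      MU Λ Q μ s E (κ ∩ hp η ∩ hp (-η)) ξ + MU Λ Q μ s E κ ξ by
    intro κ hκ
    filter_upwards [H (κ ∩ E) inter_subset_right (rc_inter hΛ hκ (ratSub_rc hE))] with ξ hξ
    rw [MU_congr (κ := κ ∩ hp η) (κ' := κ ∩ E ∩ hp η) (by ext x; simp; tauto),
      MU_congr (κ := κ ∩ hp (-η)) (κ' := κ ∩ E ∩ hp (-η)) (by ext x; simp; tauto),
      MU_congr (κ := κ ∩ hp η ∩ hp (-η)) (κ' := κ ∩ E ∩ hp η ∩ hp (-η)) (by ext x; simp; tauto),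
      MU_congr (κ := κ) (κ' := κ ∩ E) (by ext x; simp)]
    exact hξ
  intro κ hκE hκ
  have r1 := rc_inter hΛ hκ (hp_rc hΛ hη)
  have r2 := rc_inter hΛ hκ (hp_rc hΛ (neg_mem hη))
  have r3 := rc_inter hΛ r1 (hp_rc hΛ (neg_mem hη))
  have e1 : κ ∩ hp η ⊆ E := inter_subset_left.trans hκE
  have e2 : κ ∩ hp (-η) ⊆ E := inter_subset_left.trans hκE
  have e3 : κ ∩ hp η ∩ hp (-η) ⊆ E := inter_subset_left.trans e1
  have hq := LatE_quot hΛ hQ hE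
  have hbot : RatSub Λ ⊥ := ⟨[], by simp, by simp⟩
  let T : Finset (Submodule ℝ (Vd d)) := insert E ((VV_finite hQ hκ hκE).toFinset ∪
    (VV_finite hQ r1 e1).toFinset ∪ (VV_finite hQ r2 e2).toFinset ∪ (VV_finite hQ r3 e3).toFinset)
  have hT : ∀ U ∈ T, U ≤ E ∧ RatSub Λ U := by
    intro U hU
    simp only [T, Finset.mem_insert, Finset.mem_union, Set.Finite.mem_toFinset] at hU
    rcases hU with rfl | ((hU | hU) | hU) | hU
    · exact ⟨le_rfl, hE⟩
    · exact ⟨hU.1, VV_rat hQ hκ hκE U hU⟩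
    · exact ⟨hU.1, VV_rat hQ r1 e1 U hU⟩
    · exact ⟨hU.1, VV_rat hQ r2 e2 U hU⟩
    · exact ⟨hU.1, VV_rat hQ r3 e3 U hU⟩
  have s0 := star hΛ hQ hs hI hS hμ hE hκ hκE T hT (fun U hU => by simp [T, hU])
  have s1 := star hΛ hQ hs hI hS hμ hE r1 e1 T hT (fun U hU => by simp [T, hU])
  have s2 := star hΛ hQ hs hI hS hμ hE r2 e2 T hT (fun U hU => by simp [T, hU])
  have s3 := star hΛ hQ hs hI hS hμ hE r3 e3 T hT (fun U hU => by simp [T, hU])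
  have sc := S_cut hΛ hQ hs hE hbot bot_le hκ hκE (hS _ hq) hη
  let J := I (LatE Λ Q E)
  have hterm : ∀ U ∈ T.erase E, ∀ᶠ ξ in mf d,
      MU Λ Q μ s U (κ ∩ hp η) ξ * IU Q J s E (κ ∩ hp η) U ξ +
      MU Λ Q μ s U (κ ∩ hp (-η)) ξ * IU Q J s E (κ ∩ hp (-η)) U ξ =
      MU Λ Q μ s U (κ ∩ hp η ∩ hp (-η)) ξ * IU Q J s E (κ ∩ hp η ∩ hp (-η)) U ξ +
      MU Λ Q μ s U κ ξ * IU Q J s E κ U ξ := by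
    intro U hU
    rw [Finset.mem_erase] at hU
    obtain ⟨hUE, hUR⟩ := hT U hU.2
    by_cases hz : ∀ u ∈ U, ⟪η, u⟫ = 0
    · have ic := I_cut hΛ hQ hs hE hUR hUE hκ hκE (hI _ hq) hη
      filter_upwards [ic] with ξ hξ
      have hp1 : ∀ u ∈ U, u ∈ hp η := fun u hu => (hz u hu).ge
      have hp2 : ∀ u ∈ U, u ∈ hp (-η) := fun u hu => by
        change 0 ≤ ⟪-η, u⟫
        rw [inner_neg_left, hz u hu, neg_zero]
      rw [MU_congr (κ := κ ∩ hp η) (κ' := κ) (by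
          ext x; constructor
          · exact fun h => ⟨h.1.1, h.2⟩
          · exact fun h => ⟨⟨h.1, hp1 x h.2⟩, h.2⟩),
        MU_congr (κ := κ ∩ hp (-η)) (κ' := κ) (by
          ext x; constructor
          · exact fun h => ⟨h.1.1, h.2⟩
          · exact fun h => ⟨⟨h.1, hp2 x h.2⟩, h.2⟩),
        MU_congr (κ := κ ∩ hp η ∩ hp (-η)) (κ' := κ) (by
          ext x; constructor
          · exact fun h => ⟨h.1.1.1, h.2⟩
          · exact fun h => ⟨⟨⟨h.1, hp1 x h.2⟩, hp2 x h.2⟩, h.2⟩)]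
      rw [← mul_add, ← mul_add]
      exact congrArg _ hξ
    · have hlt : Module.finrank ℝ U < n := by
        rw [← hn]
        exact Submodule.finrank_lt_finrank_of_lt (lt_of_le_of_ne hUE hU.1)
      filter_upwards [ih _ hlt U hUR rfl κ hκ] with ξ hξ
      have hz' : ¬ ∀ u ∈ U, ⟪-η, u⟫ = 0 := by
        intro h
        apply hz
        intro u hu
        have := h u hu
        rwa [inner_neg_left, neg_eq_zero] at this
      rw [MU_IU_half hκ hz, MU_IU_half hκ hz', ← add_mul, hξ, MU_zero hz]
      ring
  rw [← Filter.eventually_all_finset] at hterm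
  filter_upwards [s0, s1, s2, s3, sc, hterm] with ξ h0 h1 h2 h3 hc ht
  rw [h0, h1, h2, h3, ← Finset.sum_add_distrib, ← Finset.sum_add_distrib] at hc
  have hET : E ∈ T := Finset.mem_insert_self _ _
  rw [← Finset.add_sum_erase T _ hET, ← Finset.add_sum_erase T _ hET,
    Finset.sum_congr rfl ht, add_left_inj] at hc
  rw [IU_E hΛ hQ hs hE hκ hκE (hI _ hq), IU_E hΛ hQ hs hE r1 e1 (hI _ hq),
    IU_E hΛ hQ hs hE r2 e2 (hI _ hq), IU_E hΛ hQ hs hE r3 e3 (hI _ hq),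
    ← add_mul, ← add_mul] at hc
  exact mul_right_cancel₀ (Real.exp_pos _).ne' hc

end cutclaim

open MeasureTheory Filter Topology Set
open scoped RealInnerProductSpace Pointwise BigOperators

section comb

variable {d : ℕ} {Λ : AddSubgroup (Vd d)} {Q : Vd d →ₗ[ℝ] Vd d →ₗ[ℝ] ℝ}

theorem cover_sub {κ : Set (Vd d)} (h0 : (0 : Vd d) ∈ κ)
    (hadd : ∀ x ∈ κ, ∀ y ∈ κ, x + y ∈ κ) (hsm : ∀ c : ℝ, 0 ≤ c → ∀ x ∈ κ, c • x ∈ κ)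
    (A : Finset (Submodule ℝ (Vd d))) (hA : ∀ x ∈ κ, ∃ U ∈ A, x ∈ U) :
    ∃ U ∈ A, κ ⊆ U := by
  classical
  induction A using Finset.induction_on with
  | empty =>
    obtain ⟨U, hU, _⟩ := hA 0 h0
    exact absurd hU (Finset.notMem_empty U)
  | insert U₁ A hU₁ ih =>
    by_cases h1 : κ ⊆ U₁
    · exact ⟨U₁, Finset.mem_insert_self _ _, h1⟩
    by_cases h2 : ∀ x ∈ κ, ∃ U ∈ A, x ∈ U
    · obtain ⟨U, hU, h⟩ := ih h2
      exact ⟨U, Finset.mem_insert_of_mem hU, h⟩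
    exfalso
    rw [Set.not_subset] at h1
    obtain ⟨x, hx, hx1⟩ := h1
    push Not at h2
    obtain ⟨y, hy, hy2⟩ := h2
    have hy1 : y ∈ U₁ := by
      obtain ⟨U, hU, hyU⟩ := hA y hy
      rcases Finset.mem_insert.1 hU with rfl | hU
      · exact hyU
      · exact absurd hyU (hy2 U hU)
    have h3 : ∀ n : ℕ, ∃ U : A, x + (n : ℝ) • y ∈ (U : Submodule ℝ (Vd d)) := by
      intro n
      obtain ⟨U, hU, h⟩ := hA _ (hadd x hx _ (hsm n (Nat.cast_nonneg n) y hy))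
      rcases Finset.mem_insert.1 hU with rfl | hU
      · exact absurd ((Submodule.add_mem_iff_left _ (Submodule.smul_mem _ _ hy1)).1 h) hx1
      · exact ⟨⟨U, hU⟩, h⟩
    choose f hf using h3
    obtain ⟨m, n, hmn, he⟩ := Finite.exists_ne_map_eq_of_infinite f
    have h4 := Submodule.sub_mem _ (hf m) (he ▸ hf n)
    rw [add_sub_add_left_eq_sub, ← sub_smul] at h4
    have hne : ((m : ℝ) - n) ≠ 0 := by
      rw [sub_ne_zero]; exact_mod_cast hmn
    have h5 := Submodule.smul_mem _ ((m : ℝ) - n)⁻¹ h4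
    rw [smul_smul, inv_mul_cancel₀ hne, one_smul] at h5
    exact hy2 _ (f m).2 h5

theorem face_all {E : Submodule ℝ (Vd d)} {κ τ τ' : Set (Vd d)} (h0 : (0 : Vd d) ∈ κ)
    (hκE : Submodule.span ℝ κ = E) (h1 : κ ⊆ τ) (h2 : κ ⊆ τ') (hτ : τ ⊆ E)
    (hF : IsFaceOf τ (τ ∩ τ')) : τ ⊆ τ' := by
  obtain ⟨-, φ, hφ⟩ := hF
  have hm : ∀ x ∈ κ, ∀ y ∈ τ, ⟪φ, y⟫ ≤ ⟪φ, x⟫ := by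
    intro x hx
    have : x ∈ τ ∩ τ' := ⟨h1 hx, h2 hx⟩
    rw [hφ] at this
    exact this.2
  have hz : ∀ x ∈ κ, ⟪φ, x⟫ = 0 := by
    intro x hx
    have a := hm x hx 0 (h1 h0)
    have b := hm 0 h0 x (h1 hx)
    rw [inner_zero_right] at a b
    linarith
  have hzE : φ ∈ Eᗮ := by
    rw [← hκE, mem_orth_span]
    intro v hv
    rw [real_inner_comm]; exact hz v hv
  have hE : ∀ x ∈ τ, ⟪φ, x⟫ = 0 := by
    intro x hx
    rw [real_inner_comm]
    exact (Submodule.mem_orthogonal _ _).1 hzE x (hτ hx)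
  intro x hx
  have : x ∈ τ ∩ τ' := by
    rw [hφ]
    refine ⟨hx, fun y hy => ?_⟩
    change ⟪φ, y⟫ ≤ ⟪φ, x⟫
    rw [hE x hx, hE y hy]
  exact this.2

theorem MU_not {μ : AddSubgroup (Vd d) → Set (Vd d) → Vd d → ℝ} {s : Vd d}
    {U : Submodule ℝ (Vd d)} {κ : Set (Vd d)} (hκ : κ ⊆ U) (h : Submodule.span ℝ κ ≠ U)
    (ξ : Vd d) : MU Λ Q μ s U κ ξ = 0 := by
  rw [MU, if_neg]
  rwa [inter_eq_left.2 hκ]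

theorem comb_main (hΛ : IsFullLattice Λ) (hQ : IsRatInner Λ Q) {s : Vd d}
    (hs : IsRatPoint Λ s)
    {I S μ : AddSubgroup (Vd d) → Set (Vd d) → Vd d → ℝ}
    (hI : IsIFamily Q Λ I) (hS : IsSFamily Q Λ S) (hμ : IsMuFamily Λ Q I S μ)
    {σ : Set (Vd d)} (hσ : IsRatCone (dualLattice Λ) σ)
    (C : Finset (Set (Vd d)))
    (hC₁ : ∀ c ∈ C, IsRatCone (dualLattice Λ) c)
    (hC₃ : ∀ c₁ ∈ C, ∀ c₂ ∈ C, IsFaceOf c₁ (c₁ ∩ c₂) ∧ IsFaceOf c₂ (c₁ ∩ c₂))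
    (hC₄ : (⋃ c ∈ C, c) = σ) (D : Finset (Set (Vd d)))
    (hD : ∀ τ, τ ∈ D ↔ τ ∈ C ∧ Submodule.span ℝ τ = Submodule.span ℝ σ) :
    ∀ᶠ ξ in mf d, MU Λ Q μ s (Submodule.span ℝ σ) σ ξ =
      ∑ τ ∈ D, MU Λ Q μ s (Submodule.span ℝ σ) (σ ∩ τ) ξ := by
  classical
  set E := Submodule.span ℝ σ with hE
  have hER : RatSub Λ E := ratSub_span hσ
  have hσE : σ ⊆ E := Submodule.subset_span
  have hCσ : ∀ τ ∈ C, τ ⊆ σ := by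
    intro τ hτ
    rw [← hC₄]
    exact Set.subset_biUnion_of_mem (u := fun c : Set (Vd d) => c) hτ
  -- the list of all inequalities
  obtain ⟨H, hH1, hH2⟩ : ∃ H : List (Vd d), (∀ g ∈ H, g ∈ Λ) ∧
      ∀ τ ∈ C, ∃ h : List (Vd d), (∀ g ∈ h, g ∈ H) ∧ τ = hset h := by
    have : ∀ τ : Set (Vd d), ∃ h : List (Vd d), τ ∈ C → (∀ g ∈ h, g ∈ Λ) ∧ τ = hset h := by
      intro τ
      by_cases hτ : τ ∈ C
      · obtain ⟨h, h1⟩ := rc_H hΛ (hC₁ τ hτ)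
        exact ⟨h, fun _ => h1⟩
      · exact ⟨[], fun h => absurd h hτ⟩
    choose f hf using this
    refine ⟨C.toList.flatMap f, ?_, ?_⟩
    · intro g hg
      obtain ⟨τ, hτ, hg⟩ := List.mem_flatMap.1 hg
      exact (hf τ (Finset.mem_toList.1 hτ)).1 g hg
    · intro τ hτ
      exact ⟨f τ, fun g hg => List.mem_flatMap.2 ⟨τ, Finset.mem_toList.2 hτ, hg⟩, (hf τ hτ).2⟩
  have main : ∀ L : List (Vd d), (∀ g ∈ L, g ∈ Λ) → ∀ κ : Set (Vd d),
      IsRatCone (dualLattice Λ) κ → κ ⊆ σ →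
      (∀ g ∈ H, g ∈ L ∨ κ ⊆ hp g ∨ κ ⊆ hp (-g)) →
      ∀ᶠ ξ in mf d, MU Λ Q μ s E κ ξ = ∑ τ ∈ D, MU Λ Q μ s E (κ ∩ τ) ξ := by
    intro L
    induction L with
    | nil =>
      intro _ κ hκ hκσ hsign
      apply Filter.Eventually.of_forall
      intro ξ
      by_cases hsp : Submodule.span ℝ κ = E
      swap
      · rw [MU_not (hκσ.trans hσE) hsp]
        symm
        apply Finset.sum_eq_zero
        intro τ hτ
        apply MU_not (inter_subset_left.trans (hκσ.trans hσE))
        intro h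
        apply hsp
        apply le_antisymm (Submodule.span_le.2 (hκσ.trans hσE))
        rw [← h]
        exact Submodule.span_mono inter_subset_left
      have hdich : ∀ τ ∈ C, κ ⊆ τ ∨ Submodule.span ℝ (κ ∩ τ) ≠ E := by
        intro τ hτ
        by_contra hno
        push Not at hno
        obtain ⟨hn1, hn2⟩ := hno
        obtain ⟨h, hh, rfl⟩ := hH2 τ hτ
        apply hn1
        intro x hx g hg
        rcases hsign g (hh g hg) with h' | h' | h'
        · exact absurd h' List.not_mem_nil
        · exact h' hx
        · have : g ∈ Eᗮ := by
            rw [← hn2, mem_orth_span]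
            intro v hv
            rw [real_inner_comm]
            exact hp_pm (hv.2 g hg) (h' hv.1)
          rw [Submodule.mem_orthogonal] at this
          have := this x (hσE (hκσ hx))
          rw [real_inner_comm] at this
          exact this.ge
      obtain ⟨τ₀, hτ₀, hκτ₀⟩ : ∃ τ ∈ D, κ ⊆ τ := by
        obtain ⟨U, hU, hκU⟩ := cover_sub (rc_zero hκ) (fun x hx y hy => rc_add hκ hx hy)
          (fun c hc x hx => rc_smul hκ hc hx) (C.image fun τ => Submodule.span ℝ (κ ∩ τ)) (by
            intro x hx
            have := hκσ hx
            rw [← hC₄] at this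
            simp only [mem_iUnion] at this
            obtain ⟨τ, hτ, hxτ⟩ := this
            exact ⟨_, Finset.mem_image_of_mem _ hτ, Submodule.subset_span ⟨hx, hxτ⟩⟩)
        obtain ⟨τ, hτ, rfl⟩ := Finset.mem_image.1 hU
        have hle : Submodule.span ℝ (κ ∩ τ) = E := by
          apply le_antisymm (Submodule.span_le.2 (inter_subset_left.trans (hκσ.trans hσE)))
          rw [← hsp, Submodule.span_le]
          exact hκU
        have hκτ : κ ⊆ τ := by
          rcases hdich τ hτ with h | h
          · exact h
          · exact absurd hle h
        refine ⟨τ, (hD τ).2 ⟨hτ, le_antisymm (Submodule.span_mono (hCσ τ hτ)) ?_⟩, hκτ⟩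
        rw [← hsp]
        exact Submodule.span_mono hκτ
      have hτ₀C := ((hD τ₀).1 hτ₀).1
      rw [Finset.sum_eq_single τ₀]
      · rw [inter_eq_left.2 hκτ₀]
      · intro τ hτ hne
        have hτC := ((hD τ).1 hτ).1
        apply MU_not (inter_subset_left.trans (hκσ.trans hσE))
        rcases hdich τ hτC with h | h
        · exfalso
          apply hne
          apply Subset.antisymm
          · exact face_all (rc_zero hκ) hsp h hκτ₀ ((hCσ τ hτC).trans hσE) (hC₃ τ hτC τ₀ hτ₀C).1
          · exact face_all (rc_zero hκ) hsp hκτ₀ h ((hCσ τ₀ hτ₀C).trans hσE)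
              (hC₃ τ₀ hτ₀C τ hτC).1
        · exact h
      · exact fun h => absurd hτ₀ h
    | cons η L ih =>
      intro hL κ hκ hκσ hsign
      have hη : η ∈ Λ := hL η List.mem_cons_self
      have ih' := ih (fun g hg => hL g (List.mem_cons_of_mem _ hg))
      have r1 := rc_inter hΛ hκ (hp_rc hΛ hη)
      have r2 := rc_inter hΛ hκ (hp_rc hΛ (neg_mem hη))
      have r3 := rc_inter hΛ r1 (hp_rc hΛ (neg_mem hη))
      have hs' : ∀ κ' ⊆ κ, (κ' ⊆ hp η ∨ κ' ⊆ hp (-η)) →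
          ∀ g ∈ H, g ∈ L ∨ κ' ⊆ hp g ∨ κ' ⊆ hp (-g) := by
        intro κ' hκ' hc g hg
        rcases hsign g hg with h | h | h
        · rcases List.mem_cons.1 h with rfl | h
          · exact Or.inr hc
          · exact Or.inl h
        · exact Or.inr (Or.inl (hκ'.trans h))
        · exact Or.inr (Or.inr (hκ'.trans h))
      have i1 := ih' _ r1 (inter_subset_left.trans hκσ)
        (hs' _ inter_subset_left (Or.inl inter_subset_right))
      have i2 := ih' _ r2 (inter_subset_left.trans hκσ)
        (hs' _ inter_subset_left (Or.inr inter_subset_right))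
      have i3 := ih' _ r3 ((inter_subset_left.trans inter_subset_left).trans hκσ)
        (hs' _ (inter_subset_left.trans inter_subset_left) (Or.inr inter_subset_right))
      have c0 := MU_cut hΛ hQ hs hI hS hμ hη _ E hER rfl κ hκ
      have cτ : ∀ τ ∈ D, ∀ᶠ ξ in mf d,
          MU Λ Q μ s E (κ ∩ hp η ∩ τ) ξ + MU Λ Q μ s E (κ ∩ hp (-η) ∩ τ) ξ =
          MU Λ Q μ s E (κ ∩ hp η ∩ hp (-η) ∩ τ) ξ + MU Λ Q μ s E (κ ∩ τ) ξ := by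
        intro τ hτ
        have := MU_cut hΛ hQ hs hI hS hμ hη _ E hER rfl (κ ∩ τ)
          (rc_inter hΛ hκ (hC₁ τ ((hD τ).1 hτ).1))
        rw [inter_right_comm κ (hp η) τ, inter_right_comm κ (hp (-η)) τ,
          inter_right_comm (κ ∩ hp η) (hp (-η)) τ, inter_right_comm κ (hp η) τ]
        exact this
      rw [← Filter.eventually_all_finset] at cτ
      filter_upwards [i1, i2, i3, c0, cτ] with ξ h1 h2 h3 h4 h5
      have h6 := Finset.sum_congr rfl h5
      rw [Finset.sum_add_distrib, Finset.sum_add_distrib, ← h1, ← h2, ← h3, h4] at h6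
      exact add_left_cancel h6
  exact main H hH1 σ hσ Subset.rfl (fun g hg => Or.inl hg)

end comb

/-- for a rational cone `σ` in `V^*`, a subdivision `{σ'}` of `σ` and a
rational point `s`, `μ_s^*(σ) = ∑_{dim σ' = dim σ} μ_s^*(σ')`, where
`μ_s^*(τ) = μ(π_{<τ>^⊥}(s + τ^*))`, the projection `π_{<τ>^⊥} : V → V/<τ>^⊥` being
realized by the `Q`-orthogonal projection along the annihilator `<τ>^⊥` of the span of
`τ`. -/
theorem statement14 (d : ℕ) (Λ : AddSubgroup (Vd d)) (hΛ : IsFullLattice Λ)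
    (Q : Vd d →ₗ[ℝ] Vd d →ₗ[ℝ] ℝ) (hQ : IsRatInner Λ Q)
    (I S μ : AddSubgroup (Vd d) → Set (Vd d) → Vd d → ℝ)
    (hI : IsIFamily Q Λ I) (hS : IsSFamily Q Λ S) (hμ : IsMuFamily Λ Q I S μ)
    (σ : Set (Vd d)) (hσ : IsRatCone (dualLattice Λ) σ)
    (C : Finset (Set (Vd d)))
    (hC₁ : ∀ c ∈ C, IsRatCone (dualLattice Λ) c)
    (hC₂ : ∀ c ∈ C, ∀ F, IsFaceOf c F → F ∈ C)
    (hC₃ : ∀ c₁ ∈ C, ∀ c₂ ∈ C, IsFaceOf c₁ (c₁ ∩ c₂) ∧ IsFaceOf c₂ (c₁ ∩ c₂))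
    (hC₄ : (⋃ c ∈ C, c) = σ)
    (s : Vd d) (hs : IsRatPoint Λ s)
    (π : Set (Vd d) → (Vd d →ₗ[ℝ] Vd d))
    (hπ : ∀ τ : Set (Vd d), τ ∈ C ∨ τ = σ →
      IsQCoproj Q ((Submodule.span ℝ τ)ᗮ) (π τ)) :
    MeroEqAt0
      (fun ξ => μ (AddSubgroup.map (π σ).toAddMonoidHom Λ)
        ((π σ) '' ((fun x => s + x) '' dualConeSet σ)) ξ)
      (fun ξ => ∑ᶠ τ ∈ {τ | τ ∈ C ∧
          Module.finrank ℝ (Submodule.span ℝ τ) = Module.finrank ℝ (Submodule.span ℝ σ)},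
        μ (AddSubgroup.map (π τ).toAddMonoidHom Λ)
          ((π τ) '' ((fun x => s + x) '' dualConeSet τ)) ξ) := by
  classical
  have hCσ : ∀ τ ∈ C, τ ⊆ σ := by
    intro τ hτ
    rw [← hC₄]
    exact Set.subset_biUnion_of_mem (u := fun c : Set (Vd d) => c) hτ
  let D := C.filter (fun τ => Submodule.span ℝ τ = Submodule.span ℝ σ)
  have hD : ∀ τ, τ ∈ D ↔ τ ∈ C ∧ Submodule.span ℝ τ = Submodule.span ℝ σ := by
    intro τ; simp [D]
  have hset : {τ | τ ∈ C ∧ Module.finrank ℝ (Submodule.span ℝ τ) =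
      Module.finrank ℝ (Submodule.span ℝ σ)} = (D : Set (Set (Vd d))) := by
    ext τ
    rw [Finset.mem_coe, hD]
    constructor
    · rintro ⟨h1, h2⟩
      exact ⟨h1, Submodule.eq_of_le_of_finrank_eq (Submodule.span_mono (hCσ τ h1)) h2⟩
    · rintro ⟨h1, h2⟩
      exact ⟨h1, by rw [h2]⟩
  have hval : ∀ τ : Set (Vd d), τ ∈ C ∨ τ = σ → Submodule.span ℝ τ = Submodule.span ℝ σ →
      ∀ ξ, MU Λ Q μ s (Submodule.span ℝ σ) τ ξ = μ (AddSubgroup.map (π τ).toAddMonoidHom Λ)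
          ((π τ) '' ((fun x => s + x) '' dualConeSet τ)) ξ := by
    intro τ hτ hsp ξ
    have h1 : π τ = pE Q (Submodule.span ℝ τ) := qp_unique hQ.2.1 (hπ τ hτ) (qp_spec hQ _)
    rw [← hsp, MU, inter_eq_left.2 Submodule.subset_span, if_pos rfl, h1]
    rfl
  rw [meroEq_iff]
  have hmain := comb_main hΛ hQ hs hI hS hμ hσ C hC₁ hC₃ hC₄ D hD
  rw [hset]
  filter_upwards [hmain] with ξ hξ
  rw [← hval σ (Or.inr rfl) rfl, hξ]
  refine Eq.trans ?_ (finsum_mem_coe_finset _ _).symm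
  apply Finset.sum_congr rfl
  intro τ hτ
  obtain ⟨h1, h2⟩ := (hD τ).1 hτ
  rw [inter_eq_right.2 (hCσ τ h1), hval τ (Or.inl h1) h2]
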